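/- For every positive integer k there exist an integer C₀ and constants α, β ∈ (0,1) such that the following holds. Let D be a digraph on n ≥ C₀k vertices with minimum semi-degree δ⁰(D) ≥ n/2 + k, and let S = {x_1, …, x_k} be any set of k vertices of D. Then for any integer partition n = n_1 + ⋯ + n_k with n_i ≥ 4 for each i ∈ {1, …, k} and with the sum of those n_i that are less than βn at most αn, D contains k vertex-disjoint directed cycles C_1, …, C_k of lengths n_1, …, n_k respectively, such that V(C_i) ∩ S = {x_i} for all i ∈ {1, …, k}. -/

import Mathlib

open scoped Classical

/-- The out-degree of a vertex `v` in the digraph with arc relation `A`. -/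
noncomputable def outDeg {V : Type*} (A : V → V → Prop) (v : V) : ℕ :=
  {u | A v u}.ncard

/-- The in-degree of a vertex `v` in the digraph with arc relation `A`. -/
noncomputable def inDeg {V : Type*} (A : V → V → Prop) (v : V) : ℕ :=
  {u | A u v}.ncard

/-- `c` is a directed cycle in the digraph with arc relation `A`, recorded as the list of
its vertices in cyclic order (its length is the number of its vertices = arcs). -/
def IsDicycleList {V : Type*} (A : V → V → Prop) (c : List V) : Prop :=
  c ≠ [] ∧ c.Nodup ∧ c.Chain' A ∧ ∀ h : c ≠ [], A (c.getLast h) (c.head h)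


/-- number of consecutive pairs satisfying `P` -/
noncomputable def pc {V : Type*} (P : V → V → Prop) : List V → ℕ
  | [] => 0
  | [_] => 0
  | a :: b :: l => (if P a b then 1 else 0) + pc P (b :: l)

section pcs
variable {V : Type*} {P Q : V → V → Prop}

/-- junction condition -/
def Jn {V : Type*} (P : V → V → Prop) (l₁ l₂ : List V) : Prop :=
  ∀ x ∈ l₁.getLast?, ∀ y ∈ l₂.head?, P x y

lemma pc_cons_le (a : V) (l : List V) : pc P (a :: l) ≤ 1 + pc P l := by
  cases l with
  | nil => simp [pc]
  | cons b l => simp only [pc]; split_ifs <;> omega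

lemma pc_le_cons (a : V) (l : List V) : pc P l ≤ pc P (a :: l) := by
  cases l with
  | nil => simp [pc]
  | cons b l => simp only [pc]; omega

lemma pc_append_le (l₁ l₂ : List V) : pc P (l₁ ++ l₂) ≤ pc P l₁ + 1 + pc P l₂ := by
  induction l₁ with
  | nil => simp
  | cons a l ih =>
    cases l with
    | nil => have := pc_cons_le (P := P) a l₂; simp [pc]; omega
    | cons b l => simp only [List.cons_append, pc] at ih ⊢; omega

lemma pc_append_ge (l₁ l₂ : List V) : pc P l₁ + pc P l₂ ≤ pc P (l₁ ++ l₂) := by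
  induction l₁ with
  | nil => simp [pc]
  | cons a l ih =>
    cases l with
    | nil => have := pc_le_cons (P := P) a l₂; simp [pc]; omega
    | cons b l => simp only [List.cons_append, pc] at ih ⊢; omega

lemma pc_append_jn (l₁ l₂ : List V) (h : Jn (fun a b => ¬ P a b) l₁ l₂) :
    pc P (l₁ ++ l₂) = pc P l₁ + pc P l₂ := by
  induction l₁ with
  | nil => simp [pc]
  | cons a l ih =>
    cases l with
    | nil =>
      cases l₂ with
      | nil => simp [pc]
      | cons b l₂ => simp [Jn] at h; simp [pc, h]
    | cons b l =>
      have h' : Jn (fun a b => ¬ P a b) (b :: l) l₂ := by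
        simpa [Jn, List.getLast?_cons_cons] using h
      have := ih h'
      simp only [List.cons_append, pc] at this ⊢; omega

lemma pc_append_cons (l₁ l₂ : List V) (c d : V) :
    pc P (l₁ ++ c :: d :: l₂) = pc P (l₁ ++ [c]) + (if P c d then 1 else 0) + pc P (d :: l₂) := by
  induction l₁ with
  | nil => simp [pc]
  | cons a l ih =>
    cases l with
    | nil => simp only [List.cons_append, List.nil_append, pc] at ih ⊢; omega
    | cons b l => simp only [List.cons_append, pc] at ih ⊢; omega

lemma pc_exists {l : List V} (h : 1 ≤ pc P l) :
    ∃ l₁ c d l₂, l = l₁ ++ c :: d :: l₂ ∧ P c d := by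
  induction l with
  | nil => simp [pc] at h
  | cons a l ih =>
    cases l with
    | nil => simp [pc] at h
    | cons b l =>
      by_cases hp : P a b
      · exact ⟨[], a, b, l, rfl, hp⟩
      · simp only [pc, hp, if_false, zero_add] at h
        obtain ⟨l₁, c, d, l₂, e, hp⟩ := ih h
        exact ⟨a :: l₁, c, d, l₂, by simp [e], hp⟩

lemma pc_infix_le (l₁ l₂ l₃ : List V) : pc P l₂ ≤ pc P (l₁ ++ l₂ ++ l₃) := by
  have := pc_append_ge (P := P) (l₁ ++ l₂) l₃
  have := pc_append_ge (P := P) l₁ l₂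
  omega

lemma pc_add_not (l : List V) : l.length ≤ pc P l + pc (fun a b => ¬ P a b) l + 1 := by
  induction l with
  | nil => simp
  | cons a l ih =>
    cases l with
    | nil => simp [pc]
    | cons b l =>
      simp only [pc, List.length_cons] at ih ⊢
      by_cases h : P a b <;> simp [h] <;> omega

lemma pc_add_not' (l : List V) (hl : l ≠ []) :
    l.length = pc P l + pc (fun a b => ¬ P a b) l + 1 := by
  induction l with
  | nil => simp at hl
  | cons a l ih =>
    cases l with
    | nil => simp [pc]
    | cons b l =>
      have ih := ih (by simp)
      simp only [pc, List.length_cons] at ih ⊢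
      by_cases h : P a b <;> simp [h] <;> omega

lemma pc_or (l : List V) (h : pc (fun a b => P a b ∧ Q a b) l = 0) :
    pc P l + pc Q l ≤ pc (fun a b => P a b ∨ Q a b) l := by
  induction l with
  | nil => simp [pc]
  | cons a l ih =>
    cases l with
    | nil => simp [pc]
    | cons b l =>
      simp only [pc] at h ih ⊢
      have := ih (by omega)
      by_cases h1 : P a b <;> by_cases h2 : Q a b <;> simp [h1, h2] at h ⊢ <;> omega

lemma pc_left_ge (p : V → Prop) (l : List V) :
    l.countP (fun v => decide (p v)) ≤ pc (fun c _ => p c) l + 1 := by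
  induction l with
  | nil => simp
  | cons a l ih =>
    cases l with
    | nil => simp [pc, List.countP_cons]; split_ifs <;> omega
    | cons b l =>
      rw [List.countP_cons]
      simp only [pc] at ih ⊢
      by_cases h : p a <;> simp [h] <;> omega

lemma pc_right_ge (p : V → Prop) (l : List V) :
    l.countP (fun v => decide (p v)) ≤ pc (fun _ c => p c) l + 1 := by
  induction l with
  | nil => simp
  | cons a l ih =>
    cases l with
    | nil => simp [pc, List.countP_cons]; split_ifs <;> omega
    | cons b l =>
      have h2 : ∀ l : List V, ∀ b, (b::l).countP (fun v => decide (p v)) ≤ pc (fun _ c => p c) (b :: l) + (if p b then 1 else 0) := by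
        intro l
        induction l with
        | nil => intro b; simp [pc, List.countP_cons]
        | cons c l ih =>
          intro b
          have := ih c
          rw [List.countP_cons]
          simp only [pc, decide_eq_true_eq]
          omega
      have := h2 (b :: l) a
      split_ifs at this <;> omega

lemma pc_zero_iff (l : List V) : pc (fun a b => ¬ P a b) l = 0 ↔ l.IsChain P := by
  induction l with
  | nil => simp [pc]
  | cons a l ih =>
    cases l with
    | nil => simp [pc]
    | cons b l =>
      simp only [pc, List.isChain_cons_cons, ← ih]
      by_cases h : P a b <;> simp [h]

lemma countP_nodup (p : V → Prop) (l : List V) (h : l.Nodup) :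
    l.countP (fun v => decide (p v)) = (l.toFinset.filter p).card := by
  rw [List.countP_eq_length_filter, ← List.toFinset_card_of_nodup (h.filter _), List.toFinset_filter]
  simp

/-- splitting off the first chain -/
lemma first_chain (A : V → V → Prop) (l : List V) (h : 1 ≤ pc (fun a b => ¬ A a b) l) :
    ∃ P R, l = P ++ R ∧ P ≠ [] ∧ pc (fun a b => ¬ A a b) P = 0 ∧
      pc (fun a b => ¬ A a b) l = 1 + pc (fun a b => ¬ A a b) R := by
  induction l with
  | nil => simp [pc] at h
  | cons a l ih =>
    cases l with
    | nil => simp [pc] at h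
    | cons b l =>
      by_cases hp : A a b
      · simp only [pc, hp, not_true_eq_false, if_false, zero_add] at h
        obtain ⟨P, R, e, h1, h2, h3⟩ := ih h
        cases P with
        | nil => exact absurd rfl h1
        | cons b' P =>
          simp only [List.cons_append, List.cons.injEq] at e
          obtain ⟨rfl, rfl⟩ := e
          refine ⟨a :: b :: P, R, by simp, by simp, by simp [pc, hp, h2], ?_⟩
          simp only [pc, hp, not_true_eq_false, if_false, zero_add]
          exact h3
      · exact ⟨[a], b :: l, rfl, by simp, by simp [pc], by simp [pc, hp]⟩

lemma short_chain (A : V → V → Prop) (ℓ : ℕ) : ∀ (m : ℕ) (l : List V), l.length ≤ m →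
    l.length < ℓ * pc (fun a b => ¬ A a b) l →
    ∃ B0 P B1, l = B0 ++ P ++ B1 ∧ P ≠ [] ∧ pc (fun a b => ¬ A a b) P = 0 ∧ P.length ≤ ℓ ∧
      pc (fun a b => ¬ A a b) (B0 ++ B1) + 1 ≤ pc (fun a b => ¬ A a b) l := by
  intro m
  induction m with
  | zero =>
    intro l h h2
    have : l = [] := List.length_eq_zero_iff.1 (by omega)
    subst this; simp [pc] at h2
  | succ m ih =>
    intro l hl h
    have h1 : 1 ≤ pc (fun a b => ¬ A a b) l := by
      by_contra h0
      have : pc (fun a b => ¬ A a b) l = 0 := by omega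
      rw [this] at h; omega
    obtain ⟨P, R, e, hP, hc, hR⟩ := first_chain A l h1
    by_cases hle : P.length ≤ ℓ
    · exact ⟨[], P, R, by simpa using e, hP, hc, hle, by simp; omega⟩
    · have hlen : l.length = P.length + R.length := by rw [e]; simp
      obtain ⟨B0, Q, B1, e2, q1, q2, q3, q4⟩ := ih R (by omega) (by rw [hR] at h; nlinarith)
      refine ⟨P ++ B0, Q, B1, by rw [e, e2]; simp, q1, q2, q3, ?_⟩
      have := pc_append_le (P := fun a b => ¬ A a b) P (B0 ++ B1)
      rw [List.append_assoc]; omega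
end pcs


section cover
variable {V : Type*} [Fintype V]

/-- out-neighbourhood -/
noncomputable def outN (A : V → V → Prop) (v : V) : Finset V := Finset.univ.filter (fun u => A v u)
/-- in-neighbourhood -/
noncomputable def inN (A : V → V → Prop) (v : V) : Finset V := Finset.univ.filter (fun u => A u v)
/-- number of arcs from S to T -/
noncomputable def earcs (A : V → V → Prop) (S T : Finset V) : ℕ :=
  ((S ×ˢ T).filter (fun p => A p.1 p.2)).card
/-- the non-extremal property -/
def NProp (A : V → V → Prop) (g : ℕ) : Prop :=
  ∀ S T : Finset V, Fintype.card V ≤ 2 * S.card + 2 * g → Fintype.card V ≤ 2 * T.card + 2 * g →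
    g * Fintype.card V ≤ earcs A S T

/-- U has a Hamilton cycle -/
def HamOn {V : Type*} (A : V → V → Prop) (U : Finset V) : Prop :=
  ∃ c : List V, IsDicycleList A c ∧ c.toFinset = U

@[simp] lemma mem_outN {A : V → V → Prop} {u v : V} : u ∈ outN A v ↔ A v u := by simp [outN]
@[simp] lemma mem_inN {A : V → V → Prop} {u v : V} : u ∈ inN A v ↔ A u v := by simp [inN]

/-- cost of an ordering -/
noncomputable abbrev cst {V : Type*} (A : V → V → Prop) (l : List V) : ℕ := pc (fun a b => ¬ A a b) l

lemma jn_iff {V : Type*} (P : V → V → Prop) (l₁ l₂ : List V) :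
    Jn (fun a b => ¬ ¬ P a b) l₁ l₂ ↔ Jn P l₁ l₂ := by simp [Jn]

lemma cst_append {V : Type*} {A : V → V → Prop} {l₁ l₂ : List V} (h : Jn A l₁ l₂) :
    cst A (l₁ ++ l₂) = cst A l₁ + cst A l₂ :=
  pc_append_jn _ _ ((jn_iff A l₁ l₂).2 h)

lemma attach {V : Type*} {A : V → V → Prop} (Z Q P3 : List V) (h0 : cst A P3 = 0) (h3 : P3 ≠ [])
    (hZ : ∀ Z1 Z2, Z1 ≠ [] → Z2 ≠ [] → Z = Z1 ++ Z2 → cst A (Z2 ++ Q ++ Z1) ≤ cst A Z2 + cst A Z1)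
    (hp : 1 ≤ pc (fun c d => A c (P3.head h3) ∨ A (P3.getLast h3) d) Z) :
    ∃ Z' : List V, Z'.Perm (Z ++ Q ++ P3) ∧ cst A Z' ≤ cst A Z := by
  obtain ⟨l₁, c, d, l₂, e, hcd⟩ := pc_exists hp
  have e' : Z = (l₁ ++ [c]) ++ (d :: l₂) := by simp [e]
  have h1 := hZ (l₁ ++ [c]) (d :: l₂) (by simp) (by simp) e'
  have h2 : cst A (l₁ ++ [c]) + cst A (d :: l₂) ≤ cst A Z := by
    rw [e']; exact pc_append_ge _ _
  have hperm : (d :: l₂ ++ Q ++ (l₁ ++ [c])).Perm (Z ++ Q) := by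
    rw [e']
    have : (d :: l₂ ++ Q ++ (l₁ ++ [c])).Perm ((l₁ ++ [c]) ++ (d :: l₂ ++ Q)) := List.perm_append_comm
    simpa using this
  rcases hcd with h | h
  · refine ⟨(d :: l₂ ++ Q ++ (l₁ ++ [c])) ++ P3, hperm.append_right _, ?_⟩
    rw [cst_append]
    · omega
    · intro x hx y hy
      rw [← List.append_assoc, List.getLast?_concat] at hx
      rw [List.head?_eq_some_head h3] at hy
      simp at hx hy; subst hx hy; exact h
  · refine ⟨P3 ++ (d :: l₂ ++ Q ++ (l₁ ++ [c])), List.perm_append_comm.trans (hperm.append_right _), ?_⟩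
    rw [cst_append]
    · omega
    · intro x hx y hy
      rw [List.getLast?_eq_some_getLast h3] at hx
      simp at hx hy; subst hx hy; exact h

lemma insertion {V : Type*} {A : V → V → Prop} (M P : List V) (h0 : cst A P = 0) (hP : P ≠ [])
    (hp : 1 ≤ pc (fun c d => A c (P.head hP) ∧ A (P.getLast hP) d) M) :
    ∃ M' : List V, M'.Perm (M ++ P) ∧ cst A M' ≤ cst A M := by
  obtain ⟨l₁, c, d, l₂, e, h1, h2⟩ := pc_exists hp
  have e' : M = (l₁ ++ [c]) ++ (d :: l₂) := by simp [e]
  refine ⟨(l₁ ++ [c]) ++ (P ++ (d :: l₂)), ?_, ?_⟩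
  · rw [e', List.append_assoc (l₁ ++ [c])]
    exact List.Perm.append_left _ List.perm_append_comm
  · have h3 : cst A (l₁ ++ [c]) + cst A (d :: l₂) ≤ cst A M := by
      rw [e']; exact pc_append_ge _ _
    have j1 : Jn A P (d :: l₂) := by
      intro x hx y hy
      rw [List.getLast?_eq_some_getLast hP] at hx
      simp at hx hy; subst hx hy; exact h2
    have j2 : Jn A (l₁ ++ [c]) (P ++ d :: l₂) := by
      intro x hx y hy
      simp [List.head?_append, List.head?_eq_some_head hP] at hx hy
      subst hx hy; exact h1
    rw [cst_append j2, cst_append j1]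
    omega

/-- window: few pairs are bad -/
lemma window {A : V → V → Prop} {δ : ℕ} {M : List V} (hM : M.Nodup)
    (hδ : Fintype.card V ≤ M.length + δ) (s e : V)
    (hs : Fintype.card V ≤ 2 * (inN A s).card) (he : Fintype.card V ≤ 2 * (outN A e).card)
    (h0 : pc (fun c d => A c s ∧ A e d) M = 0) (X Z Y : List V) (hXZY : M = X ++ Z ++ Y)
    (hZ : 2 * δ + 4 ≤ Z.length) : 1 ≤ pc (fun c d => A c s ∨ A e d) Z := by
  have hMc : M.toFinset.card = M.length := List.toFinset_card_of_nodup hM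
  have hc : ∀ S : Finset V, S.card ≤ (M.toFinset ∩ S).card + δ := by
    intro S
    have h1 := Finset.card_inter_add_card_union M.toFinset S
    have h2 := Finset.card_le_univ (M.toFinset ∪ S)
    omega
  have a1 := pc_left_ge (fun v => A v s) M
  have a2 := pc_right_ge (fun v => A e v) M
  rw [countP_nodup _ _ hM] at a1 a2
  have b1 : M.toFinset.filter (fun v => A v s) = M.toFinset ∩ inN A s := by ext; simp
  have b2 : M.toFinset.filter (fun v => A e v) = M.toFinset ∩ outN A e := by ext; simp
  rw [b1] at a1; rw [b2] at a2
  have c1 := hc (inN A s)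
  have c2 := hc (outN A e)
  have a3 := pc_or (P := fun c _ => A c s) (Q := fun _ d => A e d) M h0
  have hMne : M ≠ [] := by
    rintro rfl
    have := congrArg List.length hXZY
    simp at this; omega
  have a4 := pc_add_not' (P := fun a b => A a s ∨ A e b) M hMne
  have a5 := pc_infix_le (P := fun a b => ¬ (A a s ∨ A e b)) X Z Y
  rw [← hXZY] at a5
  have a6 := pc_add_not (P := fun a b => A a s ∨ A e b) Z
  have : M.length ≤ Fintype.card V := hMc ▸ Finset.card_le_univ _
  omega

lemma far_arc {A : V → V → Prop} {δ g D : ℕ} {M : List V} (hM : M.Nodup)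
    (hδ : Fintype.card V ≤ M.length + δ) (s e : V)
    (hs : Fintype.card V ≤ 2 * (inN A s).card) (he : Fintype.card V ≤ 2 * (outN A e).card)
    (hN : NProp A g) (hg1 : δ + 1 ≤ g) (hg : 2 * D + 2 ≤ g) (hn : 0 < Fintype.card V) :
    ∃ j l : ℕ, ∃ (h1 : j + 1 < M.length) (h2 : l < M.length) (h3 : 1 ≤ l), A e (M[j + 1]) ∧ A (M[l - 1]) s ∧
      A M[j] M[l] ∧ (j + D < l ∨ l + D < j) := by
  by_contra hcon
  push Not at hcon
  have hMc : M.toFinset.card = M.length := List.toFinset_card_of_nodup hM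
  have hc : ∀ S : Finset V, S.card ≤ (M.toFinset ∩ S).card + δ := by
    intro S
    have h1 := Finset.card_inter_add_card_union M.toFinset S
    have h2 := Finset.card_le_univ (M.toFinset ∪ S)
    omega
  set X : Finset V := Finset.univ.filter (fun v => ∃ j, ∃ h : j + 1 < M.length, A e (M[j+1]) ∧ v = M[j]) with hX
  set Y : Finset V := Finset.univ.filter (fun v => ∃ l, ∃ h : l + 1 < M.length, A (M[l]) s ∧ v = M[l + 1]) with hY
  have hidx : ∀ v ∈ M, ∃ h : M.idxOf v < M.length, M[M.idxOf v] = v := by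
    intro v hv
    exact ⟨List.idxOf_lt_length_of_mem hv, List.getElem_idxOf _⟩
  have hXc : (M.toFinset ∩ outN A e).card ≤ X.card + 1 := by
    have hsub : M.toFinset ∩ outN A e ⊆ insert (M.headD s) (X.image (fun v => M.getD (M.idxOf v + 1) s)) := by
      intro v hv
      simp only [Finset.mem_inter, List.mem_toFinset, mem_outN] at hv
      obtain ⟨h, hh⟩ := hidx v hv.1
      rcases Nat.eq_zero_or_pos (M.idxOf v) with h0 | h0
      · apply Finset.mem_insert.2; left
        simp only [h0] at hh
        cases M with
        | nil => simp at hv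
        | cons a M => simp at hh ⊢; exact hh.symm
      · apply Finset.mem_insert.2; right
        apply Finset.mem_image.2
        obtain ⟨j, hj⟩ : ∃ j, M.idxOf v = j + 1 := ⟨M.idxOf v - 1, by omega⟩
        have hj1 : j + 1 < M.length := by omega
        simp only [hj] at hh
        refine ⟨M[j], ?_, ?_⟩
        · simp only [hX, Finset.mem_filter, Finset.mem_univ, true_and]
          exact ⟨j, hj1, by rw [hh]; exact hv.2, rfl⟩
        · rw [List.Nodup.idxOf_getElem hM, List.getD_eq_getElem _ _ hj1]; exact hh
    have := Finset.card_le_card hsub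
    have := Finset.card_insert_le (M.headD s) (X.image (fun v => M.getD (M.idxOf v + 1) s))
    have := Finset.card_image_le (s := X) (f := fun v => M.getD (M.idxOf v + 1) s)
    omega
  have hYc : (M.toFinset ∩ inN A s).card ≤ Y.card + 1 := by
    have hsub : M.toFinset ∩ inN A s ⊆ insert (M.getLastD s) (Y.image (fun v => M.getD (M.idxOf v - 1) s)) := by
      intro v hv
      simp only [Finset.mem_inter, List.mem_toFinset, mem_inN] at hv
      obtain ⟨h, hh⟩ := hidx v hv.1
      rcases Nat.lt_or_ge (M.idxOf v + 1) M.length with h0 | h0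
      · apply Finset.mem_insert.2; right
        apply Finset.mem_image.2
        refine ⟨M[M.idxOf v + 1], ?_, ?_⟩
        · simp only [hY, Finset.mem_filter, Finset.mem_univ, true_and]
          exact ⟨_, h0, by rw [hh]; exact hv.2, rfl⟩
        · rw [List.Nodup.idxOf_getElem hM, Nat.add_sub_cancel, List.getD_eq_getElem _ _ h]; exact hh
      · apply Finset.mem_insert.2; left
        have hne : M ≠ [] := List.ne_nil_of_mem hv.1
        have h3 : M.getLast hne = v := by
          rw [List.getLast_eq_getElem]
          rw [← hh]; congr 1; omega
        rw [← h3, List.getLastD_eq_getLast?, List.getLast?_eq_some_getLast hne]; rfl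
    have := Finset.card_le_card hsub
    have := Finset.card_insert_le (M.getLastD s) (Y.image (fun v => M.getD (M.idxOf v - 1) s))
    have := Finset.card_image_le (s := Y) (f := fun v => M.getD (M.idxOf v - 1) s)
    omega
  have c1 := hc (inN A s)
  have c2 := hc (outN A e)
  have hE := hN X Y (by omega) (by omega)
  -- upper bound
  have hE2 : earcs A X Y ≤ (Fintype.card V) * (2 * D + 1) := by
    unfold earcs
    have : ((X ×ˢ Y).filter (fun p => A p.1 p.2)).card ≤ (Finset.univ (α := V)).card * (2 * D + 1) := by
      have hmul := Finset.card_le_mul_card_image_of_maps_to (s := (X ×ˢ Y).filter (fun p => A p.1 p.2)) (t := Finset.univ (α := V)) (f := Prod.fst) (fun _ _ => Finset.mem_univ _) (2 * D + 1) ?_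
      · rw [mul_comm] at hmul; exact hmul
      · intro u _
        have : (Finset.Icc (M.idxOf u - D) (M.idxOf u + D)).card ≤ 2 * D + 1 := by
          rw [Nat.card_Icc]; omega
        refine le_trans ?_ this
        apply Finset.card_le_card_of_injOn (fun p => M.idxOf p.2)
        · intro p hp
          simp only [Finset.coe_filter, Finset.mem_filter, Finset.mem_product, Set.mem_ofPred_eq, hX, hY, Finset.mem_univ, true_and] at hp
          obtain ⟨⟨⟨⟨j, hj, hj2, hj3⟩, ⟨l, hl, hl2, hl3⟩⟩, ha⟩, rfl⟩ := hp
          simp only [Finset.coe_Icc, Set.mem_Icc]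
          rw [hj3, hl3, List.Nodup.idxOf_getElem hM, List.Nodup.idxOf_getElem hM]
          have := hcon j (l + 1) hj hl (by omega) hj2 (by simpa using hl2) (by rw [← hj3, ← hl3]; exact ha)
          omega
        · intro p hp q hq hpq
          simp only [Finset.coe_filter, Finset.mem_filter, Finset.mem_product, Set.mem_ofPred_eq, hX, hY, Finset.mem_univ, true_and] at hp hq hpq
          obtain ⟨⟨⟨_, ⟨l, hl, hl2, hl3⟩⟩, ha⟩, h1⟩ := hp
          obtain ⟨⟨⟨_, ⟨l', hl', hl2', hl3'⟩⟩, ha'⟩, h1'⟩ := hq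
          have e1 : p.1 = q.1 := h1.trans h1'.symm
          have e2 : p.2 = q.2 := by
            rw [hl3, hl3', List.Nodup.idxOf_getElem hM, List.Nodup.idxOf_getElem hM] at hpq
            simp only [hl3, hl3', hpq]
          exact Prod.ext e1 e2
    simpa using this
  nlinarith

end cover


section cover
variable {V : Type*} [Fintype V]

lemma cover_core {A : V → V → Prop} {δ g : ℕ} {M P1 P3 : List V} (hM : M.Nodup)
    (hδ : Fintype.card V ≤ M.length + δ)
    (hs : ∀ v, Fintype.card V ≤ 2 * (inN A v).card) (he : ∀ v, Fintype.card V ≤ 2 * (outN A v).card)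
    (hN : NProp A g) (hg : 4 * δ + 12 ≤ g) (hn : 0 < Fintype.card V)
    (h1 : P1 ≠ []) (h3 : P3 ≠ []) (c1 : cst A P1 = 0) (c3 : cst A P3 = 0) :
    ∃ l' : List V, l'.Perm (M ++ P1 ++ P3) ∧ cst A l' ≤ cst A M + 1 := by
  by_cases x1 : 1 ≤ pc (fun c d => A c (P1.head h1) ∧ A (P1.getLast h1) d) M
  · obtain ⟨M', hp, hc⟩ := insertion M P1 c1 h1 x1
    refine ⟨M' ++ P3, hp.append_right _, ?_⟩
    have := pc_append_le (P := fun a b => ¬ A a b) M' P3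
    simp only [cst] at *; omega
  by_cases x3 : 1 ≤ pc (fun c d => A c (P3.head h3) ∧ A (P3.getLast h3) d) M
  · obtain ⟨M', hp, hc⟩ := insertion M P3 c3 h3 x3
    refine ⟨M' ++ P1, (hp.append_right _).trans ?_, ?_⟩
    · rw [List.append_assoc, List.append_assoc]; exact List.Perm.append_left _ List.perm_append_comm
    have := pc_append_le (P := fun a b => ¬ A a b) M' P1
    simp only [cst] at *; omega
  obtain ⟨j, l, hj, hl, hl1, a1, a2, a3, hfar⟩ := far_arc (D := 2 * δ + 5) hM hδ (P1.head h1) (P1.getLast h1) (hs _) (he _) hN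
    (by omega) (by omega) hn
  have hwin := window hM hδ (P3.head h3) (P3.getLast h3) (hs _) (he _) (by omega)
  rcases hfar with hlt | hlt
  · -- j < l
    obtain ⟨L, Y, R, hsplit, hL, hY, hR, hYl⟩ : ∃ L Y R : List V, M = L ++ Y ++ R ∧ L.getLast? = some M[j] ∧
        (Y.head? = some M[j+1] ∧ Y.getLast? = some M[l-1]) ∧ R.head? = some M[l] ∧ Y.length = l - j - 1 := by
      refine ⟨M.take (j+1), (M.drop (j+1)).take (l - j - 1), M.drop l, ?_, ?_, ⟨?_, ?_⟩, ?_, ?_⟩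
      · have : M.drop l = (M.drop (j+1)).drop (l - j - 1) := by
          rw [List.drop_drop]; congr 1; omega
        rw [this, List.append_assoc, List.take_append_drop, List.take_append_drop]
      · rw [List.getLast?_take]; simp [List.getElem?_eq_getElem (show j < M.length by omega)]
      · rw [List.head?_take, List.head?_drop, if_neg (by omega)]; simp [hj]
      · rw [List.getLast?_take, if_neg (by omega), List.getElem?_drop]
        have : j + 1 + (l - j - 1 - 1) = l - 1 := by omega
        rw [this, List.getElem?_eq_getElem (by omega)]; rfl
      · rw [List.head?_drop, List.getElem?_eq_getElem hl]
      · simp; omega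
    have hw := hwin L Y R hsplit (by omega)
    have hYne : Y ≠ [] := by rintro rfl; simp at hYl; omega
    obtain ⟨Z', hp, hc⟩ := attach Y P1 P3 c3 h3 (by
      intro Z1 Z2 z1 z2 e
      have j1 : Jn A Z2 P1 := by
        intro x hx y hy
        have : Y.getLast? = some x := by rw [e, List.getLast?_append]; simp at hx; simp [hx]
        rw [hY.2] at this
        rw [List.head?_eq_some_head h1] at hy
        simp at this hy; subst hy; subst this; exact a2
      have j2 : Jn A (Z2 ++ P1) Z1 := by
        intro x hx y hy
        have : Y.head? = some y := by rw [e, List.head?_append]; simp at hy; simp [hy]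
        rw [hY.1] at this
        rw [List.getLast?_append, List.getLast?_eq_some_getLast h1] at hx
        simp at this hx; subst hx; subst this; exact a1
      rw [cst_append j2, cst_append j1]; omega) hw
    refine ⟨(L ++ R) ++ Z', ?_, ?_⟩
    · refine (List.Perm.append_left _ hp).trans ?_
      rw [hsplit]
      simp only [List.append_assoc]
      apply List.Perm.append_left
      simp only [← List.append_assoc]
      exact List.Perm.append_right _ (List.Perm.append_right _ List.perm_append_comm)
    · have := pc_append_le (P := fun a b => ¬ A a b) (L ++ R) Z'
      have jj : Jn A L R := by
        intro x hx y hy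
        rw [hL] at hx; rw [hR] at hy
        simp at hx hy; subst hx hy; exact a3
      have e1 := cst_append jj
      have e2 := pc_append_ge (P := fun a b => ¬ A a b) (L ++ Y) R
      have e3 := pc_append_ge (P := fun a b => ¬ A a b) L Y
      rw [← hsplit] at e2
      simp only [cst] at *; omega
  · obtain ⟨L, Z, R, hsplit, hL, hZ, hR, hZl⟩ : ∃ L Y R : List V, M = L ++ Y ++ R ∧ L.getLast? = some M[l-1] ∧
        (Y.head? = some M[l] ∧ Y.getLast? = some M[j]) ∧ R.head? = some M[j+1] ∧ Y.length = j + 1 - l := by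
      refine ⟨M.take l, (M.drop l).take (j + 1 - l), M.drop (j + 1), ?_, ?_, ⟨?_, ?_⟩, ?_, ?_⟩
      · have : M.drop (j+1) = (M.drop l).drop (j + 1 - l) := by
          rw [List.drop_drop]; congr 1; omega
        rw [this, List.append_assoc, List.take_append_drop, List.take_append_drop]
      · rw [List.getLast?_take, if_neg (by omega), List.getElem?_eq_getElem (by omega)]; rfl
      · rw [List.head?_take, List.head?_drop, if_neg (by omega)]; simp [hl]
      · rw [List.getLast?_take, if_neg (by omega), List.getElem?_drop]
        have : l + (j + 1 - l - 1) = j := by omega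
        rw [this, List.getElem?_eq_getElem (by omega)]; rfl
      · rw [List.head?_drop, List.getElem?_eq_getElem hj]
      · simp; omega
    have hw := hwin L Z R hsplit (by omega)
    obtain ⟨Z', hp, hc⟩ := attach Z [] P3 c3 h3 (by
      intro Z1 Z2 z1 z2 e
      have j1 : Jn A Z2 Z1 := by
        intro x hx y hy
        have t1 : Z.getLast? = some x := by rw [e, List.getLast?_append]; simp at hx; simp [hx]
        have t2 : Z.head? = some y := by rw [e, List.head?_append]; simp at hy; simp [hy]
        rw [hZ.2] at t1; rw [hZ.1] at t2
        simp at t1 t2; subst t1; subst t2; exact a3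
      simp only [List.append_nil]
      rw [cst_append j1]) hw
    refine ⟨(L ++ P1 ++ R) ++ Z', ?_, ?_⟩
    · refine (List.Perm.append_left _ hp).trans ?_
      rw [hsplit]
      simp only [List.append_assoc, List.append_nil, List.nil_append]
      apply List.Perm.append_left
      have : (P1 ++ (R ++ Z)).Perm (Z ++ (R ++ P1)) := by
        refine List.perm_append_comm.trans ?_
        rw [← List.append_assoc]
        exact List.Perm.append_right _ List.perm_append_comm
      have := this.append_right P3
      simpa using this
    · have := pc_append_le (P := fun a b => ¬ A a b) (L ++ P1 ++ R) Z'
      have j1 : Jn A L P1 := by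
        intro x hx y hy
        rw [hL] at hx; rw [List.head?_eq_some_head h1] at hy
        simp at hx hy; subst hx hy; exact a2
      have j2 : Jn A (L ++ P1) R := by
        intro x hx y hy
        rw [List.getLast?_append, List.getLast?_eq_some_getLast h1] at hx; rw [hR] at hy
        simp at hx hy; subst hx hy; exact a1
      have e1 := cst_append j1
      have e4 := cst_append j2
      have e2 := pc_append_ge (P := fun a b => ¬ A a b) (L ++ Z) R
      have e3 := pc_append_ge (P := fun a b => ¬ A a b) L Z
      rw [← hsplit] at e2
      simp only [cst] at *; omega

lemma cover_step {A : V → V → Prop} {δ g ℓ : ℕ} {l : List V} (hl : l.Nodup)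
    (hδ : Fintype.card V + 2 * ℓ ≤ l.length + δ)
    (hs : ∀ v, Fintype.card V ≤ 2 * (inN A v).card) (he : ∀ v, Fintype.card V ≤ 2 * (outN A v).card)
    (hN : NProp A g) (hg : 4 * δ + 12 ≤ g) (hn : 0 < Fintype.card V)
    (hc : Fintype.card V < ℓ * (cst A l - 1)) :
    ∃ l' : List V, l'.Perm l ∧ cst A l' < cst A l := by
  have hlen : ∀ l : List V, l.Nodup → l.length ≤ Fintype.card V := fun l h => h.length_le_card
  have hge : ℓ * (cst A l - 1) ≤ ℓ * cst A l := Nat.mul_le_mul_left _ (by omega)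
  obtain ⟨B0, P1, B1, e, p1, p2, p3, p4⟩ := short_chain A ℓ _ l le_rfl
    (lt_of_le_of_lt (hlen l hl) (lt_of_lt_of_le hc hge))
  have perm1 : ((B0 ++ B1) ++ P1).Perm l := by
    rw [e, List.append_assoc, List.append_assoc]
    exact List.Perm.append_left _ List.perm_append_comm
  have hnd : ((B0 ++ B1) ++ P1).Nodup := perm1.nodup_iff.2 hl
  have hnd1 : (B0 ++ B1).Nodup := hnd.of_append_left
  have len1 := perm1.length_eq
  rw [List.length_append] at len1
  by_cases hsm : cst A (B0 ++ B1) + 2 ≤ cst A l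
  · refine ⟨_, perm1, ?_⟩
    have := pc_append_le (P := fun a b => ¬ A a b) (B0 ++ B1) P1
    simp only [cst] at *; omega
  have hge2 : ℓ * (cst A l - 1) ≤ ℓ * cst A (B0 ++ B1) := Nat.mul_le_mul_left _ (by omega)
  obtain ⟨C0, P3, C1, e', q1, q2, q3, q4⟩ := short_chain A ℓ _ (B0 ++ B1) le_rfl
    (lt_of_le_of_lt (hlen _ hnd1) (lt_of_lt_of_le hc hge2))
  have perm2 : ((C0 ++ C1) ++ P3).Perm (B0 ++ B1) := by
    rw [e', List.append_assoc, List.append_assoc]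
    exact List.Perm.append_left _ List.perm_append_comm
  have hnd2 : ((C0 ++ C1) ++ P3).Nodup := perm2.nodup_iff.2 hnd1
  have len2 := perm2.length_eq
  rw [List.length_append] at len2
  obtain ⟨l', hp, hc'⟩ := cover_core (M := C0 ++ C1) (P1 := P3) (P3 := P1) (δ := δ) hnd2.of_append_left
    (by omega) hs he hN hg hn q1 p1 q2 p2
  refine ⟨l', hp.trans ((perm2.append_right _).trans perm1), ?_⟩
  simp only [cst] at *; omega

lemma cover {A : V → V → Prop} {δ g ℓ R : ℕ} (hℓ : Fintype.card V < ℓ * R)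
    (hs : ∀ v, Fintype.card V ≤ 2 * (inN A v).card) (he : ∀ v, Fintype.card V ≤ 2 * (outN A v).card)
    (hN : NProp A g) (hg : 4 * δ + 12 ≤ g) (hn : 0 < Fintype.card V) (U : Finset V)
    (hU : Fintype.card V + 2 * ℓ ≤ U.card + δ) :
    ∃ l : List V, l.Nodup ∧ l.toFinset = U ∧ cst A l ≤ R := by
  have key : ∀ c, ∀ l : List V, cst A l ≤ c → l.Nodup → l.toFinset = U → ∃ l : List V, l.Nodup ∧ l.toFinset = U ∧ cst A l ≤ R := by
    intro c
    induction c with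
    | zero => intro l h1 h2 h3; exact ⟨l, h2, h3, by omega⟩
    | succ c ih =>
      intro l h1 h2 h3
      by_cases hR : cst A l ≤ R
      · exact ⟨l, h2, h3, hR⟩
      have : ℓ * R ≤ ℓ * (cst A l - 1) := Nat.mul_le_mul_left _ (by omega)
      obtain ⟨l', hp, hc⟩ := cover_step (δ := δ) (ℓ := ℓ) h2 (by rw [← List.toFinset_card_of_nodup h2, h3]; exact hU) hs he hN hg hn (by omega)
      exact ih l' (by omega) (hp.nodup_iff.2 h2) (by rw [← h3]; exact List.toFinset_eq_of_perm _ _ hp)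
  exact key _ U.toList le_rfl U.nodup_toList (by simp)

/-- an ordering of cost c splits into c+1 chains -/
lemma chains_of_cost {V : Type*} (A : V → V → Prop) : ∀ (c : ℕ) (l : List V), cst A l = c →
    ∃ Ls : List (List V), Ls.flatten = l ∧ Ls.length ≤ c + 1 ∧ ∀ P ∈ Ls, P ≠ [] ∧ P.IsChain A := by
  intro c
  induction c with
  | zero =>
    intro l h
    by_cases hl : l = []
    · exact ⟨[], by simp [hl], by simp, by simp⟩
    · refine ⟨[l], by simp, by simp, ?_⟩
      simp only [List.mem_singleton]
      rintro P rfl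
      exact ⟨hl, (pc_zero_iff P).1 h⟩
  | succ c ih =>
    intro l h
    obtain ⟨P, R, e, hP, hc, hR⟩ := first_chain A l (by simp only [cst] at h; omega)
    obtain ⟨Ls, h1, h2, h3⟩ := ih R (by simp only [cst] at *; omega)
    refine ⟨P :: Ls, by simp [h1, e], by simpa using h2, ?_⟩
    intro Q hQ
    rcases List.mem_cons.1 hQ with rfl | hQ
    · exact ⟨hP, (pc_zero_iff _).1 hc⟩
    · exact h3 Q hQ

/-- Absorbing chains into a closed list. -/
lemma absorb {V : Type*} {A : V → V → Prop} : ∀ (Ls : List (List V)) (ℓ : List V),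
    IsDicycleList A ℓ → (∀ s e, Ls.length ≤ pc (fun c d => A c s ∧ A e d) ℓ) →
    (∀ P ∈ Ls, P ≠ [] ∧ P.IsChain A) → (ℓ ++ Ls.flatten).Nodup →
    ∃ c, IsDicycleList A c ∧ c.Perm (ℓ ++ Ls.flatten) := by
  intro Ls
  induction Ls with
  | nil => intro ℓ h _ _ _; exact ⟨ℓ, h, by simp⟩
  | cons P Ls ih =>
    intro ℓ hℓ hcnt hch hnd
    obtain ⟨hP, hPc⟩ := hch P (by simp)
    obtain ⟨l₁, c, d, l₂, e, hcs, hed⟩ := pc_exists (l := ℓ) (P := fun c d => A c (P.head hP) ∧ A (P.getLast hP) d)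
      (le_trans (by simp) (hcnt _ _))
    have perm : (l₁ ++ [c] ++ P ++ d :: l₂).Perm (ℓ ++ P) := by
      rw [e]
      have : (P ++ d :: l₂).Perm (d :: l₂ ++ P) := List.perm_append_comm
      have := List.Perm.append_left (l₁ ++ [c]) this
      simpa using this
    have hnd2 : ((l₁ ++ [c] ++ P ++ d :: l₂) ++ Ls.flatten).Nodup := by
      refine ((perm.append_right _).nodup_iff).2 ?_
      simpa using hnd
    suffices hh : IsDicycleList A (l₁ ++ [c] ++ P ++ d :: l₂) ∧
        ∀ s e, Ls.length ≤ pc (fun c d => A c s ∧ A e d) (l₁ ++ [c] ++ P ++ d :: l₂) by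
      obtain ⟨c', h1, h2⟩ := ih (l₁ ++ [c] ++ P ++ d :: l₂) hh.1 hh.2 (fun Q hQ => hch Q (by simp [hQ])) hnd2
      refine ⟨c', h1, h2.trans ?_⟩
      simpa using perm.append_right Ls.flatten
    constructor
    · obtain ⟨a0, a1, a2, a3⟩ := hℓ
      refine ⟨by simp, hnd2.of_append_left, ?_, ?_⟩
      · have a2' : (l₁ ++ c :: d :: l₂).IsChain A := by rw [← e]; exact a2
        rw [List.isChain_append_cons_cons] at a2'
        show List.IsChain A _
        rw [List.isChain_append, List.isChain_append]
        refine ⟨⟨a2'.1, hPc, ?_⟩, a2'.2.2, ?_⟩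
        · intro x hx y hy
          rw [List.head?_eq_some_head hP] at hy
          simp at hx hy; subst hx hy; exact hcs
        · intro x hx y hy
          rw [List.getLast?_append, List.getLast?_eq_some_getLast hP] at hx
          simp at hx hy; subst hx hy; exact hed
      · intro h
        have := a3 a0
        have e1 : (l₁ ++ [c] ++ P ++ d :: l₂).getLast h = ℓ.getLast a0 := by
          subst e; simp [List.getLast_append]
        have e2 : (l₁ ++ [c] ++ P ++ d :: l₂).head h = ℓ.head a0 := by
          subst e; cases l₁ <;> simp
        rw [e1, e2]; exact this
    · intro s e'
      have h1 := hcnt s e'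
      rw [e, pc_append_cons] at h1
      have h2 := pc_append_ge (P := fun c d => A c s ∧ A e' d) (l₁ ++ [c] ++ P) (d :: l₂)
      have h3 := pc_append_ge (P := fun c d => A c s ∧ A e' d) (l₁ ++ [c]) P
      simp only [List.length_cons] at h1
      split_ifs at h1 <;> omega
end cover


section build
variable {V : Type*} [Fintype V]

lemma card_sdiff_ge (S F : Finset V) : S.card ≤ (S \ F).card + F.card := by
  have := Finset.card_le_card (Finset.subset_union_left (s₁ := S) (s₂ := F))
  have h2 := Finset.card_union_le (S \ F) F
  rw [Finset.sdiff_union_self_eq_union] at h2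
  omega

lemma exists_mid {A : V → V → Prop} {g : ℕ} (hN : NProp A g) (hg : 0 < g) (hn : 0 < Fintype.card V)
    (hs : ∀ v, Fintype.card V ≤ 2 * (inN A v).card) (he : ∀ v, Fintype.card V ≤ 2 * (outN A v).card)
    (F : Finset V) (hF : F.card ≤ g) (u v : V) :
    ∃ c d, A u c ∧ A c d ∧ A d v ∧ c ∉ F ∧ d ∉ F := by
  have h1 := card_sdiff_ge (outN A u) F
  have h2 := card_sdiff_ge (inN A v) F
  have := hN (outN A u \ F) (inN A v \ F) (by have := he u; omega) (by have := hs v; omega)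
  have hpos : 0 < earcs A (outN A u \ F) (inN A v \ F) := lt_of_lt_of_le (Nat.mul_pos hg hn) this
  obtain ⟨⟨c, d⟩, hp⟩ := Finset.card_pos.1 hpos
  simp at hp
  exact ⟨c, d, hp.1.1.1, hp.2, hp.1.2.1, hp.1.1.2, hp.1.2.2⟩

lemma averaging {A : V → V → Prop} {g : ℕ} (hN : NProp A g) (hg : 0 < g) (hn : 0 < Fintype.card V)
    (hs : ∀ v, Fintype.card V ≤ 2 * (inN A v).card) (he : ∀ v, Fintype.card V ≤ 2 * (outN A v).card)
    (F : Finset V) (hF : F.card ≤ g) (w : V × V → ℝ) (hw : ∀ q, 0 ≤ w q) :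
    ∃ a b, A a b ∧ a ∉ F ∧ b ∉ F ∧
      (g : ℝ) / Fintype.card V * ∑ q, w q ≤ ∑ q, if A a q.1 ∧ A q.2 b then w q else 0 := by
  set n := Fintype.card V with hnd
  set Arcs : Finset (V × V) := Finset.univ.filter (fun p => A p.1 p.2 ∧ p.1 ∉ F ∧ p.2 ∉ F) with hA
  have hcard : (Arcs.card : ℝ) ≤ (n : ℝ) * n := by
    have := Finset.card_le_univ Arcs
    rw [Fintype.card_prod] at this
    exact_mod_cast this
  have hhit : ∀ q : V × V, (g : ℝ) * n ≤ ((Arcs.filter (fun p => A p.1 q.1 ∧ A q.2 p.2)).card : ℝ) := by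
    intro q
    have h1 := card_sdiff_ge (inN A q.1) F
    have h2 := card_sdiff_ge (outN A q.2) F
    have h3 := hN (inN A q.1 \ F) (outN A q.2 \ F) (by have := hs q.1; omega) (by have := he q.2; omega)
    have h4 : earcs A (inN A q.1 \ F) (outN A q.2 \ F) ≤ (Arcs.filter (fun p => A p.1 q.1 ∧ A q.2 p.2)).card := by
      apply Finset.card_le_card
      intro p hp
      simp [hA] at hp ⊢
      tauto
    exact_mod_cast h3.trans h4
  have hne : Arcs.Nonempty := by
    haveI : Nonempty V := Fintype.card_pos_iff.1 hn
    obtain ⟨v⟩ := this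
    have h1 := hhit (v, v)
    have h2 : (0 : ℝ) < (g : ℝ) * n := by positivity
    have h3 : 0 < (Arcs.filter (fun p => A p.1 v ∧ A v p.2)).card := by
      have := lt_of_lt_of_le h2 h1
      exact_mod_cast this
    obtain ⟨p, hp⟩ := Finset.card_pos.1 h3
    exact ⟨p, (Finset.mem_filter.1 hp).1⟩
  by_contra hcon
  push Not at hcon
  have hsum : ∑ p ∈ Arcs, (∑ q, if A p.1 q.1 ∧ A q.2 p.2 then w q else 0) < ∑ p ∈ Arcs, ((g : ℝ) / n * ∑ q, w q) := by
    apply Finset.sum_lt_sum_of_nonempty hne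
    intro p hp
    simp only [hA, Finset.mem_filter, Finset.mem_univ, true_and] at hp
    exact hcon p.1 p.2 hp.1 hp.2.1 hp.2.2
  rw [Finset.sum_comm, Finset.sum_const, nsmul_eq_mul] at hsum
  have hW : 0 ≤ ∑ q, w q := Finset.sum_nonneg (fun q _ => hw q)
  have h1 : (g : ℝ) * n * ∑ q, w q ≤ ∑ q, ∑ p ∈ Arcs, (if A p.1 q.1 ∧ A q.2 p.2 then w q else 0) := by
    rw [Finset.mul_sum]
    apply Finset.sum_le_sum
    intro q _
    rw [← Finset.sum_filter, Finset.sum_const, nsmul_eq_mul]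
    exact mul_le_mul_of_nonneg_right (hhit q) (hw q)
  have hn' : (0 : ℝ) < n := by exact_mod_cast hn
  have h2 : (Arcs.card : ℝ) * ((g : ℝ) / n * ∑ q, w q) ≤ (g : ℝ) * n * ∑ q, w q := by
    calc (Arcs.card : ℝ) * ((g : ℝ) / n * ∑ q, w q) ≤ ((n : ℝ) * n) * ((g : ℝ) / n * ∑ q, w q) :=
          mul_le_mul_of_nonneg_right hcard (by positivity)
      _ = _ := by field_simp
  linarith

/-- potential -/
noncomputable def Phi (A : V → V → Prop) (l : List V) : ℝ :=
  ∑ q : V × V, (1 / 2 : ℝ) ^ (pc (fun c d => A c q.1 ∧ A q.2 d) l)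

lemma build_step {A : V → V → Prop} {g : ℕ} (hirr : ∀ v, ¬ A v v) (hN : NProp A g) (hg : 0 < g) (hn : 0 < Fintype.card V)
    (hs : ∀ v, Fintype.card V ≤ 2 * (inN A v).card) (he : ∀ v, Fintype.card V ≤ 2 * (outN A v).card)
    (l : List V) (hl : l ≠ []) (hnd : l.Nodup) (hch : l.IsChain A)
    (F : Finset V) (hlF : ∀ v ∈ l, v ∉ F) (hF : F.card + l.length + 2 ≤ g) :
    ∃ l' : List V, l' ≠ [] ∧ l'.Nodup ∧ l'.IsChain A ∧ (∀ v ∈ l', v ∉ F) ∧ l'.length = l.length + 4 ∧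
      Phi A l' ≤ (1 - (g : ℝ) / (2 * Fintype.card V)) * Phi A l := by
  have hc1 : (F ∪ l.toFinset).card ≤ F.card + l.length := (Finset.card_union_le _ _).trans (by
    have := List.toFinset_card_le l; omega)
  obtain ⟨a, b, hab, ha, hb, hsum⟩ := averaging hN hg hn hs he (F ∪ l.toFinset) (by omega)
    (fun q => (1 / 2 : ℝ) ^ (pc (fun c d => A c q.1 ∧ A q.2 d) l)) (fun q => by positivity)
  obtain ⟨c, d, h1, h2, h3, h4, h5⟩ := exists_mid hN hg hn hs he (insert a (insert b (F ∪ l.toFinset)))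
    (by
      have := Finset.card_insert_le a (insert b (F ∪ l.toFinset))
      have := Finset.card_insert_le b (F ∪ l.toFinset)
      omega) (l.getLast hl) a
  have hab' : a ≠ b := by rintro rfl; exact hirr _ hab
  have hcd' : c ≠ d := by rintro rfl; exact hirr _ h2
  simp only [Finset.mem_insert, Finset.mem_union, List.mem_toFinset, not_or] at ha hb h4 h5
  refine ⟨l ++ [c, d, a, b], by simp, ?_, ?_, ?_, by simp, ?_⟩
  · rw [List.nodup_append]
    refine ⟨hnd, ?_, ?_⟩
    · simp; grind
    · intro x hx y hy
      simp at hy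
      rintro rfl
      rcases hy with rfl | rfl | rfl | rfl <;> tauto
  · rw [List.isChain_append]
    refine ⟨hch, by simp [h2, h3, hab], ?_⟩
    intro x hx y hy
    rw [List.getLast?_eq_some_getLast hl] at hx
    simp at hx hy; subst hx hy; exact h1
  · intro v hv
    simp at hv
    rcases hv with hv | rfl | rfl | rfl | rfl
    · exact hlF v hv
    all_goals tauto
  · have hbound : ∀ q : V × V, (1 / 2 : ℝ) ^ (pc (fun c d => A c q.1 ∧ A q.2 d) (l ++ [c, d, a, b])) ≤
        (1 / 2 : ℝ) ^ (pc (fun c d => A c q.1 ∧ A q.2 d) l) - 1 / 2 * (if A a q.1 ∧ A q.2 b then (1 / 2 : ℝ) ^ (pc (fun c d => A c q.1 ∧ A q.2 d) l) else 0) := by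
      intro q
      have hge := pc_append_ge (P := fun c d => A c q.1 ∧ A q.2 d) l [c, d, a, b]
      split_ifs with hq
      · have h1 : 1 ≤ pc (fun c d => A c q.1 ∧ A q.2 d) [c, d, a, b] := by
          simp only [pc, hq, and_self, if_true]; omega
        have : (1 / 2 : ℝ) ^ (pc (fun c d => A c q.1 ∧ A q.2 d) (l ++ [c, d, a, b])) ≤ (1 / 2 : ℝ) ^ (pc (fun c d => A c q.1 ∧ A q.2 d) l + 1) :=
          pow_le_pow_of_le_one (by norm_num) (by norm_num) (by omega)
        rw [pow_succ] at this
        linarith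
      · have : (1 / 2 : ℝ) ^ (pc (fun c d => A c q.1 ∧ A q.2 d) (l ++ [c, d, a, b])) ≤ (1 / 2 : ℝ) ^ (pc (fun c d => A c q.1 ∧ A q.2 d) l) :=
          pow_le_pow_of_le_one (by norm_num) (by norm_num) (by omega)
        linarith
    have h6 := Finset.sum_le_sum (fun q (_ : q ∈ Finset.univ) => hbound q)
    rw [Finset.sum_sub_distrib, ← Finset.mul_sum] at h6
    unfold Phi
    have hn' : (0 : ℝ) < Fintype.card V := by exact_mod_cast hn
    have e : (g : ℝ) / (2 * Fintype.card V) = 1 / 2 * (g / Fintype.card V) := by field_simp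
    rw [e]
    refine h6.trans ?_
    have := hsum
    nlinarith

lemma build {A : V → V → Prop} {g : ℕ} (hirr : ∀ v, ¬ A v v) (hN : NProp A g) (hg : 0 < g) (hn : 0 < Fintype.card V)
    (hs : ∀ v, Fintype.card V ≤ 2 * (inN A v).card) (he : ∀ v, Fintype.card V ≤ 2 * (outN A v).card)
    (F : Finset V) (u : V) (hu : u ∉ F) (hgn : g ≤ Fintype.card V) : ∀ t : ℕ, F.card + 4 * t + 3 ≤ g →
    ∃ l' : List V, l' ≠ [] ∧ l'.Nodup ∧ l'.IsChain A ∧ (∀ v ∈ l', v ∉ F) ∧ l'.length = 4 * t + 1 ∧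
      Phi A l' ≤ (1 - (g : ℝ) / (2 * Fintype.card V)) ^ t * (Fintype.card V : ℝ) ^ 2 := by
  intro t
  induction t with
  | zero =>
    intro _
    refine ⟨[u], by simp, by simp, by simp, by simpa using hu, by simp, ?_⟩
    simp [Phi, pc, sq]
  | succ t ih =>
    intro h
    obtain ⟨l, h1, h2, h3, h4, h5, h6⟩ := ih (by omega)
    obtain ⟨l', g1, g2, g3, g4, g5, g6⟩ := build_step hirr hN hg hn hs he l h1 h2 h3 F h4 (by omega)
    refine ⟨l', g1, g2, g3, g4, by omega, g6.trans ?_⟩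
    rw [pow_succ, mul_comm _ (1 - (g : ℝ) / (2 * Fintype.card V)), mul_assoc]
    apply mul_le_mul_of_nonneg_left h6
    rw [sub_nonneg, div_le_one (by positivity)]
    have : (g : ℝ) ≤ Fintype.card V := by exact_mod_cast hgn
    have : (0 : ℝ) < Fintype.card V := by exact_mod_cast hn
    linarith

lemma build_cycle {A : V → V → Prop} {g t R : ℕ} (hirr : ∀ v, ¬ A v v) (hN : NProp A g) (hg : 0 < g) (hn : 0 < Fintype.card V)
    (hs : ∀ v, Fintype.card V ≤ 2 * (inN A v).card) (he : ∀ v, Fintype.card V ≤ 2 * (outN A v).card)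
    (F : Finset V) (hgn : g < Fintype.card V) (ht : F.card + 4 * t + 3 ≤ g)
    (hR : (1 - (g : ℝ) / (2 * Fintype.card V)) ^ t * (Fintype.card V : ℝ) ^ 2 ≤ (1 / 2) ^ R) :
    ∃ l : List V, IsDicycleList A l ∧ (∀ v ∈ l, v ∉ F) ∧ l.length = 4 * t + 3 ∧
      ∀ s e, R ≤ pc (fun c d => A c s ∧ A e d) l := by
  obtain ⟨u, hu⟩ : ∃ u, u ∉ F := by
    by_contra hh
    push Not at hh
    have : F = Finset.univ := by ext; simp [hh]
    rw [this, Finset.card_univ] at ht; omega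
  obtain ⟨l, h1, h2, h3, h4, h5, h6⟩ := build hirr hN hg hn hs he F u hu hgn.le t ht
  have hc1 : (F ∪ l.toFinset).card ≤ F.card + l.length := (Finset.card_union_le _ _).trans (by
    have := List.toFinset_card_le l; omega)
  obtain ⟨c, d, a1, a2, a3, a4, a5⟩ := exists_mid hN hg hn hs he (F ∪ l.toFinset) (by omega) (l.getLast h1) (l.head h1)
  have hcd' : c ≠ d := by rintro rfl; exact hirr _ a2
  simp only [Finset.mem_union, List.mem_toFinset, not_or] at a4 a5
  refine ⟨l ++ [c, d], ⟨by simp, ?_, ?_, ?_⟩, ?_, by simp; omega, ?_⟩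
  · rw [List.nodup_append]
    refine ⟨h2, by simp [hcd'], ?_⟩
    intro x hx y hy
    simp at hy
    rintro rfl
    rcases hy with rfl | rfl <;> tauto
  · show List.IsChain A _
    rw [List.isChain_append]
    refine ⟨h3, by simp [a2], ?_⟩
    intro x hx y hy
    rw [List.getLast?_eq_some_getLast h1] at hx
    simp at hx hy; subst hx hy; exact a1
  · intro h
    rw [List.head_append_of_ne_nil h1]
    simpa using a3
  · intro v hv
    simp at hv
    rcases hv with hv | rfl | rfl
    · exact h4 v hv
    all_goals tauto
  · intro s e
    have hge := pc_append_ge (P := fun c d => A c s ∧ A e d) l [c, d]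
    have : (1 / 2 : ℝ) ^ (pc (fun c d => A c s ∧ A e d) l) ≤ (1 / 2) ^ R := by
      refine le_trans ?_ (h6.trans hR)
      unfold Phi
      exact Finset.single_le_sum (f := fun q : V × V => (1 / 2 : ℝ) ^ (pc (fun c d => A c q.1 ∧ A q.2 d) l)) (fun q _ => by positivity) (Finset.mem_univ (s, e))
    have := (pow_le_pow_iff_right_of_lt_one₀ (by norm_num : (0:ℝ) < 1/2) (by norm_num)).1 this
    omega

/-- Hamiltonicity in the non-extremal case. -/
lemma hamN {A : V → V → Prop} {g t R δ ℓ : ℕ} (hirr : ∀ v, ¬ A v v) (hN : NProp A g) (hg : 0 < g)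
    (hs : ∀ v, Fintype.card V ≤ 2 * (inN A v).card) (he : ∀ v, Fintype.card V ≤ 2 * (outN A v).card)
    (F : Finset V) (hgn : g < Fintype.card V) (hδ : F.card + 4 * t + 3 + 2 * ℓ ≤ δ)
    (hδg : 4 * δ + 12 ≤ g) (hℓ : Fintype.card V < ℓ * R)
    (hR : (1 - (g : ℝ) / (2 * Fintype.card V)) ^ t * (Fintype.card V : ℝ) ^ 2 ≤ (1 / 2) ^ (R + 1)) :
    HamOn A (Finset.univ \ F) := by
  have hn : 0 < Fintype.card V := by omega
  obtain ⟨l, h1, h2, h3, h4⟩ := build_cycle hirr hN hg hn hs he F hgn (by omega) hR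
  have hlc : l.toFinset.card = 4 * t + 3 := by rw [List.toFinset_card_of_nodup h1.2.1, h3]
  obtain ⟨m, m1, m2, m3⟩ := cover (δ := δ) (ℓ := ℓ) (R := R) hℓ hs he hN hδg hn (Finset.univ \ (F ∪ l.toFinset)) (by
    have := card_sdiff_ge Finset.univ (F ∪ l.toFinset)
    have := Finset.card_union_le F l.toFinset
    rw [Finset.card_univ] at *
    omega)
  obtain ⟨Ls, p1, p2, p3⟩ := chains_of_cost A _ m rfl
  have hnd : (l ++ Ls.flatten).Nodup := by
    rw [p1, List.nodup_append]
    refine ⟨h1.2.1, m1, ?_⟩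
    rintro x hx y hy rfl
    have : x ∈ m.toFinset := by simpa using hy
    rw [m2] at this
    simp at this; tauto
  obtain ⟨c, c1, c2⟩ := absorb Ls l h1 (fun s e => by have := h4 s e; omega) p3 hnd
  refine ⟨c, c1, ?_⟩
  rw [List.toFinset_eq_of_perm _ _ c2, p1, List.toFinset_append, m2]
  ext v
  simp
  constructor
  · rintro (h | h)
    · exact h2 v h
    · exact h.1
  · intro h
    by_cases hv : v ∈ l <;> tauto
end build


section smallN
variable {V : Type*} [Fintype V]

lemma exists_out (S F : Finset V) (h : F.card < S.card) : ∃ v ∈ S, v ∉ F := by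
  by_contra hh
  push Not at hh
  have := Finset.card_le_card (show S ⊆ F from hh)
  omega

lemma greedy_path {A : V → V → Prop} (he : ∀ v, Fintype.card V ≤ 2 * (outN A v).card)
    (F : Finset V) (x : V) (hx : x ∉ F) : ∀ j : ℕ, 2 * F.card + 2 * j < Fintype.card V →
    ∃ l : List V, l.head? = some x ∧ l.Nodup ∧ l.IsChain A ∧ (∀ v ∈ l, v ∉ F) ∧ l.length = j + 1 := by
  intro j
  induction j with
  | zero => intro _; exact ⟨[x], by simp, by simp, by simp, by simpa using hx, by simp⟩
  | succ j ih =>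
    intro h
    obtain ⟨l, h1, h2, h3, h4, h5⟩ := ih (by omega)
    have hl : l ≠ [] := by rintro rfl; simp at h1
    have hc1 : (F ∪ l.toFinset).card ≤ F.card + l.length := (Finset.card_union_le _ _).trans (by
      have := List.toFinset_card_le l; omega)
    obtain ⟨v, hv, hvF⟩ := exists_out (outN A (l.getLast hl)) (F ∪ l.toFinset)
      (by have := he (l.getLast hl); omega)
    simp at hv hvF
    refine ⟨l ++ [v], by simp [List.head?_append, h1], ?_, ?_, ?_, by simp [h5]⟩
    · rw [List.nodup_append]; refine ⟨h2, by simp, ?_⟩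
      intro a ha b hb; simp at hb; rintro rfl; subst hb; tauto
    · rw [List.isChain_append]; refine ⟨h3, by simp, ?_⟩
      intro a ha b hb
      rw [List.getLast?_eq_some_getLast hl] at ha
      simp at ha hb; subst ha hb; exact hv
    · intro w hw
      simp at hw
      rcases hw with hw | rfl
      · exact h4 w hw
      · tauto

lemma smallN {A : V → V → Prop} {g : ℕ} (hirr : ∀ v, ¬ A v v) (hN : NProp A g)
    (hs : ∀ v, Fintype.card V ≤ 2 * (inN A v).card) (he : ∀ v, Fintype.card V ≤ 2 * (outN A v).card)
    (hgn : 2 * g < Fintype.card V) (F : Finset V) (x : V) (hx : x ∉ F) (m : ℕ) (hm : 4 ≤ m)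
    (hF : F.card + m ≤ g) :
    ∃ c : List V, (IsDicycleList A c ∧ c.length = m ∧ x ∈ c) ∧ ∀ v ∈ c, v ∉ F := by
  obtain ⟨l, h1, h2, h3, h4, h5⟩ := greedy_path he F x hx (m - 3) (by omega)
  have hl : l ≠ [] := by rintro rfl; simp at h1
  have hc1 : (F ∪ l.toFinset).card ≤ F.card + l.length := (Finset.card_union_le _ _).trans (by
      have := List.toFinset_card_le l; omega)
  obtain ⟨c, d, a1, a2, a3, a4, a5⟩ := exists_mid hN (by omega) (by omega) hs he (F ∪ l.toFinset) (by omega) (l.getLast hl) x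
  have hcd' : c ≠ d := by rintro rfl; exact hirr _ a2
  have hxl : x ∈ l := List.mem_of_mem_head? h1
  simp only [Finset.mem_union, List.mem_toFinset, not_or] at a4 a5
  refine ⟨l ++ [c, d], ⟨⟨by simp, ?_, ?_, ?_⟩, by simp; omega, by simp [hxl]⟩, ?_⟩
  · rw [List.nodup_append]
    refine ⟨h2, by simp [hcd'], ?_⟩
    intro x hx y hy
    simp at hy
    rintro rfl
    rcases hy with rfl | rfl <;> tauto
  · show List.IsChain A _
    rw [List.isChain_append]
    refine ⟨h3, by simp [a2], ?_⟩
    intro x hx y hy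
    rw [List.getLast?_eq_some_getLast hl] at hx
    simp at hx hy; subst hx hy; exact a1
  · intro h
    rw [List.head_append_of_ne_nil hl]
    rw [List.head?_eq_some_head hl] at h1
    simp at h1
    simpa [h1] using a3
  · intro v hv
    simp at hv
    rcases hv with hv | rfl | rfl
    · exact h4 v hv
    all_goals tauto

lemma seq_disjoint {ι : Type*} (I : Finset ι) (Core : ι → Finset V) (P : ι → List V → Prop)
    (N : ι → ℕ) (B : ℕ) (F0 : Finset V)
    (hcore : ∀ i ∈ I, ∀ j ∈ I, i ≠ j → Disjoint (Core i) (Core j))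
    (hcore0 : ∀ i ∈ I, Disjoint F0 (Core i))
    (hP : ∀ i ∈ I, ∀ F : Finset V, F.card ≤ B → Disjoint F (Core i) → ∃ c, P i c ∧ ∀ v ∈ c, v ∉ F)
    (hlen : ∀ i ∈ I, ∀ c, P i c → c.length ≤ N i ∧ ∀ v ∈ Core i, v ∈ c)
    (hB : F0.card + (∑ i ∈ I, (Core i).card) + ∑ i ∈ I, N i ≤ B) :
    ∃ c : ι → List V, (∀ i ∈ I, P i (c i) ∧ ∀ v ∈ c i, v ∉ F0) ∧
      ∀ i ∈ I, ∀ j ∈ I, i ≠ j → ∀ v ∈ c i, v ∉ c j := by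
  have key : ∀ J : Finset ι, J ⊆ I → ∃ c : ι → List V, (∀ i ∈ J, P i (c i) ∧ ∀ v ∈ c i, v ∉ F0 ∧ ∀ j ∈ I, j ≠ i → v ∉ Core j) ∧
      ∀ i ∈ J, ∀ j ∈ J, i ≠ j → ∀ v ∈ c i, v ∉ c j := by
    intro J
    induction J using Finset.induction_on with
    | empty => intro _; exact ⟨fun _ => [], by simp, by simp⟩
    | insert i J hi ih =>
      intro hJ
      have hiI : i ∈ I := hJ (Finset.mem_insert_self _ _)
      have hJI : J ⊆ I := (Finset.subset_insert _ _).trans hJ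
      obtain ⟨c, hc1, hc2⟩ := ih hJI
      set F : Finset V := F0 ∪ ((I.erase i).biUnion Core ∪ J.biUnion (fun j => (c j).toFinset)) with hF
      obtain ⟨d, hd1, hd2⟩ := hP i hiI F (by
        have e1 : ((I.erase i).biUnion Core).card ≤ ∑ i ∈ I, (Core i).card :=
          Finset.card_biUnion_le.trans (Finset.sum_le_sum_of_subset (Finset.erase_subset _ _))
        have e2 : (J.biUnion (fun j => (c j).toFinset)).card ≤ ∑ i ∈ I, N i := by
          refine Finset.card_biUnion_le.trans ?_
          refine le_trans ?_ (Finset.sum_le_sum_of_subset hJI)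
          apply Finset.sum_le_sum
          intro j hj
          exact (List.toFinset_card_le _).trans (hlen j (hJI hj) _ (hc1 j hj).1).1
        rw [hF]
        have := Finset.card_union_le F0 ((I.erase i).biUnion Core ∪ J.biUnion (fun j => (c j).toFinset))
        have := Finset.card_union_le ((I.erase i).biUnion Core) (J.biUnion (fun j => (c j).toFinset))
        omega) (by
        rw [Finset.disjoint_left]
        intro v hv hvi
        simp only [hF, Finset.mem_union, Finset.mem_biUnion, Finset.mem_erase, List.mem_toFinset] at hv
        rcases hv with h | ⟨j, ⟨h1, h2⟩, h3⟩ | ⟨j, h1, h2⟩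
        · exact Finset.disjoint_left.1 (hcore0 i hiI) h hvi
        · exact Finset.disjoint_left.1 (hcore j h2 i hiI h1) h3 hvi
        · exact ((hc1 j h1).2 v h2).2 i hiI (by rintro rfl; exact hi h1) hvi)
      simp only [hF, Finset.mem_union, Finset.mem_biUnion, Finset.mem_erase, List.mem_toFinset, not_or, not_exists, not_and] at hd2
      have hup : ∀ j ∈ J, Function.update c i d j = c j := fun j hj => by
        rw [Function.update_of_ne]; rintro rfl; exact hi hj
      refine ⟨Function.update c i d, ?_, ?_⟩
      · intro j hj
        rcases Finset.mem_insert.1 hj with h | h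
        · subst h
          rw [Function.update_self]
          refine ⟨hd1, fun v hv => ⟨(hd2 v hv).1, fun j' hj' hne => (hd2 v hv).2.1 j' ⟨hne, hj'⟩⟩⟩
        · rw [hup j h]
          exact hc1 j h
      · intro j hj j' hj' hne v hv
        rcases Finset.mem_insert.1 hj with h | h
        · subst h
          rw [Function.update_self] at hv
          rcases Finset.mem_insert.1 hj' with h' | h'
          · exact absurd h'.symm hne
          · rw [hup j' h']
            exact (hd2 v hv).2.2 j' h'
        · rw [hup j h] at hv
          rcases Finset.mem_insert.1 hj' with h' | h'
          · subst h'
            rw [Function.update_self]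
            intro hvd
            exact (hd2 v hvd).2.2 j h hv
          · rw [hup j' h']
            exact hc2 j h j' h' hne v hv
  obtain ⟨c, h1, h2⟩ := key I subset_rfl
  exact ⟨c, fun i hi => ⟨(h1 i hi).1, fun v hv => ((h1 i hi).2 v hv).1⟩, h2⟩

/-- Outcome: small cycles plus a Hamilton cycle on the rest. -/
def Outcome {k : ℕ} (A : V → V → Prop) (x : Fin k → V) (N : Fin k → ℕ) (i₀ : Fin k) : Prop :=
  ∃ c : Fin k → List V,
    (∀ i, i ≠ i₀ → IsDicycleList A (c i) ∧ (c i).length = N i ∧ x i ∈ c i ∧ ∀ j, j ≠ i → x j ∉ c i) ∧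
    (∀ i j, i ≠ i₀ → j ≠ i₀ → i ≠ j → ∀ v ∈ c i, v ∉ c j) ∧
    HamOn A (Finset.univ \ (Finset.univ.erase i₀).biUnion (fun i => (c i).toFinset))

lemma outcome_N {k : ℕ} {A : V → V → Prop} {g t R δ ℓ s : ℕ} (hirr : ∀ v, ¬ A v v) (hN : NProp A g)
    (hs : ∀ v, Fintype.card V ≤ 2 * (inN A v).card) (he : ∀ v, Fintype.card V ≤ 2 * (outN A v).card)
    (hgn : 2 * g < Fintype.card V) (x : Fin k → V) (hx : Function.Injective x) (N : Fin k → ℕ) (i₀ : Fin k)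
    (hN4 : ∀ i, 4 ≤ N i) (hsum : ∑ i ∈ Finset.univ.erase i₀, N i ≤ s)
    (hδ : s + 4 * t + 3 + 2 * ℓ ≤ δ) (hδ2 : k + 2 * s ≤ δ)
    (hδg : 4 * δ + 12 ≤ g) (hℓ : Fintype.card V < ℓ * R)
    (hR : (1 - (g : ℝ) / (2 * Fintype.card V)) ^ t * (Fintype.card V : ℝ) ^ 2 ≤ (1 / 2) ^ (R + 1)) :
    Outcome A x N i₀ := by
  have hle : ∀ i ∈ Finset.univ.erase i₀, N i ≤ s := fun i hi =>
    (Finset.single_le_sum (f := N) (fun _ _ => Nat.zero_le _) hi).trans hsum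
  have hIk : (Finset.univ.erase i₀).card + 1 = k := by
    rw [Finset.card_erase_of_mem (Finset.mem_univ _)]; simp
    have := i₀.2; omega
  obtain ⟨c, hc1, hc2⟩ := seq_disjoint (Finset.univ.erase i₀) (fun i => {x i})
    (fun i c => (IsDicycleList A c ∧ c.length = N i ∧ x i ∈ c) ∧ ∀ j, j ≠ i → x j ∉ c) N (k + s) {x i₀}
    (by intro i _ j _ h; simpa using fun h' => h (hx h'))
    (by intro i hi; simp at hi ⊢; exact fun h' => hi (hx h').symm)
    (by
      intro i hi F hF hdis
      have hcard : (F ∪ (Finset.univ.erase i).image x).card + N i ≤ g := by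
        have h1 := Finset.card_union_le F ((Finset.univ.erase i).image x)
        have h2 := Finset.card_image_le (s := Finset.univ.erase i) (f := x)
        have h3 := Finset.card_le_univ (Finset.univ.erase i)
        simp only [Fintype.card_fin] at h3
        have := hle i hi
        omega
      obtain ⟨c, h1, h2⟩ := smallN hirr hN hs he hgn (F ∪ (Finset.univ.erase i).image x) (x i) (by
        simp at hdis ⊢
        exact ⟨hdis, fun j hj h' => hj (hx h')⟩) (N i) (hN4 i) hcard
      refine ⟨c, ⟨h1, ?_⟩, fun v hv hF => h2 v hv (Finset.mem_union_left _ hF)⟩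
      intro j hj hjc
      exact h2 _ hjc (Finset.mem_union_right _ (Finset.mem_image_of_mem _ (by simp [hj]))))
    (by
      intro i hi c hc
      refine ⟨hc.1.2.1.le, ?_⟩
      intro v hv; simp at hv; subst hv; exact hc.1.2.2)
    (by simp only [Finset.card_singleton, Finset.sum_const, smul_eq_mul]; omega)
  refine ⟨c, ?_, ?_, ?_⟩
  · intro i hi
    obtain ⟨⟨⟨h1, h2, h3⟩, h4⟩, _⟩ := hc1 i (by simp [hi])
    exact ⟨h1, h2, h3, h4⟩
  · intro i j hi hj hij
    exact hc2 i (by simp [hi]) j (by simp [hj]) hij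
  · apply hamN (g := g) (t := t) (R := R) (δ := δ) (ℓ := ℓ) hirr hN (by omega) hs he _ (by omega) _ hδg hℓ hR
    have : ((Finset.univ.erase i₀).biUnion (fun i => (c i).toFinset)).card ≤ s := by
      refine (Finset.card_biUnion_le.trans (Finset.sum_le_sum ?_)).trans hsum
      intro i hi
      exact (List.toFinset_card_le _).trans (hc1 i hi).1.1.2.1.le
    omega
end smallN


section perm
variable {W : Type*} [Fintype W]
open Equiv.Perm

lemma merge_cycles (σ : Equiv.Perm W) (u u' : W) (h : ¬ σ.SameCycle u u') :
    (∀ x y, σ.SameCycle x y → (σ * Equiv.swap u u').SameCycle x y) ∧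
      (σ * Equiv.swap u u').SameCycle u u' := by
  have hne : u ≠ u' := by rintro rfl; exact h (SameCycle.refl _ _)
  set τ := σ * Equiv.swap u u' with hτ
  have t1 : τ u = σ u' := by simp [hτ]
  have t2 : τ u' = σ u := by simp [hτ]
  have t3 : ∀ x, x ≠ u → x ≠ u' → τ x = σ x := by
    intro x h1 h2; simp [hτ, Equiv.swap_apply_of_ne_of_ne h1 h2]
  have step : ∀ x, τ.SameCycle x (τ x) := fun x => ⟨1, by simp⟩
  have key : ∀ j : ℕ, τ.SameCycle u' ((σ ^ (j + 1)) u) := by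
    intro j
    induction j with
    | zero => simpa [← t2] using step u'
    | succ j ih =>
      rw [pow_succ', mul_apply]
      set z := (σ ^ (j + 1)) u with hz
      by_cases hzu : z = u
      · rw [hzu, ← t2]; exact step u'
      · have hzu' : z ≠ u' := by
          intro hh; exact h ⟨(j + 1 : ℕ), by rw [zpow_natCast, ← hz, hh]⟩
        rw [← t3 z hzu hzu']
        exact ih.trans (step z)
  have huu : τ.SameCycle u' u := by
    have hpos := orderOf_pos σ
    have := key (orderOf σ - 1)
    rw [Nat.sub_add_cancel hpos, pow_orderOf_eq_one] at this
    simpa using this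
  have hstep : ∀ x, τ.SameCycle x (σ x) := by
    intro x
    by_cases h1 : x = u
    · subst h1; rw [← t2]; exact huu.symm.trans (step u')
    by_cases h2 : x = u'
    · subst h2; rw [← t1]; exact huu.trans (step u)
    rw [← t3 x h1 h2]; exact step x
  refine ⟨?_, huu.symm⟩
  intro x y hxy
  obtain ⟨j, _, _, hj⟩ := hxy.exists_pow_eq'' 
  rw [← hj]
  clear hj
  have : ∀ j : ℕ, τ.SameCycle x ((σ ^ j) x) := by
    intro j
    induction j with
    | zero => simpa using SameCycle.refl τ x
    | succ j ih => rw [pow_succ', mul_apply]; exact ih.trans (hstep _)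
  exact this j

lemma list_of_cycle (R : W → W → Prop) (σ : Equiv.Perm W) (hne : Nonempty W)
    (hσ : ∀ x y, σ.SameCycle x y) (hR : ∀ w, R w (σ w)) : HamOn R Finset.univ := by
  obtain ⟨x⟩ := hne
  have hcyc : σ.IsCycleOn (Finset.univ : Finset W) := by
    refine ⟨?_, fun x _ y _ => hσ x y⟩
    simp only [Finset.coe_univ]; exact Set.bijOn_univ.2 σ.bijective
  set n := Fintype.card W with hn
  have hn0 : 0 < n := Fintype.card_pos_iff.2 ⟨x⟩
  have hpow : ∀ a b : ℕ, (σ ^ a) x = (σ ^ b) x ↔ a ≡ b [MOD n] := by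
    intro a b
    have := hcyc.pow_apply_eq_pow_apply (Finset.mem_univ x) (m := a) (n := b)
    rwa [Finset.card_univ] at this
  have hnd : ((List.range n).map (fun j => (σ ^ j) x)).Nodup := by
    rw [List.nodup_map_iff_inj_on List.nodup_range]
    intro a ha b hb hab
    simp at ha hb
    have := (hpow a b).1 hab
    exact Nat.ModEq.eq_of_lt_of_lt this ha hb
  refine ⟨(List.range n).map (fun j => (σ ^ j) x), ⟨?_, hnd, ?_, ?_⟩, ?_⟩
  · simp; omega
  · show List.IsChain R _
    rw [List.isChain_iff_getElem]
    intro j hj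
    simp only [List.getElem_map, List.getElem_range, pow_succ', mul_apply]
    exact hR _
  · intro h
    have h1 : ((List.range n).map (fun j => (σ ^ j) x)).getLast h = (σ ^ (n - 1)) x := by
      rw [List.getLast_eq_getElem]; simp
    have h2 : ((List.range n).map (fun j => (σ ^ j) x)).head h = x := by
      rw [List.head_eq_getElem]; simp
    rw [h1, h2]
    have h3 : σ ((σ ^ (n - 1)) x) = x := by
      rw [← mul_apply, ← pow_succ', Nat.sub_add_cancel hn0]
      have := (hpow n 0).2 (by simp [Nat.ModEq])
      simpa using this
    have := hR ((σ ^ (n - 1)) x)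
    rwa [h3] at this
  · apply Finset.eq_univ_of_card
    rw [List.toFinset_card_of_nodup hnd]; simp [hn]

/-- valid permutations -/
def ValidPerm (R : W → W → Prop) (i o : W → Bool) (T : Finset W) (f : W → W) (σ : Equiv.Perm W) : Prop :=
  (∀ w, R w (σ w)) ∧ (∀ w, i (σ w) = o w) ∧ ∀ w, w ∉ T → σ w = f w

lemma ham_of_perm (R : W → W → Prop) (i o : W → Bool) (T T' : Finset W) (f : W → W) (e : ℕ)
    (hT' : ∀ v, v ∈ T' ↔ ∀ w, w ∉ T → f w ≠ v)
    (h1 : ∀ u ∈ T, (T'.filter (fun v => i v = o u ∧ ¬ R u v)).card ≤ e)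
    (h2 : ∀ v ∈ T', (T.filter (fun u => o u = i v ∧ ¬ R u v)).card ≤ e)
    (hrooms : ∀ r, 4 * e < (T.filter (fun u => o u = r)).card)
    (hreach : ∀ σ, ValidPerm R i o T f σ → ∀ w, ∃ w' ∈ T, σ.SameCycle w w')
    (hconn : ∀ σ, ValidPerm R i o T f σ → ∃ u ∈ T, ∃ u' ∈ T, o u ≠ o u' ∧ σ.SameCycle u u')
    (hex : ∃ σ, ValidPerm R i o T f σ) : HamOn R Finset.univ := by
  set S : Finset (Equiv.Perm W) := Finset.univ.filter (ValidPerm R i o T f) with hS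
  obtain ⟨σ, hσS, hmax⟩ := Finset.exists_max_image S
    (fun σ => (Finset.univ.filter (fun p : W × W => σ.SameCycle p.1 p.2)).card)
    (by obtain ⟨σ, h⟩ := hex; exact ⟨σ, by simp [hS, h]⟩)
  have hσ : ValidPerm R i o T f σ := by simpa [hS] using hσS
  have hTT' : ∀ u ∈ T, σ u ∈ T' := by
    intro u hu
    rw [hT']
    intro w hw hwu
    rw [← hσ.2.2 w hw] at hwu
    have := σ.injective hwu
    subst this; exact hw hu
  -- no swaps
  have hno : ∀ u ∈ T, ∀ u' ∈ T, o u = o u' → R u (σ u') → R u' (σ u) → σ.SameCycle u u' := by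
    intro u hu u' hu' ho hr hr'
    by_contra hnot
    obtain ⟨m1, m2⟩ := merge_cycles σ u u' hnot
    have hne : u ≠ u' := by rintro rfl; exact hnot (SameCycle.refl _ _)
    set τ := σ * Equiv.swap u u' with hτ
    have t1 : τ u = σ u' := by simp [hτ]
    have t2 : τ u' = σ u := by simp [hτ]
    have t3 : ∀ x, x ≠ u → x ≠ u' → τ x = σ x := by
      intro x h1 h2; simp [hτ, Equiv.swap_apply_of_ne_of_ne h1 h2]
    have hval : ValidPerm R i o T f τ := by
      refine ⟨?_, ?_, ?_⟩
      · intro w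
        by_cases w1 : w = u
        · subst w1; rw [t1]; exact hr
        by_cases w2 : w = u'
        · subst w2; rw [t2]; exact hr'
        rw [t3 w w1 w2]; exact hσ.1 w
      · intro w
        by_cases w1 : w = u
        · subst w1; rw [t1, ho]; exact hσ.2.1 _
        by_cases w2 : w = u'
        · subst w2; rw [t2, ← ho]; exact hσ.2.1 _
        rw [t3 w w1 w2]; exact hσ.2.1 w
      · intro w hw
        rw [t3 w (by rintro rfl; exact hw hu) (by rintro rfl; exact hw hu')]
        exact hσ.2.2 w hw
    have hle := hmax τ (by simp [hS, hval])
    have hlt : (Finset.univ.filter (fun p : W × W => σ.SameCycle p.1 p.2)).card <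
        (Finset.univ.filter (fun p : W × W => τ.SameCycle p.1 p.2)).card := by
      apply Finset.card_lt_card
      rw [Finset.ssubset_iff_of_subset]
      · exact ⟨(u, u'), by simpa using m2, by simpa using hnot⟩
      · intro p hp
        simp at hp ⊢
        exact m1 _ _ hp
    omega
  -- each u sees almost all of its room
  have hsee : ∀ u ∈ T, ((T.filter (fun v => o v = o u)).filter (fun v => ¬ σ.SameCycle u v)).card ≤ 2 * e := by
    intro u hu
    have hsub : (T.filter (fun v => o v = o u)).filter (fun v => ¬ σ.SameCycle u v) ⊆
        (T.filter (fun v => o v = o u ∧ ¬ R u (σ v))) ∪ (T.filter (fun v => o v = i (σ u) ∧ ¬ R v (σ u))) := by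
      intro v hv
      simp only [Finset.mem_filter, Finset.mem_union] at hv ⊢
      obtain ⟨⟨v1, v2⟩, v3⟩ := hv
      rw [hσ.2.1 u]
      by_contra hcon
      push Not at hcon
      exact v3 (hno u hu v v1 v2.symm (hcon.1 v1 v2) (hcon.2 v1 v2))
    have a1 : (T.filter (fun v => o v = o u ∧ ¬ R u (σ v))).card ≤ e := by
      refine le_trans ?_ (h1 u hu)
      apply Finset.card_le_card_of_injOn σ
      · intro v hv
        simp at hv ⊢
        exact ⟨hTT' v hv.1, by rw [hσ.2.1, hv.2.1], hv.2.2⟩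
      · exact σ.injective.injOn
    have a2 := h2 (σ u) (hTT' u hu)
    have a3 := Finset.card_le_card hsub
    have a4 := Finset.card_union_le (T.filter (fun v => o v = o u ∧ ¬ R u (σ v))) (T.filter (fun v => o v = i (σ u) ∧ ¬ R v (σ u)))
    omega
  have hroom : ∀ u ∈ T, ∀ u' ∈ T, o u = o u' → σ.SameCycle u u' := by
    intro u hu u' hu' ho
    by_contra hnot
    have b1 := hsee u hu
    have b2 := hsee u' hu'
    rw [← ho] at b2
    have hsub : (T.filter (fun v => o v = o u)) ⊆ ((T.filter (fun v => o v = o u)).filter (fun v => ¬ σ.SameCycle u v)) ∪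
        ((T.filter (fun v => o v = o u)).filter (fun v => ¬ σ.SameCycle u' v)) := by
      intro v hv
      simp only [Finset.mem_union, Finset.mem_filter] at hv ⊢
      by_cases hc : σ.SameCycle u v
      · right; exact ⟨hv, fun hc' => hnot (hc.trans hc'.symm)⟩
      · left; exact ⟨hv, hc⟩
    have b3 := Finset.card_le_card hsub
    have b4 := Finset.card_union_le ((T.filter (fun v => o v = o u)).filter (fun v => ¬ σ.SameCycle u v))
        ((T.filter (fun v => o v = o u)).filter (fun v => ¬ σ.SameCycle u' v))
    have := hrooms (o u)
    omega
  obtain ⟨p, hp, q, hq, hpq, hsc⟩ := hconn σ hσ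
  have hall : ∀ u ∈ T, σ.SameCycle p u := by
    intro u hu
    by_cases hup : o u = o p
    · exact hroom p hp u hu hup.symm
    · have : o q = o u := by
        revert hup hpq
        cases o u <;> cases o p <;> cases o q <;> simp
      exact hsc.trans (hroom q hq u hu this)
  refine list_of_cycle R σ ⟨p⟩ ?_ hσ.1
  intro x y
  obtain ⟨x', hx', hxs⟩ := hreach σ hσ x
  obtain ⟨y', hy', hys⟩ := hreach σ hσ y
  exact hxs.trans (((hall x' hx').symm.trans (hall y' hy')).trans hys.symm)
end perm


section rooms
variable {W : Type*} [Fintype W]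
open Equiv.Perm

lemma exists_valid (R : W → W → Prop) (i o : W → Bool) (T T' : Finset W) (f : W → W) (e : ℕ)
    (hT' : ∀ v, v ∈ T' ↔ ∀ w, w ∉ T → f w ≠ v)
    (h1 : ∀ u ∈ T, (T'.filter (fun v => i v = o u ∧ ¬ R u v)).card ≤ e)
    (h2 : ∀ v ∈ T', (T.filter (fun u => o u = i v ∧ ¬ R u v)).card ≤ e)
    (hrooms : ∀ r, 4 * e < (T.filter (fun u => o u = r)).card)
    (hbal : (Finset.univ.filter (fun w => i w = true)).card = (Finset.univ.filter (fun w => o w = true)).card)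
    (hf1 : ∀ w, w ∉ T → ∀ w', w' ∉ T → f w = f w' → w = w')
    (hf2 : ∀ w, w ∉ T → i (f w) = o w) (hf3 : ∀ w, w ∉ T → R w (f w)) :
    ∃ σ, ValidPerm R i o T f σ := by
  have hbal' : ∀ r, (Finset.univ.filter (fun w => i w = r)).card = (Finset.univ.filter (fun w => o w = r)).card := by
    intro r
    cases r
    · have a1 := Finset.card_filter_add_card_filter_not (s := (Finset.univ : Finset W)) (fun w => i w = true)
      have a2 := Finset.card_filter_add_card_filter_not (s := (Finset.univ : Finset W)) (fun w => o w = true)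
      simp only [Bool.not_eq_true] at a1 a2
      omega
    · exact hbal
  have hsize : ∀ r, (T.filter (fun u => o u = r)).card = (T'.filter (fun v => i v = r)).card := by
    intro r
    have b1 : (Tᶜ.filter (fun u => o u = r)).card = (T'ᶜ.filter (fun v => i v = r)).card := by
      apply Finset.card_bij (fun w _ => f w)
      · intro w hw
        simp only [Finset.mem_filter, Finset.mem_compl] at hw ⊢
        refine ⟨?_, by rw [hf2 w hw.1, hw.2]⟩
        rw [hT']; push Not; exact ⟨w, hw.1, rfl⟩
      · intro w hw w' hw' h
        simp only [Finset.mem_filter, Finset.mem_compl] at hw hw'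
        exact hf1 w hw.1 w' hw'.1 h
      · intro v hv
        simp only [Finset.mem_filter, Finset.mem_compl] at hv
        obtain ⟨hv1, hv2⟩ := hv
        rw [hT'] at hv1; push Not at hv1
        obtain ⟨w, hw, rfl⟩ := hv1
        exact ⟨w, by simp [hw, ← hf2 w hw, hv2], rfl⟩
    have c1 : (T.filter (fun u => o u = r)).card + (Tᶜ.filter (fun u => o u = r)).card = (Finset.univ.filter (fun w => o w = r)).card := by
      rw [← Finset.card_union_of_disjoint]
      · congr 1; ext w; simp; tauto
      · exact Finset.disjoint_filter_filter disjoint_compl_right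
    have c2 : (T'.filter (fun u => i u = r)).card + (T'ᶜ.filter (fun u => i u = r)).card = (Finset.univ.filter (fun w => i w = r)).card := by
      rw [← Finset.card_union_of_disjoint]
      · congr 1; ext w; simp; tauto
      · exact Finset.disjoint_filter_filter disjoint_compl_right
    have := hbal' r
    omega
  set t : T → Finset W := fun u => T'.filter (fun v => i v = o u ∧ R u v) with ht
  have hall : ∀ s : Finset T, s.card ≤ (s.biUnion t).card := by
    intro s
    have hr : ∀ r, (s.filter (fun u : T => o u = r)).card ≤ ((s.biUnion t).filter (fun v => i v = r)).card := by
      intro r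
      rcases (s.filter (fun u : T => o u = r)).eq_empty_or_nonempty with h0 | ⟨u, hu⟩
      · rw [h0]; simp
      simp only [Finset.mem_filter] at hu
      have hm := hsize r
      have hrm := hrooms r
      have hsr : (s.filter (fun u : T => o u = r)).card ≤ (T.filter (fun u => o u = r)).card := by
        apply Finset.card_le_card_of_injOn (fun u : T => (u : W))
        · intro x hx; simp at hx ⊢; exact hx.2
        · exact Subtype.val_injective.injOn
      by_cases hse : (s.filter (fun u : T => o u = r)).card ≤ e
      · have hsub : T'.filter (fun v => i v = r) ⊆ (s.biUnion t).filter (fun v => i v = r) ∪ T'.filter (fun v => i v = o u ∧ ¬ R u v) := by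
          intro v hv
          simp only [Finset.mem_filter, Finset.mem_union, Finset.mem_biUnion, ht] at hv ⊢
          by_cases hR : R u v
          · left; exact ⟨⟨u, hu.1, hv.1, by rw [hv.2, hu.2], hR⟩, hv.2⟩
          · right; exact ⟨hv.1, by rw [hv.2, hu.2], hR⟩
        have := Finset.card_le_card hsub
        have := Finset.card_union_le ((s.biUnion t).filter (fun v => i v = r)) (T'.filter (fun v => i v = o u ∧ ¬ R u v))
        have := h1 u u.2
        omega
      · have hsub : T'.filter (fun v => i v = r) ⊆ (s.biUnion t).filter (fun v => i v = r) := by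
          intro v hv
          simp only [Finset.mem_filter, Finset.mem_biUnion, ht] at hv ⊢
          refine ⟨?_, hv.2⟩
          by_contra hcon
          push Not at hcon
          apply hse
          refine le_trans ?_ (h2 v hv.1)
          apply Finset.card_le_card_of_injOn (fun u : T => (u : W))
          · intro x hx
            simp at hx ⊢
            exact ⟨by rw [hx.2, hv.2], hcon x hx.1 hv.1 (by rw [hx.2, hv.2])⟩
          · exact Subtype.val_injective.injOn
        have := Finset.card_le_card hsub
        omega
    have a1 := Finset.card_filter_add_card_filter_not (s := s) (fun w : T => o w = true)
    have a2 := Finset.card_filter_add_card_filter_not (s := s.biUnion t) (fun w => i w = true)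
    simp only [Bool.not_eq_true] at a1 a2
    have := hr true
    have := hr false
    omega
  obtain ⟨m, hm1, hm2⟩ := (Finset.all_card_le_biUnion_card_iff_exists_injective t).1 hall
  simp only [ht, Finset.mem_filter] at hm2
  set F : W → W := fun w => if h : w ∈ T then m ⟨w, h⟩ else f w with hF
  have F1 : ∀ w (h : w ∈ T), F w = m ⟨w, h⟩ := fun w h => by simp [hF, h]
  have F2 : ∀ w, w ∉ T → F w = f w := fun w h => by simp [hF, h]
  have hinj : Function.Injective F := by
    intro w w' hww
    by_cases h : w ∈ T <;> by_cases h' : w' ∈ T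
    · rw [F1 w h, F1 w' h'] at hww
      have := hm1 hww
      simpa using this
    · rw [F1 w h, F2 w' h'] at hww
      have := (hm2 ⟨w, h⟩).1
      rw [hT'] at this
      exact absurd hww.symm (this w' h')
    · rw [F2 w h, F1 w' h'] at hww
      have := (hm2 ⟨w', h'⟩).1
      rw [hT'] at this
      exact absurd hww (this w h)
    · rw [F2 w h, F2 w' h'] at hww
      exact hf1 w h w' h' hww
  refine ⟨Equiv.ofBijective F (Finite.injective_iff_bijective.1 hinj), ?_, ?_, ?_⟩
  · intro w
    rw [Equiv.ofBijective_apply]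
    by_cases h : w ∈ T
    · rw [F1 w h]; exact (hm2 ⟨w, h⟩).2.2
    · rw [F2 w h]; exact hf3 w h
  · intro w
    rw [Equiv.ofBijective_apply]
    by_cases h : w ∈ T
    · rw [F1 w h]; exact (hm2 ⟨w, h⟩).2.1
    · rw [F2 w h]; exact hf2 w h
  · intro w h
    rw [Equiv.ofBijective_apply, F2 w h]

lemma ham_rooms (R : W → W → Prop) (i o : W → Bool) (Gd G' : Finset W) (e : ℕ) (hG' : G' ⊆ Gd)
    (hout : ∀ u ∈ Gd, (Gd.filter (fun v => i v = o u ∧ ¬ R u v)).card ≤ e)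
    (hin : ∀ v ∈ Gd, (Gd.filter (fun u => o u = i v ∧ ¬ R u v)).card ≤ e)
    (hbal : (Finset.univ.filter (fun w => i w = true)).card = (Finset.univ.filter (fun w => o w = true)).card)
    (hpo : ∀ w, w ∉ Gd → 2 * Gdᶜ.card ≤ (G'.filter (fun v => i v = o w ∧ R w v)).card)
    (hpi : ∀ w, w ∉ Gd → 2 * Gdᶜ.card ≤ (G'.filter (fun u => o u = i w ∧ R u w)).card)
    (hrooms : ∀ r, 4 * e + Gdᶜ.card < (Gd.filter (fun u => o u = r)).card)
    (hconn : 2 * Gdᶜ.card < (Gd.filter (fun w => i w ≠ o w)).card ∨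
      ((∃ w, w ∉ Gd ∧ i w ≠ o w) ∧ ∀ v ∈ G', i v = o v)) :
    HamOn R Finset.univ := by
  set B := {w : W // w ∉ Gd} with hB
  have hBc : Fintype.card B = Gdᶜ.card := by
    rw [Fintype.card_subtype]; congr 1; ext; simp
  set t : B ⊕ B → Finset W := fun z => match z with
    | Sum.inl w => G'.filter (fun v => i v = o w ∧ R w v)
    | Sum.inr w => G'.filter (fun u => o u = i w ∧ R u w) with ht
  have htc : ∀ z, 2 * Gdᶜ.card ≤ (t z).card := by
    rintro (w | w)
    · exact hpo w w.2
    · exact hpi w w.2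
  obtain ⟨p, hp1, hp2⟩ := (Finset.all_card_le_biUnion_card_iff_exists_injective t).1 (by
    intro s
    rcases s.eq_empty_or_nonempty with rfl | ⟨z, hz⟩
    · simp
    · have h1 := Finset.card_le_univ s
      rw [Fintype.card_sum, hBc] at h1
      have h2 := htc z
      have h3 := Finset.card_le_card (Finset.subset_biUnion_of_mem t hz)
      omega)
  set a : B → W := fun w => p (Sum.inl w) with ha
  set b : B → W := fun w => p (Sum.inr w) with hb
  have a1 : ∀ w, a w ∈ G' ∧ i (a w) = o w ∧ R w (a w) := fun w => by
    have := hp2 (Sum.inl w); simpa [ht] using this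
  have b1 : ∀ w, b w ∈ G' ∧ o (b w) = i w ∧ R (b w) w := fun w => by
    have := hp2 (Sum.inr w); simpa [ht] using this
  have a2 : Function.Injective a := fun x y h => by simpa using hp1 h
  have b2 : Function.Injective b := fun x y h => by simpa using hp1 h
  have ab : ∀ x y, a x ≠ b y := fun x y h => by simpa using hp1 h
  set T : Finset W := Gd.filter (fun w => ∀ w', b w' ≠ w) with hT
  have hTn : ∀ w, w ∉ T ↔ w ∉ Gd ∨ ∃ w', b w' = w := by
    intro w; simp only [hT, Finset.mem_filter]
    constructor
    · intro h; by_cases hw : w ∈ Gd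
      · right; by_contra hc; push Not at hc; exact h ⟨hw, hc⟩
      · left; exact hw
    · rintro (h | ⟨w', h⟩) ⟨h1, h2⟩
      · exact h h1
      · exact h2 w' h
  set f : W → W := fun w => if h : w ∉ Gd then a ⟨w, h⟩ else if h : ∃ w', b w' = w then (h.choose : W) else w with hf
  have f1 : ∀ w : B, f w = a w := fun w => by simp only [hf]; rw [dif_pos w.2]
  have f2 : ∀ w : B, f (b w) = w := fun w => by
    have h1 : b w ∈ Gd := hG' (b1 w).1
    have h2 : ∃ w', b w' = b w := ⟨w, rfl⟩
    simp only [hf, h1, not_true_eq_false, dif_neg, not_false_eq_true, h2, dif_pos]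
    exact congrArg Subtype.val (b2 h2.choose_spec)
  set T' : Finset W := Finset.univ.filter (fun v => ∀ w, w ∉ T → f w ≠ v) with hT'
  have hT'm : ∀ v, v ∈ T' ↔ ∀ w, w ∉ T → f w ≠ v := by intro v; simp [hT']
  have hT'2 : ∀ v, v ∈ T' ↔ v ∈ Gd ∧ ∀ w, a w ≠ v := by
    intro v
    rw [hT'm]
    constructor
    · intro h
      refine ⟨?_, ?_⟩
      · by_contra hv
        exact h (b ⟨v, hv⟩) ((hTn _).2 (Or.inr ⟨_, rfl⟩)) (f2 ⟨v, hv⟩)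
      · intro w hw
        exact h w ((hTn _).2 (Or.inl w.2)) (by rw [f1, hw])
    · rintro ⟨h1, h2⟩ w hw hfw
      rcases (hTn w).1 hw with h | ⟨w', rfl⟩
      · rw [f1 ⟨w, h⟩] at hfw; exact h2 _ hfw
      · rw [f2] at hfw; rw [← hfw] at h1; exact w'.2 h1
  have hTG : T ⊆ Gd := Finset.filter_subset _ _
  have hT'G : T' ⊆ Gd := fun v hv => ((hT'2 v).1 hv).1
  have h1 : ∀ u ∈ T, (T'.filter (fun v => i v = o u ∧ ¬ R u v)).card ≤ e := fun u hu =>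
    (Finset.card_le_card (Finset.filter_subset_filter _ hT'G)).trans (hout u (hTG hu))
  have h2 : ∀ v ∈ T', (T.filter (fun u => o u = i v ∧ ¬ R u v)).card ≤ e := fun u hu =>
    (Finset.card_le_card (Finset.filter_subset_filter _ hTG)).trans (hin u (hT'G hu))
  have hr : ∀ r, 4 * e < (T.filter (fun u => o u = r)).card := by
    intro r
    have hsub : Gd.filter (fun u => o u = r) ⊆ T.filter (fun u => o u = r) ∪ Finset.univ.image b := by
      intro w hw
      simp only [Finset.mem_filter, Finset.mem_union, Finset.mem_image, Finset.mem_univ, true_and] at hw ⊢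
      by_cases h : w ∈ T
      · left; exact ⟨h, hw.2⟩
      · right; rcases (hTn w).1 h with h | h
        · exact absurd hw.1 h
        · exact h
    have e1 := Finset.card_le_card hsub
    have e2 := Finset.card_union_le (T.filter (fun u => o u = r)) (Finset.univ.image b)
    have e3 := Finset.card_image_le (s := (Finset.univ : Finset B)) (f := b)
    rw [Finset.card_univ, hBc] at e3
    have := hrooms r
    omega
  have step : ∀ (σ : Equiv.Perm W) x, σ.SameCycle x (σ x) := fun σ x => ⟨1, by simp⟩
  have haT : ∀ w, a w ∈ T := by
    intro w
    by_contra h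
    rcases (hTn _).1 h with h | ⟨w', h⟩
    · exact h (hG' (a1 w).1)
    · exact ab _ _ h.symm
  have hpre : ∀ σ, ValidPerm R i o T f σ → ∀ v ∈ T', σ⁻¹ v ∈ T := by
    intro σ hσ v hv
    by_contra h
    refine (hT'm v).1 hv _ h ?_
    rw [← hσ.2.2 _ h]; simp
  refine ham_of_perm R i o T T' f e hT'm h1 h2 hr ?_ ?_ ?_
  · intro σ hσ w
    have hbad : ∀ w : B, σ w = a w := fun w => by rw [hσ.2.2 _ ((hTn _).2 (Or.inl w.2)), f1]
    by_cases hw : w ∈ T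
    · exact ⟨w, hw, SameCycle.refl _ _⟩
    · rcases (hTn w).1 hw with h | ⟨w', rfl⟩
      · exact ⟨a ⟨w, h⟩, haT _, by rw [← hbad]; exact step σ w⟩
      · refine ⟨a w', haT _, ?_⟩
        have e1 : σ (b w') = w' := by rw [hσ.2.2 _ hw, f2]
        have e2 := step σ (b w')
        rw [e1] at e2
        rw [← hbad]
        exact e2.trans (step σ _)
  · intro σ hσ
    have hbad : ∀ w : B, σ w = a w := fun w => by rw [hσ.2.2 _ ((hTn _).2 (Or.inl w.2)), f1]
    rcases hconn with hc | ⟨⟨w, hw, hio⟩, hd⟩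
    · obtain ⟨w, hw, hwn⟩ := exists_out (Gd.filter (fun w => i w ≠ o w)) (Finset.univ.image a ∪ Finset.univ.image b) (by
        have e2 := Finset.card_union_le (Finset.univ.image a) (Finset.univ.image b)
        have e3 := Finset.card_image_le (s := (Finset.univ : Finset B)) (f := b)
        have e4 := Finset.card_image_le (s := (Finset.univ : Finset B)) (f := a)
        rw [Finset.card_univ, hBc] at e3 e4
        omega)
      simp only [Finset.mem_filter, Finset.mem_union, Finset.mem_image, Finset.mem_univ, true_and, not_or, not_exists] at hw hwn
      have w1 : w ∈ T := by
        by_contra h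
        rcases (hTn _).1 h with h | ⟨w', h⟩
        · exact h hw.1
        · exact hwn.2 w' h
      have w2 : w ∈ T' := (hT'2 w).2 ⟨hw.1, hwn.1⟩
      refine ⟨σ⁻¹ w, hpre σ hσ w w2, w, w1, ?_, ?_⟩
      · rw [← hσ.2.1]; simpa using hw.2
      · have := step σ (σ⁻¹ w); simpa using this
    · set w' : B := ⟨w, hw⟩ with hw'
      have hbT' : b w' ∈ T' := (hT'2 _).2 ⟨hG' (b1 w').1, fun x => ab x w'⟩
      refine ⟨σ⁻¹ (b w'), hpre σ hσ _ hbT', a w', haT _, ?_, ?_⟩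
      · have e1 : o (σ⁻¹ (b w')) = i w := by
          rw [← hσ.2.1, show σ (σ⁻¹ (b w')) = b w' by simp]
          rw [hd _ (b1 w').1, (b1 w').2.1]
        have e2 : o (a w') = o w := by rw [← hd _ (a1 w').1, (a1 w').2.1]
        rw [e1, e2]; exact hio
      · have s1 := step σ (σ⁻¹ (b w'))
        rw [show σ (σ⁻¹ (b w')) = b w' by simp] at s1
        have e1 : σ (b w') = w' := by rw [hσ.2.2 _ ((hTn _).2 (Or.inr ⟨_, rfl⟩)), f2]
        have s2 := step σ (b w')
        rw [e1] at s2
        rw [← hbad]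
        exact (s1.trans s2).trans (step σ _)
  · refine exists_valid R i o T T' f e hT'm h1 h2 hr hbal ?_ ?_ ?_
    · intro w hw w' hw' hff
      rcases (hTn w).1 hw with h | ⟨z, rfl⟩ <;> rcases (hTn w').1 hw' with h' | ⟨z', rfl⟩
      · rw [f1 ⟨w, h⟩, f1 ⟨w', h'⟩] at hff
        exact congrArg Subtype.val (a2 hff)
      · rw [f1 ⟨w, h⟩, f2] at hff
        exact absurd (hff ▸ hG' (a1 _).1) z'.2
      · rw [f1 ⟨w', h'⟩, f2] at hff
        exact absurd (hff ▸ hG' (a1 _).1) z.2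
      · rw [f2, f2] at hff
        rw [Subtype.ext hff]
    · intro w hw
      rcases (hTn w).1 hw with h | ⟨z, rfl⟩
      · rw [f1 ⟨w, h⟩]; exact (a1 _).2.1
      · rw [f2]; exact (b1 z).2.1.symm
    · intro w hw
      rcases (hTn w).1 hw with h | ⟨z, rfl⟩
      · rw [f1 ⟨w, h⟩]; exact (a1 ⟨w, h⟩).2.2
      · rw [f2]; exact (b1 z).2.2
end rooms


section struct
variable {V : Type*} [Fintype V]

/-- a room -/
noncomputable def room (f : V → Bool) (b : Bool) : Finset V := Finset.univ.filter (fun v => f v = b)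

lemma earcs_eq_out (A : V → V → Prop) (S T : Finset V) :
    earcs A S T = ∑ u ∈ S, (T ∩ outN A u).card := by
  unfold earcs
  rw [Finset.card_filter, Finset.sum_product]
  refine Finset.sum_congr rfl fun u _ => ?_
  rw [← Finset.card_filter]
  congr 1; ext v; simp

lemma earcs_eq_in (A : V → V → Prop) (S T : Finset V) :
    earcs A S T = ∑ v ∈ T, (S ∩ inN A v).card := by
  unfold earcs
  rw [Finset.card_filter, Finset.sum_product_right]
  refine Finset.sum_congr rfl fun u _ => ?_
  rw [← Finset.card_filter]
  congr 1; ext v; simp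

lemma earcs_flip (A : V → V → Prop) (S T : Finset V) :
    earcs (fun u v => A v u) T S = earcs A S T := by
  rw [earcs_eq_out, earcs_eq_in]; rfl

lemma markov {ι : Type*} (S : Finset ι) (f : ι → ℕ) (D : ℕ) :
    (S.filter (fun u => D ≤ f u)).card * D ≤ ∑ u ∈ S, f u := by
  calc _ ≤ ∑ u ∈ S.filter (fun u => D ≤ f u), f u := by
        rw [← smul_eq_mul]
        exact Finset.card_nsmul_le_sum _ _ _ (fun u hu => (Finset.mem_filter.1 hu).2)
    _ ≤ _ := Finset.sum_le_sum_of_subset (Finset.filter_subset _ _)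

lemma struct_half (A : V → V → Prop) (S T : Finset V) (g D E : ℕ)
    (he : ∀ v, Fintype.card V ≤ 2 * (outN A v).card)
    (hST : earcs A S T < g * Fintype.card V)
    (hS : Fintype.card V ≤ 2 * S.card + 2 * g) (hT : Fintype.card V ≤ 2 * T.card + 2 * g)
    (hg : g ≤ D) (hD : g * Fintype.card V ≤ D * D) (hE : 12 * (D * Fintype.card V) ≤ E * E)
    (hDE : 8 * D ≤ E) (hn : 2 * g + 2 * D + 2 ≤ Fintype.card V) :
    ∃ B : Finset V, 2 * B.card ≤ E ∧ (∀ u ∈ S, u ∉ B → (Tᶜ \ outN A u).card ≤ E) ∧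
      (∀ v ∈ Tᶜ, v ∉ B → (S \ inN A v).card ≤ E) ∧ Fintype.card V ≤ 2 * Tᶜ.card + 2 * E := by
  set n := Fintype.card V with hnn
  have hTc : Tᶜ.card + T.card = n := by rw [Finset.card_compl]; have := Finset.card_le_univ T; omega
  set B1 := S.filter (fun u => D ≤ (T ∩ outN A u).card) with hB1
  have hD0 : 0 < D := by
    rcases Nat.eq_zero_or_pos D with h | h
    · subst h; have : g = 0 := by omega
      subst this; simp at hST
    · exact h
  have hB1c : B1.card < D := by
    have h1 : B1.card * D ≤ ∑ u ∈ S, (T ∩ outN A u).card := markov S (fun u => (T ∩ outN A u).card) D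
    rw [← earcs_eq_out] at h1
    have : B1.card * D < D * D := by omega
    exact lt_of_mul_lt_mul_right this (Nat.zero_le _)
  have hdeg : ∀ u, (outN A u).card ≤ (T ∩ outN A u).card + (Tᶜ ∩ outN A u).card := by
    intro u
    rw [← Finset.card_union_of_disjoint]
    · apply Finset.card_le_card; intro v; simp; tauto
    · rw [Finset.disjoint_left]; intro v; simp; tauto
  have hspl : ∀ u, (Tᶜ \ outN A u).card + (Tᶜ ∩ outN A u).card = Tᶜ.card := fun u =>
    Finset.card_sdiff_add_card_inter _ _
  have hgood : ∀ u ∈ S, u ∉ B1 → (Tᶜ \ outN A u).card ≤ g + D := by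
    intro u hu hu1
    have h1 : (T ∩ outN A u).card < D := by
      by_contra h; exact hu1 (by simp [hB1, hu]; omega)
    have := hdeg u
    have := hspl u
    have := he u
    omega
  have htot : ∑ u ∈ S, (Tᶜ \ outN A u).card ≤ 3 * (D * n) := by
    calc ∑ u ∈ S, (Tᶜ \ outN A u).card ≤ ∑ u ∈ S, ((g + D) + if u ∈ B1 then n else 0) := by
          apply Finset.sum_le_sum; intro u hu
          by_cases h : u ∈ B1
          · simp only [h, if_true]
            have := Finset.card_le_univ (Tᶜ \ outN A u); omega
          · simp only [h, if_false]; simpa using hgood u hu h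
      _ ≤ n * (g + D) + D * n := by
          rw [Finset.sum_add_distrib, Finset.sum_const, smul_eq_mul, ← Finset.sum_filter, Finset.sum_const, smul_eq_mul]
          have h1 : (S.filter (fun u => u ∈ B1)).card ≤ D := by
            refine le_trans (Finset.card_le_card ?_) hB1c.le
            intro u; simp
          have h2 := Finset.card_le_univ S
          gcongr
      _ ≤ _ := by nlinarith
  have hsw : ∑ v ∈ Tᶜ, (S \ inN A v).card = ∑ u ∈ S, (Tᶜ \ outN A u).card := by
    have e1 := earcs_eq_out (fun u v => ¬ A u v) S Tᶜ
    have e2 := earcs_eq_in (fun u v => ¬ A u v) S Tᶜ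
    have e3 : ∀ v, S ∩ inN (fun u v => ¬ A u v) v = S \ inN A v := by intro v; ext; simp
    have e4 : ∀ v, Tᶜ ∩ outN (fun u v => ¬ A u v) v = Tᶜ \ outN A v := by intro v; ext; simp
    simp only [e3, e4] at e1 e2
    omega
  set B2 := Tᶜ.filter (fun v => E ≤ (S \ inN A v).card) with hB2
  have hB2c : 4 * B2.card ≤ E := by
    have h1 := markov Tᶜ (fun v => (S \ inN A v).card) E
    have h2 : (4 * B2.card) * E ≤ E * E := by
      have : B2.card * E ≤ 3 * (D * n) := by rw [← hsw] at htot; exact h1.trans htot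
      nlinarith
    exact Nat.le_of_mul_le_mul_right h2 (by omega)
  have hSD : D < S.card := by omega
  obtain ⟨u, hu, hu1⟩ := exists_out S B1 (by omega)
  refine ⟨B1 ∪ B2, ?_, ?_, ?_, ?_⟩
  · have := Finset.card_union_le B1 B2; omega
  · intro u hu hu1
    have := hgood u hu (fun h => hu1 (Finset.mem_union_left _ h)); omega
  · intro v hv hv1
    by_contra h
    exact hv1 (Finset.mem_union_right _ (by simp only [hB2, Finset.mem_filter]; exact ⟨hv, by omega⟩))
  · have h1 : (T ∩ outN A u).card < D := by
      by_contra h; exact hu1 (by simp [hB1, hu]; omega)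
    have := hdeg u
    have := hspl u
    have := he u
    omega

/-- extremal structure -/
structure Str (A : V → V → Prop) (i o : V → Bool) (G : Finset V) (E : ℕ) : Prop where
  g1 : Gᶜ.card ≤ E
  g2 : ∀ u ∈ G, (room i (o u) \ outN A u).card ≤ E
  g3 : ∀ v ∈ G, (room o (i v) \ inN A v).card ≤ E
  g4o : ∀ b, Fintype.card V ≤ 2 * (room o b).card + 2 * E
  g4i : ∀ b, Fintype.card V ≤ 2 * (room i b).card + 2 * E

lemma struct_E0 (A : V → V → Prop) (S T : Finset V) (g D E : ℕ)
    (hs : ∀ v, Fintype.card V ≤ 2 * (inN A v).card)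
    (he : ∀ v, Fintype.card V ≤ 2 * (outN A v).card)
    (hST : earcs A S T < g * Fintype.card V)
    (hS : Fintype.card V ≤ 2 * S.card + 2 * g) (hT : Fintype.card V ≤ 2 * T.card + 2 * g)
    (hg : g ≤ D) (hD : g * Fintype.card V ≤ D * D) (hE : 12 * (D * Fintype.card V) ≤ E * E)
    (hDE : 8 * D ≤ E) (hn : 2 * g + 2 * D + 2 ≤ Fintype.card V) :
    ∃ (i o : V → Bool) (G : Finset V), Str A i o G E := by
  obtain ⟨B, b1, b2, b3, b4⟩ := struct_half A S T g D E he hST hS hT hg hD hE hDE hn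
  obtain ⟨B', c1, c2, c3, c4⟩ := struct_half (fun u v => A v u) T S g D E hs
    (by rw [earcs_flip]; exact hST) hT hS hg hD hE hDE hn
  set i : V → Bool := fun v => decide (v ∉ T) with hi
  set o : V → Bool := fun v => decide (v ∈ S) with ho
  have r1 : room i true = Tᶜ := by ext; simp [room, hi]
  have r2 : room i false = T := by ext; simp [room, hi]
  have r3 : room o true = S := by ext; simp [room, ho]
  have r4 : room o false = Sᶜ := by ext; simp [room, ho]
  refine ⟨i, o, (B ∪ B')ᶜ, ?_, ?_, ?_, ?_, ?_⟩
  · rw [compl_compl]; have := Finset.card_union_le B B'; omega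
  · intro u hu
    simp only [Finset.mem_compl, Finset.mem_union, not_or] at hu
    by_cases h : u ∈ S
    · have : o u = true := by simp [ho, h]
      rw [this, r1]; exact b2 u h hu.1
    · have : o u = false := by simp [ho, h]
      rw [this, r2]; exact c3 u (by simpa using h) hu.2
  · intro v hv
    simp only [Finset.mem_compl, Finset.mem_union, not_or] at hv
    by_cases h : v ∈ T
    · have : i v = false := by simp [hi, h]
      rw [this, r4]; exact c2 v h hv.2
    · have : i v = true := by simp [hi, h]
      rw [this, r3]; exact b3 v (by simpa using h) hv.1
  · intro b; cases b
    · rw [r4]; exact c4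
    · rw [r3]; omega
  · intro b; cases b
    · rw [r2]; omega
    · rw [r1]; exact b4
end struct


section labels
variable {V : Type*} [Fintype V]

/-- weakly allowed out label -/
def wo (A : V → V → Prop) (i : V → Bool) (H : ℕ) (b : Bool) (v : V) : Prop :=
  H ≤ (room i b ∩ outN A v).card
/-- weakly allowed in label -/
def wi (A : V → V → Prop) (o : V → Bool) (H : ℕ) (b : Bool) (v : V) : Prop :=
  H ≤ (room o b ∩ inN A v).card
/-- minimal imbalance -/
noncomputable def lo (A : V → V → Prop) (i o : V → Bool) (H : ℕ) (b : Bool) (v : V) : ℤ :=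
  (if wo A i H (!b) v then 0 else 1) + (if wi A o H b v then 0 else 1) - 1
/-- imbalance of a role -/
def rho (b i' o' : Bool) : ℤ := (if o' = b then 1 else 0) - (if i' = b then 1 else 0)

lemma lo_le_rho {A : V → V → Prop} {i o : V → Bool} {H : ℕ} {v : V} {i' o' : Bool}
    (h1 : wi A o H i' v) (h2 : wo A i H o' v) (b : Bool) : lo A i o H b v ≤ rho b i' o' := by
  unfold lo rho
  have e1 : o' ≠ b → o' = !b := by cases o' <;> cases b <;> simp
  by_cases ho : o' = b <;> by_cases hi : i' = b
  · subst hi; simp only [h1, ho, if_true]; split_ifs <;> simp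
  · simp only [ho, hi, if_true, if_false]; split_ifs <;> simp
  · have := e1 ho; subst this; subst hi; simp only [h1, h2, if_true]; simp
  · have := e1 ho; subst this; simp only [h2, if_true, hi, if_false]; split_ifs <;> simp

lemma lo_ge {A : V → V → Prop} {i o : V → Bool} {H : ℕ} {v : V} (b : Bool) : -1 ≤ lo A i o H b v := by
  unfold lo; split_ifs <;> simp
lemma lo_le {A : V → V → Prop} {i o : V → Bool} {H : ℕ} {v : V} (b : Bool) : lo A i o H b v ≤ 1 := by
  unfold lo; split_ifs <;> simp
lemma rho_ge (b i' o' : Bool) : -1 ≤ rho b i' o' := by unfold rho; split_ifs <;> simp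
lemma rho_le (b i' o' : Bool) : rho b i' o' ≤ 1 := by unfold rho; split_ifs <;> simp
lemma rho_not (b i' o' : Bool) : rho (!b) i' o' = - rho b i' o' := by
  cases b <;> cases i' <;> cases o' <;> rfl

lemma room_split (f : V → Bool) (b : Bool) : (room f b).card + (room f (!b)).card = Fintype.card V := by
  have a1 := Finset.card_filter_add_card_filter_not (s := (Finset.univ : Finset V)) (fun w => f w = b)
  rw [Finset.card_univ] at a1
  rw [← a1]; unfold room
  congr 2
  ext v; simp; cases f v <;> cases b <;> simp

lemma room_inter (f : V → Bool) (b : Bool) (S : Finset V) :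
    (room f b ∩ S).card + (room f (!b) ∩ S).card = S.card := by
  rw [← Finset.card_union_of_disjoint]
  · congr 1; ext v; simp only [room, Finset.mem_union, Finset.mem_inter, Finset.mem_filter, Finset.mem_univ, true_and]
    cases f v <;> cases b <;> simp
  · rw [Finset.disjoint_left]; intro v; simp only [room, Finset.mem_inter, Finset.mem_filter, Finset.mem_univ, true_and]
    cases f v <;> cases b <;> simp

/-- basic setting with numeric assumptions -/
structure Base (A : V → V → Prop) (i o : V → Bool) (G : Finset V) (E H k : ℕ) : Prop extends Str A i o G E where
  hirr : ∀ v, ¬ A v v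
  dout : ∀ v, Fintype.card V + 2 * k ≤ 2 * (outN A v).card
  din : ∀ v, Fintype.card V + 2 * k ≤ 2 * (inN A v).card
  hk : 1 ≤ k
  kE : 100 * k ≤ E
  kH : 10000 * (k * E) ≤ H
  kn : 1000 * (k * H) ≤ Fintype.card V

namespace Base
variable {A : V → V → Prop} {i o : V → Bool} {G : Finset V} {E H k : ℕ}

lemma EH (h : Base A i o G E H k) : 1000 * E ≤ H := by have := h.kH; have := h.hk; nlinarith
lemma Hn (h : Base A i o G E H k) : 1000 * H ≤ Fintype.card V := by have := h.kn; have := h.hk; nlinarith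
lemma E100 (h : Base A i o G E H k) : 100 ≤ E := by have := h.kE; have := h.hk; omega

lemma wo_or (h : Base A i o G E H k) (b : Bool) (v : V) : wo A i H b v ∨ wo A i H (!b) v := by
  by_contra hc
  push Not at hc
  obtain ⟨h1, h2⟩ := hc
  unfold wo at h1 h2
  have := room_inter i b (outN A v)
  have := h.dout v
  have := h.Hn
  omega

lemma wi_or (h : Base A i o G E H k) (b : Bool) (v : V) : wi A o H b v ∨ wi A o H (!b) v := by
  by_contra hc
  push Not at hc
  obtain ⟨h1, h2⟩ := hc
  unfold wi at h1 h2
  have := room_inter o b (inN A v)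
  have := h.din v
  have := h.Hn
  omega

lemma forced_out (h : Base A i o G E H k) {b : Bool} {v : V} (hv : ¬ wo A i H (!b) v) : (room i b \ outN A v).card ≤ H + E := by
  unfold wo at hv
  have := room_inter i b (outN A v)
  have := h.dout v
  have := h.g4i (!b)
  have := room_split i b
  have := Finset.card_sdiff_add_card_inter (room i b) (outN A v)
  omega

lemma forced_in (h : Base A i o G E H k) {b : Bool} {v : V} (hv : ¬ wi A o H (!b) v) : (room o b \ inN A v).card ≤ H + E := by
  unfold wi at hv
  have := room_inter o b (inN A v)
  have := h.din v
  have := h.g4o (!b)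
  have := room_split o b
  have := Finset.card_sdiff_add_card_inter (room o b) (inN A v)
  omega

lemma good_wo (h : Base A i o G E H k) {v : V} (hv : v ∈ G) : wo A i H (o v) v := by
  unfold wo
  have := h.g2 v hv
  have := h.g4i (o v)
  have := Finset.card_sdiff_add_card_inter (room i (o v)) (outN A v)
  have := h.Hn; have := h.EH; have := h.E100
  omega

lemma good_wi (h : Base A i o G E H k) {v : V} (hv : v ∈ G) : wi A o H (i v) v := by
  unfold wi
  have := h.g3 v hv
  have := h.g4o (i v)
  have := Finset.card_sdiff_add_card_inter (room o (i v)) (inN A v)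
  have := h.Hn; have := h.EH; have := h.E100
  omega

lemma good_lo (h : Base A i o G E H k) {v : V} (hv : v ∈ G) (b : Bool) : lo A i o H b v ≤ rho b (i v) (o v) :=
  lo_le_rho (h.good_wi hv) (h.good_wo hv) b

lemma sum_rho (h : Base A i o G E H k) (b : Bool) : ∑ v, rho b (i v) (o v) ≤ 2 * E ∧ - (2 * E : ℤ) ≤ ∑ v, rho b (i v) (o v) := by
  have e : ∑ v, rho b (i v) (o v) = (room o b).card - (room i b).card := by
    unfold rho
    rw [Finset.sum_sub_distrib, Finset.sum_boole, Finset.sum_boole]; rfl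
  have := h.g4i b; have := h.g4o b; have := h.g4i (!b); have := h.g4o (!b)
  have := room_split i b; have := room_split o b
  rw [e]; constructor <;> omega

lemma lo_univ_le (h : Base A i o G E H k) (b : Bool) : ∑ v, lo A i o H b v +
    (G.filter (fun v => lo A i o H b v < rho b (i v) (o v))).card ≤ 4 * E := by
  have h1 : ∑ v, (lo A i o H b v + if v ∈ G ∧ lo A i o H b v < rho b (i v) (o v) then 1 else 0) ≤
      ∑ v, (rho b (i v) (o v) + if v ∈ Gᶜ then 2 else 0) := by
    apply Finset.sum_le_sum
    intro v _
    by_cases hv : v ∈ G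
    · have := h.good_lo hv b
      simp only [hv, true_and, Finset.mem_compl, not_true, if_false]
      split_ifs <;> omega
    · have := lo_le (A := A) (i := i) (o := o) (H := H) (v := v) b
      have := rho_ge b (i v) (o v)
      simp only [hv, false_and, Finset.mem_compl, not_false_eq_true, if_true, if_false]
      omega
  rw [Finset.sum_add_distrib, Finset.sum_add_distrib, Finset.sum_boole, ← Finset.sum_filter, Finset.sum_const] at h1
  have h2 := (h.sum_rho b).1
  have h3 := h.g1
  have e1 : (Finset.univ.filter (fun v => v ∈ G ∧ lo A i o H b v < rho b (i v) (o v))) = G.filter (fun v => lo A i o H b v < rho b (i v) (o v)) := by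
    ext; simp
  have e2 : (Finset.univ.filter (fun v => v ∈ Gᶜ)) = Gᶜ := by ext; simp
  rw [e1, e2, nsmul_eq_mul] at h1
  push_cast at h1
  omega
end Base

/-- full setting -/
structure Full (A : V → V → Prop) (i o : V → Bool) (G : Finset V) (E H k Θ : ℕ) : Prop extends Base A i o G E H k where
  g5 : ∀ b, ∑ v, lo A i o H b v ≤ -(Θ : ℤ) ∨ ∀ v ∈ G, lo A i o H b v = rho b (i v) (o v)

lemma Base.shrink {A : V → V → Prop} {i o : V → Bool} {G : Finset V} {E₀ E H k : ℕ} 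
    (h : Base A i o G E₀ H k) (hE : 11 * E₀ = E) (kH : 10000 * (k * E) ≤ H) :
    ∃ G', Full A i o G' E H k E₀ := by
  set Fl : Bool → Finset V := fun b => if ∑ v, lo A i o H b v ≤ -(E₀ : ℤ) then ∅ else
    G.filter (fun v => lo A i o H b v < rho b (i v) (o v)) with hFl
  have hc : ∀ b, (Fl b).card ≤ 5 * E₀ := by
    intro b
    simp only [hFl]
    split_ifs with hb
    · simp
    · have := h.lo_univ_le b; omega
  have hsub : G \ (Fl true ∪ Fl false) ⊆ G := Finset.sdiff_subset
  refine ⟨G \ (Fl true ∪ Fl false), ⟨⟨⟨?_, ?_, ?_, ?_, ?_⟩, h.hirr, h.dout, h.din, h.hk, ?_, kH, h.kn⟩, ?_⟩⟩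
  · have e : (G \ (Fl true ∪ Fl false))ᶜ ⊆ Gᶜ ∪ (Fl true ∪ Fl false) := by
      intro v; simp; tauto
    have := Finset.card_le_card e
    have := Finset.card_union_le Gᶜ (Fl true ∪ Fl false)
    have := Finset.card_union_le (Fl true) (Fl false)
    have := hc true; have := hc false; have := h.g1
    omega
  · intro u hu; have := h.g2 u (hsub hu); omega
  · intro u hu; have := h.g3 u (hsub hu); omega
  · intro b; have := h.g4o b; omega
  · intro b; have := h.g4i b; omega
  · have := h.kE; omega
  · intro b
    by_cases hb : ∑ v, lo A i o H b v ≤ -(E₀ : ℤ)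
    · left; exact hb
    · right
      intro v hv
      have h1 := h.good_lo (hsub hv) b
      have h2 : v ∉ Fl b := by
        simp only [Finset.mem_sdiff, Finset.mem_union, not_or] at hv
        cases b
        · exact hv.2.2
        · exact hv.2.1
      simp only [hFl, hb, if_false, Finset.mem_filter, hsub hv, true_and] at h2
      omega
end labels


section jlem
variable {V : Type*} [Fintype V]

/-- vertex-disjoint pairs -/
def PDisj (J : Finset (V × V)) : Prop :=
  ∀ p ∈ J, ∀ q ∈ J, p ≠ q → p.1 ≠ q.1 ∧ p.1 ≠ q.2 ∧ p.2 ≠ q.1 ∧ p.2 ≠ q.2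

lemma arc_avoid {A : V → V → Prop} {P Q F : Finset V} {d : ℕ}
    (h1 : ∀ u ∈ P, (Q ∩ outN A u).card ≤ d) (h2 : ∀ v ∈ Q, (P ∩ inN A v).card ≤ d)
    (hF : 2 * (F.card * d) < earcs A P Q) : ∃ u ∈ P, ∃ v ∈ Q, A u v ∧ u ∉ F ∧ v ∉ F := by
  by_contra hc
  push Not at hc
  have hsub : ((P ×ˢ Q).filter (fun p => A p.1 p.2)) ⊆
      (((P ∩ F) ×ˢ Q).filter (fun p => A p.1 p.2)) ∪ ((P ×ˢ (Q ∩ F)).filter (fun p => A p.1 p.2)) := by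
    rintro ⟨u, v⟩ hp
    simp only [Finset.mem_union, Finset.mem_filter, Finset.mem_product, Finset.mem_inter] at hp ⊢
    by_cases hu : u ∈ F
    · left; tauto
    · have := hc u hp.1.1 v hp.1.2 hp.2 hu
      right; tauto
  have e0 := Finset.card_le_card hsub
  have e1 := Finset.card_union_le (((P ∩ F) ×ˢ Q).filter (fun p => A p.1 p.2)) ((P ×ˢ (Q ∩ F)).filter (fun p => A p.1 p.2))
  have e2 : earcs A (P ∩ F) Q ≤ F.card * d := by
    rw [earcs_eq_out]
    refine (Finset.sum_le_card_nsmul _ _ d (fun u hu => h1 u (Finset.mem_inter.1 hu).1)).trans ?_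
    rw [smul_eq_mul]; gcongr; exact Finset.inter_subset_right
  have e3 : earcs A P (Q ∩ F) ≤ F.card * d := by
    rw [earcs_eq_in]
    refine (Finset.sum_le_card_nsmul _ _ d (fun u hu => h2 u (Finset.mem_inter.1 hu).1)).trans ?_
    rw [smul_eq_mul]; gcongr; exact Finset.inter_subset_right
  unfold earcs at hF e2 e3
  omega

lemma matching_greedy {A : V → V → Prop} {P Q : Finset V} {d : ℕ} (hirr : ∀ v, ¬ A v v)
    (h1 : ∀ u ∈ P, (Q ∩ outN A u).card ≤ d) (h2 : ∀ v ∈ Q, (P ∩ inN A v).card ≤ d) :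
    ∀ m : ℕ, 4 * (m * d) ≤ earcs A P Q → 0 < d →
    ∃ J : Finset (V × V), J.card = m ∧ (∀ p ∈ J, p.1 ∈ P ∧ p.2 ∈ Q ∧ A p.1 p.2) ∧ PDisj J := by
  intro m
  induction m with
  | zero => intro _ _; exact ⟨∅, by simp, by simp, by simp [PDisj]⟩
  | succ m ih =>
    intro hm hd
    obtain ⟨J, j1, j2, j3⟩ := ih (by nlinarith) hd
    set F := J.image Prod.fst ∪ J.image Prod.snd with hF
    have hFc : F.card ≤ 2 * m := by
      have : F.card ≤ (J.image Prod.fst).card + (J.image Prod.snd).card := Finset.card_union_le _ _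
      have : (J.image Prod.fst).card ≤ J.card := Finset.card_image_le
      have : (J.image Prod.snd).card ≤ J.card := Finset.card_image_le
      omega
    obtain ⟨u, hu, v, hv, huv, hu', hv'⟩ := arc_avoid (F := F) h1 h2 (by nlinarith)
    have f1 : ∀ p ∈ J, p.1 ∈ F ∧ p.2 ∈ F := fun p hp => by
      simp only [hF, Finset.mem_union, Finset.mem_image]
      exact ⟨Or.inl ⟨p, hp, rfl⟩, Or.inr ⟨p, hp, rfl⟩⟩
    have hn : (u, v) ∉ J := fun hh => hu' (f1 _ hh).1
    refine ⟨insert (u, v) J, by rw [Finset.card_insert_of_notMem hn, j1], ?_, ?_⟩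
    · intro p hp
      rcases Finset.mem_insert.1 hp with rfl | hp
      · exact ⟨hu, hv, huv⟩
      · exact j2 p hp
    · intro p hp q hq hpq
      have aux : ∀ q ∈ J, u ≠ q.1 ∧ u ≠ q.2 ∧ v ≠ q.1 ∧ v ≠ q.2 := fun q hq =>
        ⟨fun e => hu' (e ▸ (f1 q hq).1), fun e => hu' (e ▸ (f1 q hq).2),
          fun e => hv' (e ▸ (f1 q hq).1), fun e => hv' (e ▸ (f1 q hq).2)⟩
      rcases Finset.mem_insert.1 hp with rfl | hp <;> rcases Finset.mem_insert.1 hq with rfl | hq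
      · exact absurd rfl hpq
      · exact aux q hq
      · have := aux p hp
        exact ⟨this.1.symm, this.2.2.1.symm, this.2.1.symm, this.2.2.2.symm⟩
      · exact j3 p hp q hq hpq

lemma Full.J_exists {A : V → V → Prop} {i o : V → Bool} {G : Finset V} {E H k Θ : ℕ}
    (h : Full A i o G E H k Θ) (b : Bool) (hΘ : 2 * k ≤ Θ) (y : ℕ) (hy : (y : ℤ) = 2 * k + ∑ v, lo A i o H b v)
    (hy1 : 1 ≤ y) :
    ∃ J : Finset (V × V), J.card = 10 * (k * y) ∧
      (∀ p ∈ J, ¬ wo A i H (!b) p.1 ∧ ¬ wi A o H b p.2 ∧ A p.1 p.2) ∧ PDisj J := by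
  have hsp : ∀ v ∈ G, lo A i o H b v = rho b (i v) (o v) := by
    rcases h.g5 b with h1 | h1
    · omega
    · exact h1
  set P : Finset V := Finset.univ.filter (fun v => ¬ wo A i H (!b) v) with hP
  set Q : Finset V := Finset.univ.filter (fun v => ¬ wi A o H b v) with hQ
  have mP : ∀ v, v ∈ P ↔ ¬ wo A i H (!b) v := by intro v; simp [hP]
  have mQ : ∀ v, v ∈ Q ↔ ¬ wi A o H b v := by intro v; simp [hQ]
  have hL : ∑ v, lo A i o H b v = P.card + Q.card - Fintype.card V := by
    unfold lo
    rw [Finset.sum_sub_distrib, Finset.sum_add_distrib]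
    have e1 : ∀ v, (if wo A i H (!b) v then (0:ℤ) else 1) = if ¬ wo A i H (!b) v then 1 else 0 := by
      intro v; split_ifs <;> simp_all
    have e2 : ∀ v, (if wi A o H b v then (0:ℤ) else 1) = if ¬ wi A o H b v then 1 else 0 := by
      intro v; split_ifs <;> simp_all
    simp only [e1, e2]
    rw [Finset.sum_boole, Finset.sum_boole]
    simp [hP, hQ]
  have hiff : ∀ v ∈ G, (v ∈ P ↔ o v = b) ∧ (v ∈ Q ↔ i v = !b) := by
    intro v hv
    have h1 := hsp v hv
    have h2 := h.good_wo hv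
    have h3 := h.good_wi hv
    rw [mP, mQ]
    unfold lo rho at h1
    have k1 : o v ≠ b → wo A i H (!b) v := by
      intro hne
      have : o v = !b := by revert hne; cases o v <;> cases b <;> simp
      rwa [this] at h2
    have k2 : i v = b → wi A o H b v := by intro hh; rwa [hh] at h3
    have k3 : (i v = !b) ↔ ¬ i v = b := by cases i v <;> cases b <;> simp
    rw [k3]
    by_cases c1 : o v = b <;> by_cases c2 : i v = b <;> by_cases c3 : wo A i H (!b) v <;>
      by_cases c4 : wi A o H b v <;> simp_all
  have hPc : Fintype.card V ≤ 4 * P.card := by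
    have : room o b ⊆ P ∪ Gᶜ := by
      intro v hv
      simp only [room, Finset.mem_filter, Finset.mem_univ, true_and] at hv
      by_cases hg : v ∈ G
      · exact Finset.mem_union_left _ ((hiff v hg).1.2 hv)
      · simp [hg]
    have := Finset.card_le_card this
    have := Finset.card_union_le P Gᶜ
    have := h.g4o b; have := h.g1; have := h.EH; have := h.Hn; have := h.E100
    omega
  have hQc : Fintype.card V ≤ 4 * Q.card := by
    have : room i (!b) ⊆ Q ∪ Gᶜ := by
      intro v hv
      simp only [room, Finset.mem_filter, Finset.mem_univ, true_and] at hv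
      by_cases hg : v ∈ G
      · exact Finset.mem_union_left _ ((hiff v hg).2.2 hv)
      · simp [hg]
    have := Finset.card_le_card this
    have := Finset.card_union_le Q Gᶜ
    have := h.g4i (!b); have := h.g1; have := h.EH; have := h.Hn; have := h.E100
    omega
  have d1 : ∀ u ∈ P, (Q ∩ outN A u).card ≤ H + E := by
    intro u hu
    have : Q ∩ outN A u ⊆ (room i (!b) ∩ outN A u) ∪ Gᶜ := by
      intro v hv
      rw [Finset.mem_inter] at hv
      by_cases hg : v ∈ G
      · exact Finset.mem_union_left _ (Finset.mem_inter.2 ⟨by simp [room, (hiff v hg).2.1 hv.1], hv.2⟩)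
      · simp [hg]
    have := Finset.card_le_card this
    have := Finset.card_union_le (room i (!b) ∩ outN A u) Gᶜ
    have hu := (mP u).1 hu
    unfold wo at hu
    have := h.g1
    omega
  have d2 : ∀ v ∈ Q, (P ∩ inN A v).card ≤ H + E := by
    intro u hu
    have : P ∩ inN A u ⊆ (room o b ∩ inN A u) ∪ Gᶜ := by
      intro v hv
      rw [Finset.mem_inter] at hv
      by_cases hg : v ∈ G
      · exact Finset.mem_union_left _ (Finset.mem_inter.2 ⟨by simp [room, (hiff v hg).1.1 hv.1], hv.2⟩)
      · simp [hg]
    have := Finset.card_le_card this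
    have := Finset.card_union_le (room o b ∩ inN A u) Gᶜ
    have hu := (mQ u).1 hu
    unfold wi at hu
    have := h.g1
    omega
  have hie : ∀ S T : Finset V, S.card + T.card ≤ (S ∩ T).card + Fintype.card V := by
    intro S T
    have := Finset.card_union_add_card_inter S T
    have := Finset.card_le_univ (S ∪ T)
    omega
  have hen : Fintype.card V * y ≤ 8 * earcs A P Q := by
    by_cases hc : Fintype.card V + y ≤ 2 * Q.card + 2 * k
    · have h1 : ∀ u ∈ P, y ≤ 2 * (Q ∩ outN A u).card := by
        intro u _
        have := hie Q (outN A u); have := h.dout u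
        omega
      have h2 := Finset.card_nsmul_le_sum P _ y h1
      rw [← Finset.mul_sum, ← earcs_eq_out, smul_eq_mul] at h2
      nlinarith
    · have h1 : ∀ u ∈ Q, y ≤ 2 * (P ∩ inN A u).card := by
        intro u _
        have := hie P (inN A u); have := h.din u
        omega
      have h2 := Finset.card_nsmul_le_sum Q _ y h1
      rw [← Finset.mul_sum, ← earcs_eq_in, smul_eq_mul] at h2
      nlinarith
  obtain ⟨J, j1, j2, j3⟩ := matching_greedy h.hirr d1 d2 (10 * (k * y)) (by
    have e1 := h.EH
    have e2 := h.kn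
    have e3 : k * y * (H + E) ≤ k * y * (2 * H) := Nat.mul_le_mul_left _ (by omega)
    have e4 : 1000 * (k * H) * y ≤ Fintype.card V * y := Nat.mul_le_mul_right _ e2
    have e5 : k * y * (2 * H) = 2 * (k * H * y) := by ring
    have e6 : 1000 * (k * H) * y = 1000 * (k * H * y) := by ring
    have e7 : 4 * (10 * (k * y) * (H + E)) = 40 * (k * y * (H + E)) := by ring
    omega) (by have := h.E100; omega)
  exact ⟨J, j1, fun p hp => ⟨(mP _).1 (j2 p hp).1, (mQ _).1 (j2 p hp).2.1, (j2 p hp).2.2⟩, j3⟩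
end jlem


section tlem
variable {V : Type*} [Fintype V]

/-- admissible centres for a role -/
noncomputable def adm (A : V → V → Prop) (i o : V → Bool) (H : ℕ) (ri ro : Bool) : Finset V :=
  Finset.univ.filter (fun w => 5 * H ≤ (room o ri ∩ inN A w).card ∧ 5 * H ≤ (room i ro ∩ outN A w).card)

/-- small admissible sets -/
noncomputable def sadm (A : V → V → Prop) (i o : V → Bool) (H k : ℕ) (ri ro : Bool) : Finset V :=
  if (adm A i o H ri ro).card < 20 * k then adm A i o H ri ro else ∅

/-- the union of the small admissible sets -/
noncomputable def Bad (A : V → V → Prop) (i o : V → Bool) (H k : ℕ) : Finset V :=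
  (sadm A i o H k true true ∪ sadm A i o H k true false) ∪ (sadm A i o H k false true ∪ sadm A i o H k false false)

lemma sadm_card (A : V → V → Prop) (i o : V → Bool) (H k : ℕ) (ri ro : Bool) : (sadm A i o H k ri ro).card ≤ 20 * k := by
  unfold sadm; split_ifs with h
  · omega
  · simp

lemma Bad_card (A : V → V → Prop) (i o : V → Bool) (H k : ℕ) : (Bad A i o H k).card ≤ 80 * k := by
  unfold Bad
  have := Finset.card_union_le (sadm A i o H k true true ∪ sadm A i o H k true false) (sadm A i o H k false true ∪ sadm A i o H k false false)
  have := Finset.card_union_le (sadm A i o H k true true) (sadm A i o H k true false)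
  have := Finset.card_union_le (sadm A i o H k false true) (sadm A i o H k false false)
  have := sadm_card A i o H k true true
  have := sadm_card A i o H k true false
  have := sadm_card A i o H k false true
  have := sadm_card A i o H k false false
  omega

lemma sadm_sub (A : V → V → Prop) (i o : V → Bool) (H k : ℕ) (ri ro : Bool) : sadm A i o H k ri ro ⊆ Bad A i o H k := by
  intro v hv
  unfold Bad
  simp only [Finset.mem_union]
  cases ri <;> cases ro <;> tauto

lemma pick_in (R S At F : Finset V) (m : ℕ) (hA : (R \ At).card ≤ m) (h : m + F.card < (R ∩ S).card) :
    ∃ a ∈ At, a ∈ S ∧ a ∈ R ∧ a ∉ F := by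
  obtain ⟨a, ha, ha'⟩ := exists_out (R ∩ S) ((R \ At) ∪ F) (by
    have := Finset.card_union_le (R \ At) F; omega)
  simp only [Finset.mem_inter, Finset.mem_union, Finset.mem_sdiff, not_or, not_and, not_not] at ha ha'
  exact ⟨a, ha'.1 ha.1, ha.2, ha.1, ha'.2⟩

lemma Base.tstep {A : V → V → Prop} {i o : V → Bool} {G : Finset V} {E H k : ℕ} (h : Base A i o G E H k)
    (ri ro : Bool) (At Bt : Finset V) (hA : (room o ri \ At).card ≤ 3 * H) (hB : (room i ro \ Bt).card ≤ 3 * H)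
    (X AB Cs Xt : Finset V) (hX : X.card ≤ k) (hAB : AB.card ≤ 4 * k) (hCs : Cs.card ≤ 2 * k)
    (hbad : Disjoint AB (Bad A i o H k)) (hXt : Xt ⊆ X) (hc : Xt.card + Cs.card < 2 * k) :
    ∃ a ∈ At, ∃ b ∈ Bt, ∃ c, a ∉ Bad A i o H k ∪ X ∪ AB ∪ Cs ∧ b ∉ Bad A i o H k ∪ X ∪ AB ∪ Cs ∧ a ≠ b ∧
      c ∉ Xt ∧ c ∉ AB ∧ c ∉ Cs ∧ A a c ∧ A c b := by
  set F := Bad A i o H k ∪ X ∪ AB ∪ Cs with hF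
  have hk := h.hk
  have hFc : F.card ≤ 87 * k := by
    have h1 : F.card ≤ (Bad A i o H k ∪ X ∪ AB).card + Cs.card := Finset.card_union_le _ _
    have h2 : (Bad A i o H k ∪ X ∪ AB).card ≤ (Bad A i o H k ∪ X).card + AB.card := Finset.card_union_le _ _
    have h3 : (Bad A i o H k ∪ X).card ≤ (Bad A i o H k).card + X.card := Finset.card_union_le _ _
    have := Bad_card A i o H k
    omega
  have hkH : 1000 * k ≤ H := by
    have := h.EH; have := h.kE; omega
  by_cases hbig : (adm A i o H ri ro).card < 20 * k
  · set B1 := AB.biUnion (fun w => if (room o ri ∩ inN A w).card < 5 * H then room o ri ∩ inN A w else ∅) with hB1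
    set B2 := AB.biUnion (fun w => if (room i ro ∩ outN A w).card < 5 * H then room i ro ∩ outN A w else ∅) with hB2
    have hkH2 : AB.card * (5 * H) ≤ 20 * (k * H) := by nlinarith
    have c1 : B1.card ≤ 20 * (k * H) := by
      refine (Finset.card_biUnion_le_card_mul AB _ (5 * H) (fun w _ => ?_)).trans hkH2
      split_ifs <;> [omega; simp]
    have c2 : B2.card ≤ 20 * (k * H) := by
      refine (Finset.card_biUnion_le_card_mul AB _ (5 * H) (fun w _ => ?_)).trans hkH2
      split_ifs <;> [omega; simp]
    have hkn := h.kn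
    have hHk : H ≤ k * H := by nlinarith
    obtain ⟨a, ha, -, har, haF⟩ := pick_in (room o ri) Finset.univ At (F ∪ B1) (3 * H) hA (by
      rw [Finset.inter_univ]
      have := Finset.card_union_le F B1
      have := h.g4o ri
      have := h.EH
      omega)
    obtain ⟨b, hb, -, hbr, hbF⟩ := pick_in (room i ro) Finset.univ Bt (insert a (F ∪ B2)) (3 * H) hB (by
      rw [Finset.inter_univ]
      have := Finset.card_union_le F B2
      have := Finset.card_insert_le a (F ∪ B2)
      have := h.g4i ro
      have := h.EH
      omega)
    simp only [Finset.mem_insert, not_or] at hbF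
    rw [Finset.mem_union, not_or] at haF
    obtain ⟨hba, hbF⟩ := hbF
    rw [Finset.mem_union, not_or] at hbF
    obtain ⟨c, hcc, hcn⟩ := exists_out (outN A a ∩ inN A b) (Xt ∪ Cs) (by
      have := Finset.card_union_le Xt Cs
      have := Finset.card_union_add_card_inter (outN A a) (inN A b)
      have := Finset.card_le_univ (outN A a ∪ inN A b)
      have := h.dout a; have := h.din b
      omega)
    simp only [Finset.mem_inter, mem_outN, mem_inN, Finset.mem_union, not_or] at hcc hcn
    refine ⟨a, ha, b, hb, c, haF.1, hbF.1, fun e => hba e.symm, hcn.1, ?_, hcn.2, hcc.1, hcc.2⟩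
    intro hcAB
    have hn : c ∉ adm A i o H ri ro := by
      intro hadm
      have : c ∈ Bad A i o H k := sadm_sub A i o H k ri ro (by unfold sadm; rw [if_pos hbig]; exact hadm)
      exact Finset.disjoint_left.1 hbad hcAB this
    simp only [adm, Finset.mem_filter, Finset.mem_univ, true_and, not_and_or, not_le] at hn
    rcases hn with hn | hn
    · apply haF.2
      simp only [hB1, Finset.mem_biUnion]
      exact ⟨c, hcAB, by rw [if_pos hn]; exact Finset.mem_inter.2 ⟨har, by simpa using hcc.1⟩⟩
    · apply hbF.2
      simp only [hB2, Finset.mem_biUnion]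
      exact ⟨c, hcAB, by rw [if_pos hn]; exact Finset.mem_inter.2 ⟨hbr, by simpa using hcc.2⟩⟩
  · obtain ⟨c, hcc, hcn⟩ := exists_out (adm A i o H ri ro) (X ∪ AB ∪ Cs) (by
      have := Finset.card_union_le (X ∪ AB) Cs
      have := Finset.card_union_le X AB
      omega)
    simp only [adm, Finset.mem_filter, Finset.mem_univ, true_and] at hcc
    simp only [Finset.mem_union, not_or] at hcn
    obtain ⟨a, ha, hac, -, haF⟩ := pick_in (room o ri) (inN A c) At F (3 * H) hA (by omega)
    obtain ⟨b, hb, hbc, -, hbF⟩ := pick_in (room i ro) (outN A c) Bt (insert a F) (3 * H) hB (by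
      have := Finset.card_insert_le a F; omega)
    simp only [Finset.mem_insert, not_or] at hbF
    exact ⟨a, ha, b, hb, c, haF, hbF.2, fun e => hbF.1 e.symm, fun hh => hcn.1.1 (hXt hh), hcn.1.2, hcn.2,
      by simpa using hac, by simpa using hbc⟩

/-- a triple as a finset -/
noncomputable def tri (a c b : V) : Finset V := {a, c, b}

/-- a partial system of disjoint triples -/
def TOk {ι : Type*} (A : V → V → Prop) (Bd X : Finset V) (At Bt Xt : ι → Finset V) (I : Finset ι) (a c b : ι → V) : Prop :=
  (∀ j ∈ I, a j ∈ At j ∧ b j ∈ Bt j ∧ A (a j) (c j) ∧ A (c j) (b j) ∧ a j ≠ b j ∧ a j ∉ X ∧ b j ∉ X ∧ c j ∉ Xt j ∧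
    a j ∉ Bd ∧ b j ∉ Bd) ∧
  ∀ j ∈ I, ∀ l ∈ I, j ≠ l → Disjoint (tri (a j) (c j) (b j)) (tri (a l) (c l) (b l))

lemma Base.textend {ι : Type*} {A : V → V → Prop} {i o : V → Bool} {G : Finset V} {E H k : ℕ} (h : Base A i o G E H k)
    (At Bt Xt : ι → Finset V) (X : Finset V) (hX : X.card ≤ k) (I : Finset ι) (a c b : ι → V) (j : ι) (hj : j ∉ I)
    (hT : TOk A (Bad A i o H k) X At Bt Xt I a c b)
    (ri ro : Bool) (hA : (room o ri \ At j).card ≤ 3 * H) (hB : (room i ro \ Bt j).card ≤ 3 * H)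
    (hXt : Xt j ⊆ X) (hI : I.card ≤ 2 * k) (hc : (Xt j).card + I.card < 2 * k) :
    ∃ a c b, TOk A (Bad A i o H k) X At Bt Xt (insert j I) a c b := by
  obtain ⟨t1, t2⟩ := hT
  set AB := I.image a ∪ I.image b with hAB
  set Cs := I.image c with hCs
  have c1 : AB.card ≤ 4 * k := by
    have e1 : AB.card ≤ (I.image a).card + (I.image b).card := Finset.card_union_le _ _
    have e2 : (I.image a).card ≤ I.card := Finset.card_image_le
    have e3 : (I.image b).card ≤ I.card := Finset.card_image_le
    omega
  have c2 : Cs.card ≤ I.card := Finset.card_image_le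
  have hdis : Disjoint AB (Bad A i o H k) := by
    rw [Finset.disjoint_left]
    intro v hv
    simp only [hAB, Finset.mem_union, Finset.mem_image] at hv
    rcases hv with ⟨l, hl, rfl⟩ | ⟨l, hl, rfl⟩
    · exact (t1 l hl).2.2.2.2.2.2.2.2.1
    · exact (t1 l hl).2.2.2.2.2.2.2.2.2
  obtain ⟨a', ha, b', hb, c', h1, h2, h3, h4, h5, h6, h7, h8⟩ := h.tstep ri ro (At j) (Bt j) hA hB X AB Cs (Xt j) hX c1 (by omega) hdis hXt (by omega)
  simp only [Finset.mem_union, not_or] at h1 h2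
  have hdj : ∀ l ∈ I, Disjoint (tri (a l) (c l) (b l)) (tri a' c' b') := by
    intro l hl
    have m1 : a l ∈ AB := Finset.mem_union_left _ (Finset.mem_image_of_mem _ hl)
    have m2 : b l ∈ AB := Finset.mem_union_right _ (Finset.mem_image_of_mem _ hl)
    have m3 : c l ∈ Cs := Finset.mem_image_of_mem _ hl
    have nn : ∀ v, (v ∈ AB ∨ v ∈ Cs) → v ≠ a' ∧ v ≠ c' ∧ v ≠ b' := by
      rintro v hv
      refine ⟨?_, ?_, ?_⟩ <;> rintro rfl <;> tauto
    rw [Finset.disjoint_left]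
    intro v hv hv'
    simp only [tri, Finset.mem_insert, Finset.mem_singleton] at hv hv'
    have : v ∈ AB ∨ v ∈ Cs := by rcases hv with rfl | rfl | rfl <;> tauto
    have := nn v this
    tauto
  refine ⟨Function.update a j a', Function.update c j c', Function.update b j b', ?_, ?_⟩
  · intro l hl
    by_cases hlj : l = j
    · subst hlj; simp only [Function.update_self]; tauto
    · simp only [Function.update_of_ne hlj]
      exact t1 l (Finset.mem_of_mem_insert_of_ne hl hlj)
  · intro l hl m hm hlm
    by_cases hlj : l = j <;> by_cases hmj : m = j
    · subst hlj; exact absurd hmj.symm hlm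
    · subst hlj; simp only [Function.update_self, Function.update_of_ne hmj]
      exact (hdj m (Finset.mem_of_mem_insert_of_ne hm hmj)).symm
    · subst hmj; simp only [Function.update_self, Function.update_of_ne hlj]
      exact hdj l (Finset.mem_of_mem_insert_of_ne hl hlj)
    · simp only [Function.update_of_ne hlj, Function.update_of_ne hmj]
      exact t2 l (Finset.mem_of_mem_insert_of_ne hl hlj) m (Finset.mem_of_mem_insert_of_ne hm hmj) hlm
end tlem


section fill
variable {V : Type*} [Fintype V]

/-- class of good vertices with given labels -/
noncomputable def K (i o : V → Bool) (G : Finset V) (p q : Bool) : Finset V := G.filter (fun v => i v = p ∧ o v = q)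

lemma mem_K {i o : V → Bool} {G : Finset V} {p q : Bool} {v : V} : v ∈ K i o G p q ↔ v ∈ G ∧ i v = p ∧ o v = q := by
  simp [K]

lemma room_i_le {A : V → V → Prop} {i o : V → Bool} {G : Finset V} {E : ℕ} (h : Str A i o G E) (p q : Bool) :
    (room i p).card ≤ (K i o G p q).card + (K i o G p (!q)).card + E := by
  have : room i p ⊆ (K i o G p q ∪ K i o G p (!q)) ∪ Gᶜ := by
    intro v hv
    simp only [room, Finset.mem_filter, Finset.mem_univ, true_and] at hv
    simp only [Finset.mem_union, mem_K, Finset.mem_compl, hv]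
    cases o v <;> cases q <;> simp <;> tauto
  have := Finset.card_le_card this
  have := Finset.card_union_le (K i o G p q ∪ K i o G p (!q)) Gᶜ
  have := Finset.card_union_le (K i o G p q) (K i o G p (!q))
  have := h.g1
  omega

lemma room_o_ge {i o : V → Bool} {G : Finset V} (p q : Bool) :
    (K i o G p q).card + (K i o G (!p) q).card ≤ (room o q).card := by
  rw [← Finset.card_union_of_disjoint]
  · apply Finset.card_le_card
    intro v; simp only [Finset.mem_union, mem_K, room, Finset.mem_filter, Finset.mem_univ, true_and]; tauto
  · rw [Finset.disjoint_left]; intro v; simp only [mem_K]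
    cases i v <;> cases p <;> simp

/-- the four classes are all large, or the classes off the pattern `e` are small -/
lemma Base.class_cases {A : V → V → Prop} {i o : V → Bool} {G : Finset V} {E H k : ℕ} (h : Base A i o G E H k) :
    (∀ p q, H ≤ 8 * (K i o G p q).card) ∨ ∃ e : Bool, ∀ p, 4 * (K i o G p (!(xor p e))).card ≤ H := by
  by_cases hm : ∀ p q, H ≤ 8 * (K i o G p q).card
  · left; exact hm
  · right
    push Not at hm
    obtain ⟨p, q, hpq⟩ := hm
    have h1 := room_i_le h.toStr p q
    have h2 := room_o_ge (i := i) (o := o) (G := G) p (!q)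
    have h3 := h.g4i p
    have h4 := h.g4o q
    have h5 := room_split o q
    have h6 := h.EH
    have key : 4 * (K i o G (!p) (!q)).card ≤ H := by omega
    refine ⟨xor p (!q), fun p' => ?_⟩
    by_cases hp : p' = p
    · subst hp
      have : (!(xor p' (xor p' (!q)))) = q := by cases p' <;> cases q <;> rfl
      rw [this]; omega
    · have e1 : p' = !p := by revert hp; cases p' <;> cases p <;> simp
      have : (!(xor p' (xor p (!q)))) = !q := by subst e1; cases p <;> cases q <;> rfl
      rw [this, e1]; exact key

lemma fill {A : V → V → Prop} (B : ℕ) : ∀ (L : ℕ) (z : V) (F : Finset V) (Y : ℕ → Finset V),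
    (0 < L → B < (Y 0 ∩ outN A z).card) → (∀ j, j + 1 < L → ∀ y ∈ Y j, B < (Y (j + 1) ∩ outN A y).card) →
    F.card + L ≤ B →
    ∃ l : List V, l.length = L ∧ (z :: l).IsChain A ∧ l.Nodup ∧ (∀ v ∈ l, v ∉ F) ∧
      (∀ v ∈ l.getLast?, v ∈ Y (L - 1)) ∧
      ∀ (φ : V → ℤ) (τ : ℕ → ℤ), (∀ j < L, ∀ y ∈ Y j, φ y = τ (j + 1) - τ j) → (l.map φ).sum = τ L - τ 0 := by
  intro L
  induction L with
  | zero => intro z F Y _ _ _; exact ⟨[], by simp⟩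
  | succ L ih =>
    intro z F Y h1 h2 h3
    obtain ⟨y, hy, hyF⟩ := exists_out (Y 0 ∩ outN A z) F (by have := h1 (by omega); omega)
    simp only [Finset.mem_inter, mem_outN] at hy
    obtain ⟨l, a1, a2, a3, a4, a5, a6⟩ := ih y (insert y F) (fun j => Y (j + 1))
      (fun hL => h2 0 (by omega) y hy.1) (fun j hj => h2 (j + 1) (by omega))
      (by have := Finset.card_insert_le y F; omega)
    refine ⟨y :: l, by simp [a1], ?_, ?_, ?_, ?_, ?_⟩
    · rw [List.isChain_cons_cons]; exact ⟨hy.2, a2⟩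
    · rw [List.nodup_cons]; exact ⟨fun hh => a4 y hh (Finset.mem_insert_self _ _), a3⟩
    · intro v hv
      rcases List.mem_cons.1 hv with rfl | hv
      · exact hyF
      · exact fun hh => a4 v hv (Finset.mem_insert_of_mem hh)
    · intro v hv
      rcases Nat.eq_zero_or_pos L with h0 | h0
      · subst h0
        have : l = [] := List.length_eq_zero_iff.1 a1
        subst this
        simp at hv; subst hv; exact hy.1
      · have hne : l ≠ [] := by rintro rfl; simp at a1; omega
        rw [List.getLast?_cons_of_ne_nil hne] at hv
        have := a5 v hv
        rwa [show L - 1 + 1 = L + 1 - 1 by omega] at this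
    · intro φ τ hφ
      have := a6 φ (fun j => τ (j + 1)) (fun j hj y hy => hφ (j + 1) (by omega) y hy)
      simp only [List.map_cons, List.sum_cons, this, hφ 0 (by omega) y hy.1]
      ring

/-- close up a core list by fillers -/
lemma close_up {A : V → V → Prop} {pre l : List V} {x z : V} (hx : pre.head? = some x) (hz : pre.getLast? = some z)
    (hp : pre.Nodup) (hc : pre.IsChain A) (hl : (z :: l).IsChain A) (hln : l.Nodup) (hd : ∀ v ∈ l, v ∉ pre)
    (h1 : ∀ v ∈ l.getLast?, A v x) (h0 : l = [] → A z x) : IsDicycleList A (pre ++ l) := by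
  have hne : pre ≠ [] := by rintro rfl; simp at hx
  refine ⟨by simp [hne], ?_, ?_, ?_⟩
  · rw [List.nodup_append]
    refine ⟨hp, hln, ?_⟩
    intro a ha b hb hab
    subst hab; exact hd a hb ha
  · show List.IsChain A _
    rw [List.isChain_append]
    refine ⟨hc, (List.isChain_cons.1 hl).2, ?_⟩
    intro a ha b hb
    rw [hz] at ha
    simp at ha; subst ha
    exact (List.isChain_cons.1 hl).1 b hb
  · intro hh
    have e1 : (pre ++ l).head hh = x := by
      have : (pre ++ l).head? = some x := by rw [List.head?_append, hx]; rfl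
      rw [List.head?_eq_some_head hh] at this
      simpa using this
    rw [e1]
    by_cases hl0 : l = []
    · subst hl0
      have : (pre ++ []).getLast? = some z := by simpa using hz
      rw [List.getLast?_eq_some_getLast hh] at this
      simp only [Option.some.injEq] at this
      rw [this]; exact h0 rfl
    · apply h1
      rw [List.getLast_append_of_ne_nil _ hl0, List.getLast?_eq_some_getLast hl0]
      rfl
end fill


section smalls
variable {V : Type*} [Fintype V]

/-- the small cycle specification -/
def SP (A : V → V → Prop) (i o : V → Bool) (G : Finset V) (H m : ℕ) (S : Finset V) (c : List V) : Prop :=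
  IsDicycleList A c ∧ c.length = m ∧ (∀ v ∈ S, v ∈ c) ∧
    ∀ b, (∀ v ∈ G, lo A i o H b v = rho b (i v) (o v)) → -2 ≤ (c.map (lo A i o H b)).sum

/-- indicator -/
def ind (p b : Bool) : ℤ := if p = b then 1 else 0

lemma ind_ge (p b : Bool) : 0 ≤ ind p b := by unfold ind; split_ifs <;> simp
lemma ind_le (p b : Bool) : ind p b ≤ 1 := by unfold ind; split_ifs <;> simp
lemma ind_not (p b : Bool) : ind (!p) b = 1 - ind p b := by cases p <;> cases b <;> rfl
lemma rho_ind (b p q : Bool) : rho b p q = ind q b - ind p b := rfl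

lemma Base.small_fill {A : V → V → Prop} {i o : V → Bool} {G : Finset V} {E H k : ℕ} (h : Base A i o G E H k)
    (B L : ℕ) (pre : List V) (x z : V) (t : ℕ → Bool) (Y : ℕ → Finset V)
    (hx : pre.head? = some x) (hz : pre.getLast? = some z)
    (hp : pre.Nodup) (hc : pre.IsChain A) (hY : ∀ j < L, Y j ⊆ K i o G (t j) (t (j + 1)))
    (hYc : ∀ j < L, B + E < (Y j).card) (hY0 : 0 < L → B < (Y 0 ∩ outN A z).card)
    (hYL : 0 < L → Y (L - 1) ⊆ inN A x) (h0 : L = 0 → A z x) (F : Finset V) (hF : F.card + (pre.length + L) ≤ B)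
    (hd : ∀ v ∈ pre, v ∉ F) :
    ∃ l : List V, IsDicycleList A (pre ++ l) ∧ l.length = L ∧ (∀ v ∈ pre ++ l, v ∉ F) ∧
      ∀ b, (∀ v ∈ G, lo A i o H b v = rho b (i v) (o v)) → (l.map (lo A i o H b)).sum = ind (t L) b - ind (t 0) b := by
  obtain ⟨l, a1, a2, a3, a4, a5, a6⟩ := fill (A := A) B L z (F ∪ pre.toFinset) Y hY0 (by
    intro j hj y hy
    have hyK := mem_K.1 (hY j (by omega) hy)
    have h2 := h.g2 y hyK.1
    have hsub : Y (j + 1) \ outN A y ⊆ room i (o y) \ outN A y := by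
      apply Finset.sdiff_subset_sdiff _ (le_refl _)
      intro v hv
      have := mem_K.1 (hY (j + 1) hj hv)
      simp [room, this.2.1, hyK.2.2]
    have := Finset.card_le_card hsub
    have := Finset.card_sdiff_add_card_inter (Y (j + 1)) (outN A y)
    have := hYc (j + 1) hj
    omega) (by
    have := Finset.card_union_le F pre.toFinset
    have := List.toFinset_card_le pre
    omega)
  refine ⟨l, close_up hx hz hp hc a2 a3 ?_ ?_ ?_, a1, ?_, ?_⟩
  · intro v hv hvp; exact a4 v hv (by simp [hvp])
  · intro v hv
    have hne : l ≠ [] := by rintro rfl; simp at hv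
    have : 0 < L := by rw [← a1]; exact List.length_pos_iff.2 hne
    have := hYL this (a5 v hv)
    simpa using this
  · intro hl; apply h0; rw [← a1, hl]; rfl
  · intro v hv
    rcases List.mem_append.1 hv with hv | hv
    · exact hd v hv
    · intro hvF; exact a4 v hv (by simp [hvF])
  · intro b hb
    refine a6 (lo A i o H b) (fun j => ind (t j) b) ?_
    intro j hj y hy
    have := mem_K.1 (hY j hj hy)
    rw [hb y this.1, rho_ind, this.2.1, this.2.2]

/-- a route through the rooms for a small cycle -/
def Route (A : V → V → Prop) (i o : V → Bool) (G : Finset V) (H : ℕ) (x : V) (L : ℕ) : Prop :=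
  ∃ (t : ℕ → Bool) (Y : ℕ → Finset V), (∀ j < L, Y j ⊆ K i o G (t j) (t (j + 1)) ∧ H < 20 * (Y j).card) ∧
    Y 0 ⊆ outN A x ∧ Y (L - 1) ⊆ inN A x

/-- pattern iterates -/
def hp (e : Bool) (j : ℕ) (p : Bool) : Bool := xor p (e && j.bodd)

lemma hp_zero (e p : Bool) : hp e 0 p = p := by cases e <;> cases p <;> rfl
lemma hp_succ (e p : Bool) (j : ℕ) : hp e (j + 1) p = xor (hp e j p) e := by
  unfold hp; rw [Nat.bodd_succ]; cases e <;> cases p <;> cases j.bodd <;> rfl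
lemma hp_not (e p : Bool) (j : ℕ) : hp e j (!p) = !(hp e j p) := by
  unfold hp; cases e <;> cases p <;> cases j.bodd <;> rfl

lemma Base.type1 {A : V → V → Prop} {i o : V → Bool} {G : Finset V} {E H k : ℕ} (h : Base A i o G E H k)
    (B m : ℕ) (hm : 4 ≤ m) (hB : 20 * (B + E) ≤ H) (x : V) (hR : Route A i o G H x (m - 1)) (F : Finset V) (hF : F.card + m ≤ B)
    (hx : x ∉ F) : ∃ c, SP A i o G H m {x} c ∧ ∀ v ∈ c, v ∉ F := by
  obtain ⟨t, Y, h1, h2, h3⟩ := hR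
  obtain ⟨l, a1, a2, a3, a4⟩ := h.small_fill B (m - 1) [x] x x t Y rfl rfl (by simp) (by simp) (fun j hj => (h1 j hj).1)
    (fun j hj => by have := (h1 j hj).2; omega) (fun h0 => by
      rw [Finset.inter_eq_left.2 h2]; have := (h1 0 h0).2; omega) (fun _ => h3) (by omega) F (by simp; omega)
    (by simpa using hx)
  refine ⟨[x] ++ l, ⟨a1, by simp [a2]; omega, by simp, ?_⟩, a3⟩
  intro b hb
  have := a4 b hb
  have e1 := lo_ge (A := A) (i := i) (o := o) (H := H) (v := x) b
  have := ind_ge (t (m - 1)) b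
  have := ind_le (t 0) b
  simp only [List.map_append, List.map_cons, List.map_nil, List.sum_append, List.sum_cons, List.sum_nil]
  omega

lemma Base.K_big {A : V → V → Prop} {i o : V → Bool} {G : Finset V} {E H k : ℕ} (h : Base A i o G E H k) {e : Bool}
    (he : ∀ p, 4 * (K i o G p (!(xor p e))).card ≤ H) (p : Bool) : 100 * H ≤ (K i o G p (xor p e)).card := by
  have h1 := room_i_le h.toStr p (xor p e)
  have := he p
  have := h.g4i p
  have := h.Hn; have := h.EH; have := h.E100
  omega

lemma Base.type2 {A : V → V → Prop} {i o : V → Bool} {G : Finset V} {E H k : ℕ} (h : Base A i o G E H k) {e : Bool}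
    (he : ∀ p, 4 * (K i o G p (!(xor p e))).card ≤ H)
    (B m : ℕ) (hm : 4 ≤ m) (hB : 20 * (B + E) ≤ H) (x : V) (ox ix : Bool) (h1 : ¬ wo A i H (!ox) x) (h2 : ¬ wi A o H (!ix) x)
    (hix : ix = !(hp e (m - 1) ox)) (a c b : V) (ha : a ∈ K i o G ox (xor ox e) ∩ outN A x)
    (hb : b ∈ if m = 4 then K i o G (!ox) (xor (!ox) e) ∩ inN A x else K i o G (!ox) (xor (!ox) e))
    (hac : A a c) (hcb : A c b) (hn : [x, a, c, b].Nodup)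
    (F : Finset V) (hF : F.card + m ≤ B)
    (hx : ∀ v ∈ [x, a, c, b], v ∉ F) : ∃ l, SP A i o G H m {x, a, c, b} l ∧ ∀ v ∈ l, v ∉ F := by
  have ha := Finset.mem_inter.1 ha
  have haK := mem_K.1 ha.1
  have hxa : A x a := by simpa using ha.2
  have hbK' : b ∈ K i o G (!ox) (xor (!ox) e) := by
    split_ifs at hb
    · exact (Finset.mem_inter.1 hb).1
    · exact hb
  have hbK := mem_K.1 hbK'
  set t : ℕ → Bool := fun j => hp e (j + 1) (!ox) with ht
  have htt : ∀ j, t (j + 1) = xor (t j) e := fun j => by simp only [ht]; rw [hp_succ]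
  set Y : ℕ → Finset V := fun j => if j = m - 4 - 1 then K i o G (t j) (t (j + 1)) ∩ inN A x else K i o G (t j) (t (j + 1)) with hY
  have hYK : ∀ j, Y j ⊆ K i o G (t j) (t (j + 1)) := by
    intro j; simp only [hY]; split_ifs
    · exact Finset.inter_subset_left
    · exact le_refl _
  have hEH := h.EH
  have hE100 := h.E100
  have hpar : ∀ q, hp e (m - 1) q = hp e (m - 3) q := by
    intro q
    obtain ⟨r, rfl⟩ := Nat.exists_eq_add_of_le hm
    have e1 : 4 + r - 1 = (r + 1) + 1 + 1 := by omega
    have e2 : 4 + r - 3 = r + 1 := by omega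
    rw [e1, e2, hp_succ e q (r + 1 + 1), hp_succ e q (r + 1)]; cases hp e (r + 1) q <;> cases e <;> rfl
  have htL : t (m - 4) = ix := by
    simp only [ht]; rw [hix, ← hp_not, hpar]; congr 1; omega
  have hYc : ∀ j < m - 4, 50 * H ≤ (Y j).card := by
    intro j hj
    have hK := h.K_big he (t j)
    rw [← htt] at hK
    simp only [hY]
    split_ifs with hjj
    · have hl : t (j + 1) = ix := by rw [← htL]; congr 1; omega
      have hf := h.forced_in h2
      have hsub : K i o G (t j) (t (j + 1)) \ inN A x ⊆ room o ix \ inN A x := by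
        apply Finset.sdiff_subset_sdiff _ (le_refl _)
        intro v hv
        have := mem_K.1 hv
        simp [room, this.2.2, hl]
      have := Finset.card_le_card hsub
      have := Finset.card_sdiff_add_card_inter (K i o G (t j) (t (j + 1))) (inN A x)
      omega
    · omega
  have ht0 : t 0 = xor (!ox) e := by simp only [ht]; rw [hp_succ, hp_zero]
  obtain ⟨l, a1, a2, a3, a4⟩ := h.small_fill B (m - 4) [x, a, c, b] x b t Y rfl rfl hn
    (by simp [hxa, hac, hcb]) (fun j hj => hYK j)
    (fun j hj => by have := hYc j hj; omega) (fun h0 => by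
      have := hYc 0 h0
      have h2 := h.g2 b hbK.1
      have hsub : Y 0 \ outN A b ⊆ room i (o b) \ outN A b := by
        apply Finset.sdiff_subset_sdiff _ (le_refl _)
        intro v hv
        have := mem_K.1 (hYK 0 hv)
        simp [room, this.2.1, hbK.2.2, ht0]
      have := Finset.card_le_card hsub
      have := Finset.card_sdiff_add_card_inter (Y 0) (outN A b)
      omega) (fun _ => by simp only [hY]; rw [if_pos trivial]; exact Finset.inter_subset_right)
      (by
        intro h0
        have : m = 4 := by omega
        rw [if_pos this] at hb
        simpa using (Finset.mem_inter.1 hb).2) F (by simp; omega)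
    hx
  refine ⟨[x, a, c, b] ++ l, ⟨a1, by simp [a2]; omega, by simp, ?_⟩, a3⟩
  intro β hβ
  have := a4 β hβ
  have e1 : ind ox β - ind ix β ≤ lo A i o H β x := by
    have : ind ox β - ind ix β = ind ox β + ind (!ix) β - 1 := by rw [ind_not]; ring
    rw [this]; unfold lo ind
    have f1 : ox = β → ¬ wo A i H (!β) x := by rintro rfl; exact h1
    have f2 : (!ix) = β → ¬ wi A o H β x := by rintro rfl; exact h2
    by_cases g1 : ox = β <;> by_cases g2 : (!ix) = β
    · rw [if_pos g1, if_pos g2, if_neg (f1 g1), if_neg (f2 g2)]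
    · rw [if_pos g1, if_neg g2, if_neg (f1 g1)]; split_ifs <;> simp
    · rw [if_neg g1, if_pos g2, if_neg (f2 g2)]; split_ifs <;> simp
    · rw [if_neg g1, if_neg g2]; split_ifs <;> simp
  have e2 : lo A i o H β a = ind (xor ox e) β - ind ox β := by
    rw [hβ a haK.1, rho_ind, haK.2.1, haK.2.2]
  have e3 : lo A i o H β b = ind (xor (!ox) e) β - ind (!ox) β := by
    rw [hβ b hbK.1, rho_ind, hbK.2.1, hbK.2.2]
  have e4 := lo_ge (A := A) (i := i) (o := o) (H := H) (v := c) β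
  have := ind_ge (xor ox e) β
  have := ind_le (!ox) β
  simp only [List.map_append, List.map_cons, List.map_nil, List.sum_append, List.sum_cons, List.sum_nil]
  rw [a4 β hβ, htL, ht0]
  omega

lemma Base.route_mixed {A : V → V → Prop} {i o : V → Bool} {G : Finset V} {E H k : ℕ} (h : Base A i o G E H k)
    (hm : ∀ p q, H ≤ 8 * (K i o G p q).card) (x : V) (L : ℕ) (hL : 3 ≤ L) : Route A i o G H x L := by
  have hEH := h.EH
  have hE100 := h.E100
  have hG := h.g1
  have s1 : ∀ (S : Finset V) (p : Bool), H ≤ (room i p ∩ S).card → ∃ q, 3 * H ≤ 8 * (K i o G p q ∩ S).card := by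
    intro S p hp
    have : room i p ∩ S ⊆ (K i o G p true ∩ S ∪ K i o G p false ∩ S) ∪ Gᶜ := by
      intro v hv
      simp only [room, Finset.mem_inter, Finset.mem_filter, Finset.mem_univ, true_and] at hv
      simp only [Finset.mem_union, Finset.mem_inter, mem_K, Finset.mem_compl, hv]
      cases o v <;> simp <;> tauto
    have := Finset.card_le_card this
    have := Finset.card_union_le (K i o G p true ∩ S ∪ K i o G p false ∩ S) Gᶜ
    have := Finset.card_union_le (K i o G p true ∩ S) (K i o G p false ∩ S)
    by_contra hc
    push Not at hc
    have := hc true; have := hc false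
    omega
  have s2 : ∀ (S : Finset V) (p : Bool), H ≤ (room o p ∩ S).card → ∃ q, 3 * H ≤ 8 * (K i o G q p ∩ S).card := by
    intro S p hp
    have : room o p ∩ S ⊆ (K i o G true p ∩ S ∪ K i o G false p ∩ S) ∪ Gᶜ := by
      intro v hv
      simp only [room, Finset.mem_inter, Finset.mem_filter, Finset.mem_univ, true_and] at hv
      simp only [Finset.mem_union, Finset.mem_inter, mem_K, Finset.mem_compl, hv]
      cases i v <;> simp <;> tauto
    have := Finset.card_le_card this
    have := Finset.card_union_le (K i o G true p ∩ S ∪ K i o G false p ∩ S) Gᶜ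
    have := Finset.card_union_le (K i o G true p ∩ S) (K i o G false p ∩ S)
    by_contra hc
    push Not at hc
    have := hc true; have := hc false
    omega
  obtain ⟨o', ho'⟩ : ∃ b, wo A i H b x := by
    rcases h.wo_or true x with h | h <;> exact ⟨_, h⟩
  obtain ⟨i', hi'⟩ : ∃ b, wi A o H b x := by
    rcases h.wi_or true x with h | h <;> exact ⟨_, h⟩
  obtain ⟨q1, hq1⟩ := s1 _ _ ho'
  obtain ⟨q2, hq2⟩ := s2 _ _ hi'
  set t : ℕ → Bool := fun j => if j = 0 then o' else if j = L then i' else if j = L - 1 then q2 else q1 with ht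
  refine ⟨t, fun j => if j = 0 then K i o G o' q1 ∩ outN A x else if j = L - 1 then K i o G q2 i' ∩ inN A x else
    K i o G (t j) (t (j + 1)), ?_, ?_, ?_⟩
  · intro j hj
    dsimp only
    by_cases h0 : j = 0
    · subst h0
      have e1 : t 0 = o' := by simp [ht]
      have e2 : t (0 + 1) = q1 := by
        simp only [ht]; rw [if_neg (by omega), if_neg (by omega), if_neg (by omega)]
      rw [if_pos rfl, e1, e2]
      exact ⟨Finset.inter_subset_left, by omega⟩
    · rw [if_neg h0]
      by_cases h1 : j = L - 1
      · have e1 : t j = q2 := by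
          simp only [ht]; rw [if_neg (by omega), if_neg (by omega), if_pos (by omega)]
        have e2 : t (j + 1) = i' := by
          simp only [ht]; rw [if_neg (by omega), if_pos (by omega)]
        rw [if_pos h1, e1, e2]
        exact ⟨Finset.inter_subset_left, by omega⟩
      · rw [if_neg h1]
        exact ⟨le_refl _, by have := hm (t j) (t (j + 1)); omega⟩
  · dsimp only; rw [if_pos rfl]; exact Finset.inter_subset_right
  · dsimp only; rw [if_neg (by omega), if_pos rfl]; exact Finset.inter_subset_right

lemma Base.route_pat {A : V → V → Prop} {i o : V → Bool} {G : Finset V} {E H k : ℕ} (h : Base A i o G E H k) {e : Bool}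
    (he : ∀ p, 4 * (K i o G p (!(xor p e))).card ≤ H) (x : V) (L : ℕ) (hL : 3 ≤ L) : Route A i o G H x L ∨
    ∃ ox ix, ¬ wo A i H (!ox) x ∧ ¬ wi A o H (!ix) x ∧ ix = !(hp e L ox) := by
  have hEH := h.EH
  have hE100 := h.E100
  have hG := h.g1
  by_cases hex : ∃ o' i', wo A i H o' x ∧ wi A o H i' x ∧ i' = hp e L o'
  · left
    obtain ⟨o', i', ho', hi', hh⟩ := hex
    have s1 : H ≤ 2 * (K i o G o' (xor o' e) ∩ outN A x).card := by
      have : room i o' ∩ outN A x ⊆ (K i o G o' (xor o' e) ∩ outN A x ∪ K i o G o' (!(xor o' e))) ∪ Gᶜ := by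
        intro v hv
        simp only [room, Finset.mem_inter, Finset.mem_filter, Finset.mem_univ, true_and] at hv
        simp only [Finset.mem_union, Finset.mem_inter, mem_K, Finset.mem_compl, hv]
        cases o v <;> cases o' <;> cases e <;> simp <;> tauto
      have := Finset.card_le_card this
      have := Finset.card_union_le (K i o G o' (xor o' e) ∩ outN A x ∪ K i o G o' (!(xor o' e))) Gᶜ
      have := Finset.card_union_le (K i o G o' (xor o' e) ∩ outN A x) (K i o G o' (!(xor o' e)))
      have := he o'
      unfold wo at ho'
      omega
    have s2 : H ≤ 2 * (K i o G (xor i' e) i' ∩ inN A x).card := by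
      have : room o i' ∩ inN A x ⊆ (K i o G (xor i' e) i' ∩ inN A x ∪ K i o G (!(xor i' e)) i') ∪ Gᶜ := by
        intro v hv
        simp only [room, Finset.mem_inter, Finset.mem_filter, Finset.mem_univ, true_and] at hv
        simp only [Finset.mem_union, Finset.mem_inter, mem_K, Finset.mem_compl, hv]
        cases i v <;> cases i' <;> cases e <;> simp <;> tauto
      have := Finset.card_le_card this
      have := Finset.card_union_le (K i o G (xor i' e) i' ∩ inN A x ∪ K i o G (!(xor i' e)) i') Gᶜ
      have := Finset.card_union_le (K i o G (xor i' e) i' ∩ inN A x) (K i o G (!(xor i' e)) i')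
      have h5 := he (!(xor i' e))
      have : (!(xor (!(xor i' e)) e)) = i' := by cases i' <;> cases e <;> rfl
      rw [this] at h5
      unfold wi at hi'
      omega
    refine ⟨fun j => hp e j o', fun j => if j = 0 then K i o G o' (xor o' e) ∩ outN A x else if j = L - 1 then
      K i o G (xor i' e) i' ∩ inN A x else K i o G (hp e j o') (hp e (j + 1) o'), ?_, ?_, ?_⟩
    · intro j hj
      dsimp only
      by_cases h0 : j = 0
      · subst h0
        rw [if_pos rfl, hp_succ, hp_zero]
        exact ⟨Finset.inter_subset_left, by omega⟩
      · rw [if_neg h0]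
        by_cases h1 : j = L - 1
        · have e2 : hp e (j + 1) o' = i' := by rw [hh]; congr 1; omega
          have e1 : hp e j o' = xor i' e := by
            rw [← e2, hp_succ]; cases hp e j o' <;> cases e <;> rfl
          rw [if_pos h1, e1, e2]
          exact ⟨Finset.inter_subset_left, by omega⟩
        · rw [if_neg h1, hp_succ]
          exact ⟨le_refl _, by have := h.K_big he (hp e j o'); omega⟩
    · dsimp only; rw [if_pos rfl]; exact Finset.inter_subset_right
    · dsimp only; rw [if_neg (by omega), if_pos rfl]; exact Finset.inter_subset_right
  · right
    push Not at hex
    obtain ⟨o', ho'⟩ : ∃ b, wo A i H b x := by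
      rcases h.wo_or true x with h | h <;> exact ⟨_, h⟩
    obtain ⟨i', hi'⟩ : ∃ b, wi A o H b x := by
      rcases h.wi_or true x with h | h <;> exact ⟨_, h⟩
    have h1 := hex o' i' ho' hi'
    have h2 : i' = !(hp e L o') := by
      revert h1; cases i' <;> cases hp e L o' <;> simp
    refine ⟨o', i', ?_, ?_, h2⟩
    · intro hw
      exact hex _ _ hw hi' (by rw [hp_not]; exact h2)
    · intro hw
      exact hex _ _ ho' hw (by rw [h2]; simp)
end smalls


section conf
variable {V : Type*} [Fintype V]

lemma smalls_gen {k : ℕ} {A : V → V → Prop} {i o : V → Bool} {G : Finset V} {H : ℕ} (B s : ℕ)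
    (N : Fin k → ℕ) (i₀ : Fin k) (hs : ∑ j ∈ Finset.univ.erase i₀, N j ≤ s) (Core : Fin k → Finset V)
    (hCc : ∀ j, (Core j).card ≤ 4)
    (hP : ∀ j, j ≠ i₀ → ∀ F : Finset V, F.card + N j ≤ B → (∀ v ∈ Core j, v ∉ F) →
      ∃ l, SP A i o G H (N j) (Core j) l ∧ ∀ v ∈ l, v ∉ F)
    (hC : ∀ j, j ≠ i₀ → ∀ l, l ≠ i₀ → j ≠ l → Disjoint (Core j) (Core l))
    (FJ : Finset V) (hB : FJ.card + 4 * k + 2 * s ≤ B) :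
    ∃ l : Fin k → List V, (∀ j, j ≠ i₀ → SP A i o G H (N j) (Core j) (l j) ∧
      ∀ v ∈ FJ, v ∈ l j → v ∈ (Finset.univ.erase i₀).biUnion Core) ∧
      ∀ j, j ≠ i₀ → ∀ j', j' ≠ i₀ → j ≠ j' → ∀ v ∈ l j, v ∉ l j' := by
  have hle : ∀ j, j ≠ i₀ → N j ≤ s := fun j hj =>
    (Finset.single_le_sum (f := N) (fun _ _ => Nat.zero_le _) (by simp [hj])).trans hs
  obtain ⟨l, h1, h2⟩ := seq_disjoint (Finset.univ.erase i₀) Core (fun j l => SP A i o G H (N j) (Core j) l) N (B - s)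
    (FJ \ (Finset.univ.erase i₀).biUnion Core)
    (fun j hj l hl hjl => hC j (by simpa using hj) l (by simpa using hl) hjl)
    (by
      intro j hj
      rw [Finset.disjoint_left]
      intro v hv hv'
      exact (Finset.mem_sdiff.1 hv).2 (Finset.mem_biUnion.2 ⟨j, hj, hv'⟩))
    (by
      intro j hj F hF hd
      have hj' : j ≠ i₀ := by simpa using hj
      exact hP j hj' F (by have := hle j hj'; omega) (fun v hv hvF => Finset.disjoint_left.1 hd hvF hv))
    (fun j hj c hc => ⟨hc.2.1.le, hc.2.2.1⟩)
    (by
      have e1 := Finset.card_le_card (Finset.sdiff_subset (s := FJ) (t := (Finset.univ.erase i₀).biUnion Core))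
      have e2 : ∑ j ∈ Finset.univ.erase i₀, (Core j).card ≤ (Finset.univ.erase i₀).card * 4 :=
        Finset.sum_le_card_nsmul _ _ _ (fun j _ => hCc j)
      have e3 := Finset.card_le_univ (Finset.univ.erase i₀)
      rw [Fintype.card_fin] at e3
      omega)
  refine ⟨l, fun j hj => ⟨(h1 j (by simp [hj])).1, ?_⟩, fun j hj j' hj' hne => h2 j (by simp [hj]) j' (by simp [hj']) hne⟩
  intro v hv hvl
  by_contra hc
  exact (h1 j (by simp [hj])).2 v hvl (Finset.mem_sdiff.2 ⟨hv, hc⟩)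

lemma Base.miss_o {A : V → V → Prop} {i o : V → Bool} {G : Finset V} {E H k : ℕ} (h : Base A i o G E H k) {e : Bool}
    (he : ∀ p, 4 * (K i o G p (!(xor p e))).card ≤ H) (p : Bool) : 2 * (room o (xor p e) \ K i o G p (xor p e)).card ≤ H := by
  have : room o (xor p e) \ K i o G p (xor p e) ⊆ Gᶜ ∪ K i o G (!p) (!(xor (!p) e)) := by
    intro v
    simp only [Finset.mem_sdiff, Finset.mem_union, Finset.mem_compl, mem_K, room, Finset.mem_filter, Finset.mem_univ, true_and]
    cases i v <;> cases o v <;> cases p <;> cases e <;> simp <;> tauto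
  have := Finset.card_le_card this
  have := Finset.card_union_le Gᶜ (K i o G (!p) (!(xor (!p) e)))
  have := he (!p); have := h.g1; have := h.EH; have := h.E100
  omega

lemma Base.miss_i {A : V → V → Prop} {i o : V → Bool} {G : Finset V} {E H k : ℕ} (h : Base A i o G E H k) {e : Bool}
    (he : ∀ p, 4 * (K i o G p (!(xor p e))).card ≤ H) (p : Bool) : 2 * (room i p \ K i o G p (xor p e)).card ≤ H := by
  have : room i p \ K i o G p (xor p e) ⊆ Gᶜ ∪ K i o G p (!(xor p e)) := by
    intro v
    simp only [Finset.mem_sdiff, Finset.mem_union, Finset.mem_compl, mem_K, room, Finset.mem_filter, Finset.mem_univ, true_and]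
    cases i v <;> cases o v <;> cases p <;> cases e <;> simp <;> tauto
  have := Finset.card_le_card this
  have := Finset.card_union_le Gᶜ (K i o G p (!(xor p e)))
  have := he p; have := h.g1; have := h.EH; have := h.E100
  omega

lemma miss_inter (R K' S : Finset V) (R' : Finset V) (hK : K' ⊆ R') : (R \ (K' ∩ S)).card ≤ (R \ K').card + (R' \ S).card := by
  have : R \ (K' ∩ S) ⊆ (R \ K') ∪ (R' \ S) := by
    intro v; simp only [Finset.mem_sdiff, Finset.mem_inter, Finset.mem_union]
    intro ⟨h1, h2⟩
    by_cases hv : v ∈ K'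
    · right; exact ⟨hK hv, fun hh => h2 ⟨hv, hh⟩⟩
    · left; exact ⟨h1, hv⟩
  exact (Finset.card_le_card this).trans (Finset.card_union_le _ _)

lemma Base.textend' {ι : Type*} [DecidableEq ι] {A : V → V → Prop} {i o : V → Bool} {G : Finset V} {E H k : ℕ} (h : Base A i o G E H k)
    (At Bt Xt : ι → Finset V) (X : Finset V) (hX : X.card ≤ k) (I : Finset ι) (a c b : ι → V) (j : ι) (hj : j ∉ I)
    (hT : TOk A (Bad A i o H k) X At Bt Xt I a c b)
    (ri ro : Bool) (hA : (room o ri \ At j).card ≤ 3 * H) (hB : (room i ro \ Bt j).card ≤ 3 * H)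
    (hXt : Xt j ⊆ X) (hI : I.card ≤ 2 * k) (hc : (Xt j).card + I.card < 2 * k) :
    ∃ a c b, TOk A (Bad A i o H k) X At Bt Xt (insert j I) a c b := by
  obtain ⟨a, c, b, h⟩ := h.textend At Bt Xt X hX I a c b j hj hT ri ro hA hB hXt hI hc
  refine ⟨a, c, b, ?_⟩
  convert h

/-- existence of all the triples -/
lemma Base.tasks {k : ℕ} {A : V → V → Prop} {i o : V → Bool} {G : Finset V} {E H : ℕ} (h : Base A i o G E H k) {e : Bool}
    (he : ∀ p, 4 * (K i o G p (!(xor p e))).card ≤ H) (x : Fin k → V) (hx : Function.Injective x) (N : Fin k → ℕ)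
    (hN : ∀ j, 4 ≤ N j) (i₀ : Fin k)
    (bs : Finset (Fin k)) (hbs : ∀ j ∈ bs, j ≠ i₀) (ox ix : Fin k → Bool)
    (hf : ∀ j ∈ bs, ¬ wo A i H (!(ox j)) (x j) ∧ ¬ wi A o H (!(ix j)) (x j) ∧ ix j = !(hp e (N j - 1) (ox j))) :
    ∃ a c b : Fin k ⊕ Bool → V, ∃ D : Finset Bool, (e = false → D = Finset.univ) ∧ (e = true → D = ∅) ∧
    TOk A (Bad A i o H k) (Finset.univ.image x)
      (Sum.elim (fun j => K i o G (ox j) (xor (ox j) e) ∩ outN A (x j)) (fun d => K i o G d d))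
      (Sum.elim (fun j => if N j = 4 then K i o G (!(ox j)) (xor (!(ox j)) e) ∩ inN A (x j) else K i o G (!(ox j)) (xor (!(ox j)) e))
        (fun d => K i o G (!d) (!d)))
      (Sum.elim (fun _ => Finset.univ.image x) (fun d => if d then Finset.univ.image x else (Finset.univ.image x).erase (x i₀)))
      (bs.map ⟨Sum.inl, Sum.inl_injective⟩ ∪ D.map ⟨Sum.inr, Sum.inr_injective⟩) a c b := by
  set X := Finset.univ.image x with hX
  have hXc : X.card = k := by rw [hX, Finset.card_image_of_injective _ hx]; simp
  set At : Fin k ⊕ Bool → Finset V := (Sum.elim (fun j => K i o G (ox j) (xor (ox j) e) ∩ outN A (x j)) (fun d => K i o G d d)) with hAt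
  set Bt : Fin k ⊕ Bool → Finset V := (Sum.elim (fun j => if N j = 4 then K i o G (!(ox j)) (xor (!(ox j)) e) ∩ inN A (x j) else K i o G (!(ox j)) (xor (!(ox j)) e))
        (fun d => K i o G (!d) (!d))) with hBt
  set Xt : Fin k ⊕ Bool → Finset V := (Sum.elim (fun _ => X) (fun d => if d then X else X.erase (x i₀))) with hXt
  have hEH := h.EH
  have hbk : bs.card + 1 ≤ k := by
    have : bs ⊆ Finset.univ.erase i₀ := fun j hj => by simpa using hbs j hj
    have := Finset.card_le_card this
    rw [Finset.card_erase_of_mem (Finset.mem_univ _)] at this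
    simp at this
    have := h.hk
    omega
  have h1 : ∀ J : Finset (Fin k), J ⊆ bs → ∃ a c b, TOk A (Bad A i o H k) X At Bt Xt (J.map ⟨Sum.inl, Sum.inl_injective⟩) a c b := by
    intro J
    induction J using Finset.induction_on with
    | empty =>
      intro _
      exact ⟨fun _ => x i₀, fun _ => x i₀, fun _ => x i₀, by simp [TOk]⟩
    | insert j J hj ih =>
      intro hJ
      obtain ⟨a, c, b, hT⟩ := ih ((Finset.subset_insert _ _).trans hJ)
      have hjb : j ∈ bs := hJ (Finset.mem_insert_self _ _)
      obtain ⟨f1, f2, f3⟩ := hf j hjb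
      have hJc : J.card + 1 ≤ bs.card := by
        rw [← Finset.card_insert_of_notMem hj]; exact Finset.card_le_card hJ
      rw [Finset.map_insert]
      refine h.textend' At Bt Xt X hXc.le _ a c b (Sum.inl j) (by simpa using hj) hT (xor (ox j) e) (!(ox j)) ?_ ?_ (le_refl _)
        (by rw [Finset.card_map]; omega) (by rw [Finset.card_map]; simp only [hXt, Sum.elim_inl, Function.Embedding.coeFn_mk]; omega)
      · simp only [hAt, Sum.elim_inl, Function.Embedding.coeFn_mk]
        have g1 := miss_inter (room o (xor (ox j) e)) (K i o G (ox j) (xor (ox j) e)) (outN A (x j)) (room i (ox j)) (by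
          intro v hv; have := mem_K.1 hv; simp [room, this.2.1])
        have := h.miss_o he (ox j)
        have := h.forced_out f1
        omega
      · simp only [hBt, Sum.elim_inl, Function.Embedding.coeFn_mk]
        have := h.miss_i he (!(ox j))
        split_ifs with h4
        · have g1 := miss_inter (room i (!(ox j))) (K i o G (!(ox j)) (xor (!(ox j)) e)) (inN A (x j)) (room o (ix j)) (by
            intro v hv
            have := mem_K.1 hv
            simp only [room, Finset.mem_filter, Finset.mem_univ, true_and]
            rw [this.2.2, f3, h4]; cases ox j <;> cases e <;> rfl)
          have := h.forced_in f2
          omega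
        · omega
  obtain ⟨a, c, b, hT⟩ := h1 bs (le_refl _)
  cases e with
  | true => exact ⟨a, c, b, ∅, by simp, by simp, by simpa using hT⟩
  | false =>
    obtain ⟨a, c, b, hT⟩ := h.textend' At Bt Xt X hXc.le _ a c b (Sum.inr true) (by simp) hT true false (by
        simp only [hAt, Sum.elim_inr]
        have := h.miss_o he true
        simp only [Bool.xor_false] at this
        omega) (by
        simp only [hBt, Sum.elim_inr]
        have := h.miss_i he false
        simp only [Bool.xor_false] at this
        simp only [Bool.not_true]
        omega) (by simp [hXt]) (by rw [Finset.card_map]; omega) (by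
        rw [Finset.card_map]; simp only [hXt, Sum.elim_inr]; simp; omega)
    obtain ⟨a, c, b, hT⟩ := h.textend' At Bt Xt X hXc.le _ a c b (Sum.inr false) (by simp) hT false true (by
        simp only [hAt, Sum.elim_inr]
        have := h.miss_o he false
        simp only [Bool.xor_false] at this
        omega) (by
        simp only [hBt, Sum.elim_inr]
        have := h.miss_i he true
        simp only [Bool.xor_false] at this
        simp only [Bool.not_false]
        omega) (by simp [hXt, Finset.erase_subset]) (by
          rw [Finset.card_insert_of_notMem (by simp), Finset.card_map]; omega) (by
        rw [Finset.card_insert_of_notMem (by simp), Finset.card_map]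
        have e1 : Xt (Sum.inr false) = X.erase (x i₀) := by simp [hXt]
        have e2 : (X.erase (x i₀)).card = X.card - 1 := Finset.card_erase_of_mem (by simp [hX])
        rw [e1, e2]
        have := h.hk
        omega)
    refine ⟨a, c, b, Finset.univ, by simp, by simp, ?_⟩
    convert hT using 1
    ext z; rcases z with z | z
    · simp
    · cases z <;> simp

end conf


section conf2
variable {V : Type*} [Fintype V]

/-- a configuration of small cycles and transfer triples -/
structure Conf {k : ℕ} (A : V → V → Prop) (i o : V → Bool) (G : Finset V) (H : ℕ) (x : Fin k → V) (N : Fin k → ℕ)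
    (i₀ : Fin k) (FJ : Finset V) (l : Fin k → List V) (D : Finset Bool) (a c b : Bool → V) (Z : Finset V) : Prop where
  sp : ∀ j, j ≠ i₀ → SP A i o G H (N j) {x j} (l j)
  dis : ∀ j, j ≠ i₀ → ∀ j', j' ≠ i₀ → j ≠ j' → ∀ v ∈ l j, v ∉ l j'
  x0 : ∀ j, j ≠ i₀ → x i₀ ∉ l j
  tr : ∀ d ∈ D, a d ∈ K i o G d d ∧ b d ∈ K i o G (!d) (!d) ∧ A (a d) (c d) ∧ A (c d) (b d) ∧ a d ≠ b d
  trd : ∀ d ∈ D, ∀ d' ∈ D, d ≠ d' → Disjoint (tri (a d) (c d) (b d)) (tri (a d') (c d') (b d'))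
  trl : ∀ d ∈ D, ∀ j, j ≠ i₀ → ∀ v ∈ l j, v ∉ tri (a d) (c d) (b d)
  hit : ∀ v ∈ FJ, ((∃ j, j ≠ i₀ ∧ v ∈ l j) ∨ ∃ d ∈ D, v ∈ tri (a d) (c d) (b d)) → v ∈ Z
  Zc : Z.card ≤ 4 * k + 2
  conn : (D = Finset.univ ∧ ∀ p, 4 * (K i o G p (!p)).card ≤ H) ∨ (D = ∅ ∧ H ≤ 8 * (G.filter (fun v => i v ≠ o v)).card)

lemma tri_card (a c b : V) : (tri a c b).card ≤ 3 := Finset.card_le_three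

lemma mem_tri {a c b v : V} : v ∈ tri a c b ↔ v = a ∨ v = c ∨ v = b := by simp [tri]

lemma Base.conf_core {k : ℕ} {A : V → V → Prop} {i o : V → Bool} {G : Finset V} {E H : ℕ} (h : Base A i o G E H k)
    (x : Fin k → V) (hx : Function.Injective x) (N : Fin k → ℕ)
    (hN : ∀ j, 4 ≤ N j) (i₀ : Fin k) (B s : ℕ) (hs : ∑ j ∈ Finset.univ.erase i₀, N j ≤ s)
    (bs : Finset (Fin k)) (D : Finset Bool) (a c b : Fin k ⊕ Bool → V) (At Bt Xt : Fin k ⊕ Bool → Finset V) (Bd : Finset V)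
    (hT : TOk A Bd (Finset.univ.image x) At Bt Xt
      (bs.map ⟨Sum.inl, Sum.inl_injective⟩ ∪ D.map ⟨Sum.inr, Sum.inr_injective⟩) a c b)
    (hXl : ∀ j, Xt (Sum.inl j) = Finset.univ.image x) (hXr : ∀ d, (Finset.univ.image x).erase (x i₀) ⊆ Xt (Sum.inr d))
    (hAt : ∀ d, At (Sum.inr d) = K i o G d d) (hBt : ∀ d, Bt (Sum.inr d) = K i o G (!d) (!d))
    (hB : 20 * (B + E) ≤ H)
    (hR : ∀ j, j ≠ i₀ → j ∉ bs → Route A i o G H (x j) (N j - 1))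
    (hbs : ∀ j ∈ bs, ∀ F : Finset V, F.card + N j ≤ B → [x j, a (Sum.inl j), c (Sum.inl j), b (Sum.inl j)].Nodup →
      (∀ v ∈ [x j, a (Sum.inl j), c (Sum.inl j), b (Sum.inl j)], v ∉ F) →
      ∃ l, SP A i o G H (N j) {x j, a (Sum.inl j), c (Sum.inl j), b (Sum.inl j)} l ∧ ∀ v ∈ l, v ∉ F)
    (conn : (D = Finset.univ ∧ ∀ p, 4 * (K i o G p (!p)).card ≤ H) ∨ (D = ∅ ∧ H ≤ 8 * (G.filter (fun v => i v ≠ o v)).card))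
    (FJ : Finset V) (hFB : FJ.card + 7 + 4 * k + 2 * s ≤ B) :
    ∃ l D a c b Z, Conf A i o G H x N i₀ FJ l D a c b Z := by
  obtain ⟨t1, t2⟩ := hT
  set X := Finset.univ.image x with hX
  have hxX : ∀ j, x j ∈ X := fun j => by simp [hX]
  have ml : ∀ j ∈ bs, (Sum.inl j : Fin k ⊕ Bool) ∈ (bs.map ⟨Sum.inl, Sum.inl_injective⟩ ∪ D.map ⟨Sum.inr, Sum.inr_injective⟩ : Finset (Fin k ⊕ Bool)) := by
    intro j hj; simp [hj]
  have mr : ∀ d ∈ D, (Sum.inr d : Fin k ⊕ Bool) ∈ (bs.map ⟨Sum.inl, Sum.inl_injective⟩ ∪ D.map ⟨Sum.inr, Sum.inr_injective⟩ : Finset (Fin k ⊕ Bool)) := by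
    intro j hj; simp [hj]
  set T : Fin k ⊕ Bool → Finset V := fun z => tri (a z) (c z) (b z) with hTd
  set Core : Fin k → Finset V := fun j => if j ∈ bs then insert (x j) (T (Sum.inl j)) else {x j} with hCore
  have hxT : ∀ j ∈ bs, ∀ j', x j' ∉ T (Sum.inl j) := by
    intro j hj j'
    obtain ⟨_, _, _, _, _, p1, p2, p3, _⟩ := t1 _ (ml j hj)
    rw [hXl] at p3
    simp only [hTd, mem_tri]
    rintro (e | e | e)
    · exact p1 (e ▸ hxX j')
    · exact p3 (e ▸ hxX j')
    · exact p2 (e ▸ hxX j')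
  have hxT2 : ∀ d ∈ D, ∀ j', j' ≠ i₀ → x j' ∉ T (Sum.inr d) := by
    intro d hd j' hj'
    obtain ⟨_, _, _, _, _, p1, p2, p3, _⟩ := t1 _ (mr d hd)
    simp only [hTd, mem_tri]
    rintro (e | e | e)
    · exact p1 (e ▸ hxX j')
    · exact p3 (hXr d (by rw [← e]; exact Finset.mem_erase.2 ⟨fun hh => hj' (hx hh), hxX j'⟩))
    · exact p2 (e ▸ hxX j')
  have hCm : ∀ j v, v ∈ Core j → v = x j ∨ (j ∈ bs ∧ v ∈ T (Sum.inl j)) := by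
    intro j v hv
    simp only [hCore] at hv
    split_ifs at hv with hj
    · rcases Finset.mem_insert.1 hv with e | e
      · exact Or.inl e
      · exact Or.inr ⟨hj, e⟩
    · left; simpa using hv
  have hCx : ∀ j, x j ∈ Core j := by
    intro j; simp only [hCore]; split_ifs <;> simp
  set FJ' : Finset V := (FJ ∪ {x i₀}) ∪ D.biUnion (fun d => T (Sum.inr d)) with hFJ'
  have hDT : (D.biUnion (fun d => T (Sum.inr d))).card ≤ 6 := by
    have e1 : (D.biUnion (fun d => T (Sum.inr d))).card ≤ D.card * 3 := Finset.card_biUnion_le_card_mul _ _ _ (fun d _ => tri_card _ _ _)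
    have e2 := Finset.card_le_univ D
    simp at e2
    omega
  obtain ⟨l, h1, h2⟩ := smalls_gen (A := A) (i := i) (o := o) (G := G) (H := H) B s N i₀ hs Core (by
      intro j; simp only [hCore]; split_ifs
      · have := Finset.card_insert_le (x j) (T (Sum.inl j))
        have : (T (Sum.inl j)).card ≤ 3 := tri_card _ _ _
        omega
      · simp)
    (by
      intro j hj F hF hFd
      by_cases hjb : j ∈ bs
      · have e1 : Core j = {x j, a (Sum.inl j), c (Sum.inl j), b (Sum.inl j)} := by
          simp only [hCore, if_pos hjb, hTd, tri]
        rw [e1] at hFd ⊢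
        refine hbs j hjb F hF ?_ (fun v hv => hFd v (by simpa using hv))
        obtain ⟨_, _, q1, q2, q3, p1, p2, p3, _⟩ := t1 _ (ml j hjb)
        have := hxT j hjb j
        simp only [hTd, mem_tri, not_or] at this
        have r1 : a (Sum.inl j) ≠ c (Sum.inl j) := by intro e; rw [e] at q1; exact h.hirr _ q1
        have r2 : c (Sum.inl j) ≠ b (Sum.inl j) := by intro e; rw [e] at q2; exact h.hirr _ q2
        simp [this, q3, r1, r2]
      · have e1 : Core j = {x j} := by simp only [hCore, if_neg hjb]
        rw [e1] at hFd ⊢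
        exact h.type1 B (N j) (hN j) hB (x j) (hR j hj hjb) F hF (hFd _ (by simp)))
    (by
      intro j hj j' hj' hne
      rw [Finset.disjoint_left]
      intro v hv hv'
      rcases hCm j v hv with e | ⟨e1, e2⟩ <;> rcases hCm j' v hv' with e' | ⟨e1', e2'⟩
      · exact hne (hx (e.symm.trans e'))
      · subst e; exact hxT j' e1' j e2'
      · subst e'; exact hxT j e1 j' e2
      · exact Finset.disjoint_left.1 (t2 _ (ml j e1) _ (ml j' e1') (by simpa using hne)) e2 e2')
    FJ' (by
      have e1 : FJ'.card ≤ (FJ ∪ {x i₀}).card + (D.biUnion (fun d => T (Sum.inr d))).card := Finset.card_union_le _ _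
      have e2 : (FJ ∪ {x i₀}).card ≤ FJ.card + ({x i₀} : Finset V).card := Finset.card_union_le _ _
      rw [Finset.card_singleton] at e2
      omega)
  set CC := (Finset.univ.erase i₀).biUnion Core with hCC
  have hk := h.hk
  have hCCc : CC.card ≤ 4 * (k - 1) := by
    have e1 : CC.card ≤ (Finset.univ.erase i₀).card * 4 := by
      apply Finset.card_biUnion_le_card_mul
      intro j hj; simp only [hCore]; split_ifs
      · have := Finset.card_insert_le (x j) (T (Sum.inl j))
        have : (T (Sum.inl j)).card ≤ 3 := tri_card _ _ _
        omega
      · simp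
    rw [Finset.card_erase_of_mem (Finset.mem_univ _)] at e1
    simp at e1
    omega
  refine ⟨l, D, fun d => a (Sum.inr d), fun d => c (Sum.inr d), fun d => b (Sum.inr d),
    CC ∪ D.biUnion (fun d => T (Sum.inr d)), ?_, h2, ?_, ?_, ?_, ?_, ?_, ?_, conn⟩
  · intro j hj
    obtain ⟨⟨s1, s2, s3, s4⟩, _⟩ := h1 j hj
    refine ⟨s1, s2, ?_, s4⟩
    intro v hv
    rw [Finset.mem_singleton.1 hv]
    exact s3 _ (hCx j)
  · intro j hj hh
    have := (h1 j hj).2 (x i₀) (by simp [hFJ']) hh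
    obtain ⟨j', hj', hv⟩ := Finset.mem_biUnion.1 this
    rcases hCm j' _ hv with e | ⟨e1, e2⟩
    · have := hx e; simp [this] at hj'
    · exact hxT j' e1 _ e2
  · intro d hd
    obtain ⟨p1, p2, p3, p4, p5, _⟩ := t1 _ (mr d hd)
    rw [hAt] at p1; rw [hBt] at p2
    exact ⟨p1, p2, p3, p4, p5⟩
  · intro d hd d' hd' hne
    exact t2 _ (mr d hd) _ (mr d' hd') (by simpa using hne)
  · intro d hd j hj v hv hvT
    have hvF : v ∈ FJ' := by
      simp only [hFJ', Finset.mem_union, Finset.mem_biUnion]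
      right; exact ⟨d, hd, hvT⟩
    have := (h1 j hj).2 v hvF hv
    obtain ⟨j', hj', hv'⟩ := Finset.mem_biUnion.1 this
    rcases hCm j' _ hv' with e | ⟨e1, e2⟩
    · subst e; exact hxT2 d hd j' (by simpa using hj') hvT
    · exact Finset.disjoint_left.1 (t2 _ (ml j' e1) _ (mr d hd) (by simp)) e2 hvT
  · intro v hv hh
    rw [Finset.mem_union]
    rcases hh with ⟨j, hj, hvj⟩ | ⟨d, hd, hvd⟩
    · left; exact (h1 j hj).2 v (by simp [hFJ', hv]) hvj
    · right; exact Finset.mem_biUnion.2 ⟨d, hd, hvd⟩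
  · have : (CC ∪ D.biUnion (fun d => T (Sum.inr d))).card ≤ CC.card + (D.biUnion (fun d => T (Sum.inr d))).card := Finset.card_union_le _ _
    omega

theorem Base.conf_exists {k : ℕ} {A : V → V → Prop} {i o : V → Bool} {G : Finset V} {E H : ℕ} (h : Base A i o G E H k)
    (x : Fin k → V) (hx : Function.Injective x) (N : Fin k → ℕ)
    (hN : ∀ j, 4 ≤ N j) (i₀ : Fin k) (B s : ℕ) (hs : ∑ j ∈ Finset.univ.erase i₀, N j ≤ s)
    (hB : 20 * (B + E) ≤ H)
    (FJ : Finset V) (hFB : FJ.card + 7 + 4 * k + 2 * s ≤ B) :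
    ∃ l D a c b Z, Conf A i o G H x N i₀ FJ l D a c b Z := by
  have hE100 := h.E100
  rcases h.class_cases with hm | ⟨e, he⟩
  · refine h.conf_core x hx N hN i₀ B s hs ∅ ∅ (fun _ => x i₀) (fun _ => x i₀) (fun _ => x i₀)
      (Sum.elim (fun _ => ∅) (fun d => K i o G d d)) (Sum.elim (fun _ => ∅) (fun d => K i o G (!d) (!d)))
      (fun _ => Finset.univ.image x) ∅ ?_ ?_ ?_ ?_ ?_ hB ?_ ?_ ?_ FJ hFB
    · simp [TOk]
    · intro j; rfl
    · intro d; exact Finset.erase_subset _ _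
    · intro d; rfl
    · intro d; rfl
    · intro j hj _
      exact h.route_mixed hm (x j) (N j - 1) (by have := hN j; omega)
    · simp
    · right; refine ⟨rfl, (hm true false).trans ?_⟩
      apply Nat.mul_le_mul_left
      apply Finset.card_le_card
      intro v hv
      have := mem_K.1 hv
      simp [this]
  · set bs : Finset (Fin k) := Finset.univ.filter (fun j => j ≠ i₀ ∧ ¬ Route A i o G H (x j) (N j - 1)) with hbs
    have hf : ∀ j, ∃ p : Bool × Bool, j ∈ bs → ¬ wo A i H (!p.1) (x j) ∧ ¬ wi A o H (!p.2) (x j) ∧ p.2 = !(hp e (N j - 1) p.1) := by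
      intro j
      rcases h.route_pat he (x j) (N j - 1) (by have := hN j; omega) with hr | ⟨ox, ix, hh⟩
      · refine ⟨(true, true), fun hj => ?_⟩
        simp only [hbs, Finset.mem_filter] at hj
        exact absurd hr hj.2.2
      · exact ⟨(ox, ix), fun _ => hh⟩
    choose p hp' using hf
    obtain ⟨a, c, b, D, hD1, hD2, hT⟩ := h.tasks he x hx N hN i₀ bs (fun j hj => by simp [hbs] at hj; exact hj.1)
      (fun j => (p j).1) (fun j => (p j).2) hp'
    refine h.conf_core x hx N hN i₀ B s hs bs D a c b _ _ _ _ hT ?_ ?_ ?_ ?_ hB ?_ ?_ ?_ FJ hFB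
    · intro j; rfl
    · intro d; cases d
      · simp
      · simp [Finset.erase_subset]
    · intro d; rfl
    · intro d; rfl
    · intro j hj hjb
      by_contra hc
      exact hjb (by simp [hbs, hj, hc])
    · intro j hj F hF hnd hFd
      obtain ⟨q1, q2, q3⟩ := hp' j hj
      obtain ⟨r1, r2, r3, r4, _⟩ := hT.1 (Sum.inl j) (by simp [hj])
      exact h.type2 he B (N j) (hN j) hB (x j) _ _ q1 q2 q3 _ _ _ r1 r2 r3 r4 hnd F hF hFd
    · cases e with
      | false => left; exact ⟨hD1 rfl, fun p => by have := he p; simpa using this⟩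
      | true =>
        right; refine ⟨hD2 rfl, ?_⟩
        have := h.K_big he true
        have e2 : (K i o G true (xor true true)).card ≤ (G.filter (fun v => i v ≠ o v)).card := by
          apply Finset.card_le_card
          intro v hv
          have := mem_K.1 hv
          simp [this]
        omega

end conf2


section flat
variable {V : Type*}

lemma flat_aux {W : Type*} (A : V → V → Prop) (seg : W → List V) (fs ls : W → V)
    (hf : ∀ w, (seg w).head? = some (fs w)) (hl : ∀ w, (seg w).getLast? = some (ls w))
    (hc : ∀ w, (seg w).IsChain A) : ∀ (c : List W) (w : W), (w :: c).IsChain (fun w w' => A (ls w) (fs w')) →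
      ((w :: c).flatMap seg).IsChain A ∧ ((w :: c).flatMap seg).head? = some (fs w) ∧
      ((w :: c).flatMap seg).getLast? = some (ls ((w :: c).getLast (by simp))) := by
  intro c
  induction c with
  | nil => intro w _; simp [hc, hf, hl]
  | cons w' c ih =>
    intro w h
    rw [List.isChain_cons_cons] at h
    obtain ⟨h1, h2, h3⟩ := ih w' h.2
    rw [List.flatMap_cons]
    refine ⟨?_, ?_, ?_⟩
    · rw [List.isChain_append]
      refine ⟨hc w, h1, ?_⟩
      intro x hx y hy
      rw [hl] at hx; rw [h2] at hy
      simp at hx hy; subst hx; subst hy; exact h.1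
    · rw [List.head?_append, hf]; rfl
    · rw [List.getLast?_append, h3]; rfl

lemma flatten_ham [Fintype V] {W : Type*} [Fintype W] (A : V → V → Prop) (seg : W → List V) (fs ls : W → V)
    (hf : ∀ w, (seg w).head? = some (fs w)) (hl : ∀ w, (seg w).getLast? = some (ls w))
    (hc : ∀ w, (seg w).IsChain A) (hn : ∀ w, (seg w).Nodup) (hd : ∀ w w', w ≠ w' → ∀ v ∈ seg w, v ∉ seg w')
    (U : Finset V) (hU : ∀ v, v ∈ U ↔ ∃ w, v ∈ seg w) (hR : HamOn (fun w w' => A (ls w) (fs w')) (Finset.univ : Finset W)) :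
    HamOn A U := by
  obtain ⟨c, ⟨h1, h2, h3, h4⟩, h5⟩ := hR
  have h3' : List.IsChain (fun w w' => A (ls w) (fs w')) c := h3
  have hm : ∀ w, w ∈ c := fun w => by
    have : w ∈ c.toFinset := by rw [h5]; simp
    simpa using this
  obtain ⟨w, c', rfl⟩ := List.exists_cons_of_ne_nil h1
  obtain ⟨g1, g2, g3⟩ := flat_aux A seg fs ls hf hl hc c' w h3'
  refine ⟨(w :: c').flatMap seg, ⟨?_, ?_, g1, ?_⟩, ?_⟩
  · intro hh; rw [hh] at g2; simp at g2
  · rw [List.nodup_flatMap]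
    refine ⟨fun w _ => hn w, ?_⟩
    refine List.Pairwise.imp ?_ h2
    intro a b hab
    show List.Disjoint (seg a) (seg b)
    intro v hv hv'
    exact hd a b hab v hv hv'
  · intro hh
    have e1 : ((w :: c').flatMap seg).head hh = fs w := by
      rw [List.head?_eq_some_head hh] at g2; simpa using g2
    have e2 : ((w :: c').flatMap seg).getLast hh = ls ((w :: c').getLast (by simp)) := by
      rw [List.getLast?_eq_some_getLast hh] at g3; simpa using g3
    rw [e1, e2]
    exact h4 (by simp)
  · ext v
    rw [hU, List.mem_toFinset, List.mem_flatMap]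
    constructor
    · rintro ⟨a, _, ha⟩; exact ⟨a, ha⟩
    · rintro ⟨a, ha⟩; exact ⟨a, hm a, ha⟩
end flat


section pieces
variable {V : Type*} [Fintype V]

lemma Base.pieces_ham {A : V → V → Prop} {i o : V → Bool} {G : Finset V} {E H k : ℕ} (h : Base A i o G E H k)
    {W : Type*} [Fintype W] (fs ls : W → V) (iw ow : W → Bool) (Gd : Finset W) (G0 : Finset V) (M : ℕ)
    (hinj : Function.Injective fs) (hg : ∀ w ∈ Gd, ls w = fs w ∧ fs w ∈ G ∧ i (fs w) = iw w ∧ o (fs w) = ow w)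
    (hG0 : ∀ v ∈ G0, ∃ w ∈ Gd, fs w = v)
    (hM : G0ᶜ.card ≤ M) (hM' : Gdᶜ.card ≤ M) (MH : 100 * M ≤ H) (EM : E ≤ M)
    (hwi : ∀ w, wi A o H (iw w) (fs w)) (hwo : ∀ w, wo A i H (ow w) (ls w))
    (hbal : ∑ w, rho true (iw w) (ow w) = 0)
    (conn : ((∀ p, 4 * (K i o G p (!p)).card ≤ H) ∧ ∃ w, w ∉ Gd ∧ iw w ≠ ow w) ∨ H ≤ 8 * (G.filter (fun v => i v ≠ o v)).card) :
    HamOn (fun w w' => A (ls w) (fs w')) (Finset.univ : Finset W) := by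
  have hE100 := h.E100
  have hHn := h.Hn
  have cnt : ∀ T : Finset V, T.card ≤ (Gd.filter (fun w => fs w ∈ T)).card + M := by
    intro T
    have h1 : T ∩ G0 ⊆ (Gd.filter (fun w => fs w ∈ T)).image fs := by
      intro v hv
      obtain ⟨hv1, hv2⟩ := Finset.mem_inter.1 hv
      obtain ⟨w, hw, rfl⟩ := hG0 v hv2
      exact Finset.mem_image.2 ⟨w, by simp [hw, hv1], rfl⟩
    have h2 := (Finset.card_le_card h1).trans Finset.card_image_le
    have h3 : T ⊆ (T ∩ G0) ∪ G0ᶜ := by intro v; simp; tauto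
    have h4 := (Finset.card_le_card h3).trans (Finset.card_union_le _ _)
    omega
  have key : ∀ G' : Finset W, G' ⊆ Gd → (∀ T : Finset V, H ≤ T.card → 2 * M ≤ (G'.filter (fun w => fs w ∈ T)).card) →
      (2 * Gdᶜ.card < (Gd.filter (fun w => iw w ≠ ow w)).card ∨
      ((∃ w, w ∉ Gd ∧ iw w ≠ ow w) ∧ ∀ v ∈ G', iw v = ow v)) →
      HamOn (fun w w' => A (ls w) (fs w')) (Finset.univ : Finset W) := by
    intro G' hG' hT hcon
    refine ham_rooms (fun w w' => A (ls w) (fs w')) iw ow Gd G' E hG' ?_ ?_ ?_ ?_ ?_ ?_ hcon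
    · intro u hu
      obtain ⟨a1, a2, a3, a4⟩ := hg u hu
      refine le_trans ?_ (h.g2 (fs u) a2)
      apply Finset.card_le_card_of_injOn fs
      · intro v hv
        simp only [Finset.coe_filter, Set.mem_setOf_eq] at hv
        obtain ⟨b1, b2, b3, b4⟩ := hg v hv.1
        simp only [Finset.coe_sdiff, Set.mem_diff, Finset.mem_coe, room, Finset.mem_filter, Finset.mem_univ, true_and, mem_outN]
        rw [b3, a4, ← a1]
        exact hv.2
      · exact hinj.injOn
    · intro u hu
      obtain ⟨a1, a2, a3, a4⟩ := hg u hu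
      refine le_trans ?_ (h.g3 (fs u) a2)
      apply Finset.card_le_card_of_injOn fs
      · intro v hv
        simp only [Finset.coe_filter, Set.mem_setOf_eq] at hv
        obtain ⟨b1, b2, b3, b4⟩ := hg v hv.1
        simp only [Finset.coe_sdiff, Set.mem_diff, Finset.mem_coe, room, Finset.mem_filter, Finset.mem_univ, true_and, mem_inN]
        rw [b4, a3, ← b1]
        exact hv.2
      · exact hinj.injOn
    · unfold rho at hbal
      rw [Finset.sum_sub_distrib, Finset.sum_boole, Finset.sum_boole] at hbal
      have : (((Finset.univ.filter (fun w => iw w = true)).card : ℕ) : ℤ) = (Finset.univ.filter (fun w => ow w = true)).card := by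
        linarith
      exact_mod_cast this
    · intro w _
      have := hT _ (hwo w)
      refine (Nat.mul_le_mul_left 2 hM').trans (this.trans ?_)
      apply Finset.card_le_card
      intro v hv
      simp only [Finset.mem_filter, Finset.mem_inter, room, Finset.mem_univ, true_and, mem_outN] at hv ⊢
      obtain ⟨b1, b2, b3, b4⟩ := hg v (hG' hv.1)
      exact ⟨hv.1, by rw [← b3]; exact hv.2.1, hv.2.2⟩
    · intro w _
      have := hT _ (hwi w)
      refine (Nat.mul_le_mul_left 2 hM').trans (this.trans ?_)
      apply Finset.card_le_card
      intro v hv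
      simp only [Finset.mem_filter, Finset.mem_inter, room, Finset.mem_univ, true_and, mem_inN] at hv ⊢
      obtain ⟨b1, b2, b3, b4⟩ := hg v (hG' hv.1)
      exact ⟨hv.1, by rw [← b4]; exact hv.2.1, by rw [b1]; exact hv.2.2⟩
    · intro r
      have h1 := cnt (room o r)
      have h2 := h.g4o r
      have h3 : (Gd.filter (fun w => fs w ∈ room o r)).card ≤ (Gd.filter (fun u => ow u = r)).card := by
        apply Finset.card_le_card
        intro v hv
        simp only [Finset.mem_filter, room, Finset.mem_univ, true_and] at hv ⊢
        obtain ⟨b1, b2, b3, b4⟩ := hg v hv.1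
        exact ⟨hv.1, by rw [← b4]; exact hv.2⟩
      omega
  rcases conn with ⟨c1, c2⟩ | c
  · refine key (Gd.filter (fun w => iw w = ow w)) (Finset.filter_subset _ _) ?_ ?_
    · intro T hT
      set T' := T \ (K i o G true false ∪ K i o G false true) with hT'
      have h1 := cnt (T' ∩ G)
      have h2 : ((Gd.filter (fun w => fs w ∈ T' ∩ G)).card) ≤ ((Gd.filter (fun w => iw w = ow w)).filter (fun w => fs w ∈ T)).card := by
        apply Finset.card_le_card
        intro v hv
        simp only [Finset.mem_filter, Finset.mem_inter, hT', Finset.mem_sdiff, Finset.mem_union, mem_K] at hv ⊢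
        obtain ⟨b1, b2, b3, b4⟩ := hg v hv.1
        refine ⟨⟨hv.1, ?_⟩, hv.2.1.1⟩
        have := hv.2.1.2
        rw [b3, b4] at this
        revert this; cases iw v <;> cases ow v <;> simp [b2]
      have h3 : T ⊆ (T' ∩ G) ∪ Gᶜ ∪ (K i o G true false ∪ K i o G false true) := by
        intro v hv
        simp only [hT', Finset.mem_union, Finset.mem_inter, Finset.mem_sdiff, Finset.mem_compl]
        tauto
      have h4 := Finset.card_le_card h3
      have h5 := Finset.card_union_le ((T' ∩ G) ∪ Gᶜ) (K i o G true false ∪ K i o G false true)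
      have h6 := Finset.card_union_le (T' ∩ G) Gᶜ
      have h7 := Finset.card_union_le (K i o G true false) (K i o G false true)
      have h8 := c1 true; have h9 := c1 false
      simp only [Bool.not_true, Bool.not_false] at h8 h9
      have := h.g1
      omega
    · right; exact ⟨c2, fun v hv => (Finset.mem_filter.1 hv).2⟩
  · refine key Gd (le_refl _) ?_ ?_
    · intro T hT
      have := cnt T
      omega
    · left
      have h1 := cnt (G.filter (fun v => i v ≠ o v))
      have h2 : (Gd.filter (fun w => fs w ∈ G.filter (fun v => i v ≠ o v))).card ≤ (Gd.filter (fun w => iw w ≠ ow w)).card := by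
        apply Finset.card_le_card
        intro v hv
        simp only [Finset.mem_filter] at hv ⊢
        obtain ⟨b1, b2, b3, b4⟩ := hg v hv.1
        refine ⟨hv.1, ?_⟩
        rw [← b3, ← b4]; exact hv.2.2
      omega
end pieces


section bigf
variable {V : Type*} [Fintype V]

lemma rho_contract (b i1 o2 : Bool) : rho b i1 b + rho b (!b) o2 = rho b i1 o2 + 1 := by
  cases b <;> cases i1 <;> cases o2 <;> rfl

lemma rho_true_of (b : Bool) {ι : Type*} (s : Finset ι) (f g : ι → Bool) (h : ∑ w ∈ s, rho b (f w) (g w) = 0) :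
    ∑ w ∈ s, rho true (f w) (g w) = 0 := by
  cases b
  · have : ∀ w, rho true (f w) (g w) = - rho false (f w) (g w) := fun w => rho_not false _ _
    simp only [this, Finset.sum_neg_distrib, h, neg_zero]
  · exact h

lemma sum_pairs (J : Finset (V × V)) (hJ : PDisj J) (hne : ∀ p ∈ J, p.1 ≠ p.2) (f : V → ℤ) :
    ∑ v ∈ J.image Prod.fst ∪ J.image Prod.snd, f v = ∑ p ∈ J, (f p.1 + f p.2) := by
  rw [Finset.sum_union, Finset.sum_image, Finset.sum_image, Finset.sum_add_distrib]
  · intro p hp q hq e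
    by_contra hpq
    exact (hJ p hp q hq hpq).2.2.2 e
  · intro p hp q hq e
    by_contra hpq
    exact (hJ p hp q hq hpq).1 e
  · rw [Finset.disjoint_left]
    intro v h1 h2
    obtain ⟨p, hp, rfl⟩ := Finset.mem_image.1 h1
    obtain ⟨q, hq, e⟩ := Finset.mem_image.1 h2
    by_cases hpq : p = q
    · subst hpq; exact hne p hp e.symm
    · exact (hJ p hp q hq hpq).2.1 e.symm

theorem Base.big_final {A : V → V → Prop} {i o : V → Bool} {G : Finset V} {E H k : ℕ} (h : Base A i o G E H k)
    (V2 Dv : Finset V) (io oo : V → Bool) (J : Finset (V × V)) (be : Bool)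
    (hwi : ∀ v ∈ V2, wi A o H (io v) v) (hwo : ∀ v ∈ V2, wo A i H (oo v) v)
    (hJ : PDisj J) (hJA : ∀ p ∈ J, A p.1 p.2 ∧ p.1 ∈ V2 ∧ p.2 ∈ V2 ∧ oo p.1 = be ∧ io p.2 = !be)
    (hJc : J.card ≤ 7 * E) (hDv : Dv.card ≤ 7 * E) (hV2 : V2ᶜ.card ≤ 2 * E)
    (hdev : ∀ v ∈ V2, v ∈ G → v ∉ Dv → io v = i v ∧ oo v = o v)
    (hbal : ∑ v ∈ V2, rho be (io v) (oo v) = J.card)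
    (D : Finset Bool) (a c b : Bool → V)
    (tr : ∀ d ∈ D, a d ∈ K i o G d d ∧ b d ∈ K i o G (!d) (!d) ∧ A (a d) (c d) ∧ A (c d) (b d) ∧ a d ≠ b d)
    (trd : ∀ d ∈ D, ∀ d' ∈ D, d ≠ d' → Disjoint (tri (a d) (c d) (b d)) (tri (a d') (c d') (b d')))
    (trV : ∀ d ∈ D, ∀ v ∈ V2, v ∉ tri (a d) (c d) (b d))
    (conn : (D = Finset.univ ∧ ∀ p, 4 * (K i o G p (!p)).card ≤ H) ∨ (D = ∅ ∧ H ≤ 8 * (G.filter (fun v => i v ≠ o v)).card)) :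
    HamOn A (V2 ∪ D.biUnion (fun d => tri (a d) (c d) (b d))) := by
  have hE100 := h.E100
  have hEH := h.EH
  have hne : ∀ p ∈ J, p.1 ≠ p.2 := fun p hp e => h.hirr p.1 (by have := (hJA p hp).1; rwa [← e] at this)
  set VJ : Finset V := J.image Prod.fst ∪ J.image Prod.snd with hVJ
  have mVJ : ∀ v, v ∈ VJ ↔ ∃ p ∈ J, v = p.1 ∨ v = p.2 := by
    intro v; simp only [hVJ, Finset.mem_union, Finset.mem_image]
    constructor
    · rintro (⟨p, hp, e⟩ | ⟨p, hp, e⟩)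
      · exact ⟨p, hp, Or.inl e.symm⟩
      · exact ⟨p, hp, Or.inr e.symm⟩
    · rintro ⟨p, hp, e | e⟩
      · exact Or.inl ⟨p, hp, e.symm⟩
      · exact Or.inr ⟨p, hp, e.symm⟩
  have hVJ2 : VJ ⊆ V2 := by
    intro v hv
    obtain ⟨p, hp, e | e⟩ := (mVJ v).1 hv
    · rw [e]; exact (hJA p hp).2.1
    · rw [e]; exact (hJA p hp).2.2.1
  have hVJc : VJ.card ≤ 14 * E := by
    have h1 : VJ.card ≤ (J.image Prod.fst).card + (J.image Prod.snd).card := Finset.card_union_le _ _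
    have h2 : (J.image Prod.fst).card ≤ J.card := Finset.card_image_le
    have h3 : (J.image Prod.snd).card ≤ J.card := Finset.card_image_le
    omega
  set S : Finset V := V2 \ VJ with hS
  set seg : {v // v ∈ S} ⊕ ({p // p ∈ J} ⊕ {d // d ∈ D}) → List V :=
    Sum.elim (fun v => [v.1]) (Sum.elim (fun p => [p.1.1, p.1.2]) (fun d => [a d.1, c d.1, b d.1])) with hseg
  set fs : {v // v ∈ S} ⊕ ({p // p ∈ J} ⊕ {d // d ∈ D}) → V :=
    Sum.elim (fun v => v.1) (Sum.elim (fun p => p.1.1) (fun d => a d.1)) with hfs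
  set ls : {v // v ∈ S} ⊕ ({p // p ∈ J} ⊕ {d // d ∈ D}) → V :=
    Sum.elim (fun v => v.1) (Sum.elim (fun p => p.1.2) (fun d => b d.1)) with hls
  set iw : {v // v ∈ S} ⊕ ({p // p ∈ J} ⊕ {d // d ∈ D}) → Bool :=
    Sum.elim (fun v => io v.1) (Sum.elim (fun p => io p.1.1) (fun d => d.1)) with hiw
  set ow : {v // v ∈ S} ⊕ ({p // p ∈ J} ⊕ {d // d ∈ D}) → Bool :=
    Sum.elim (fun v => oo v.1) (Sum.elim (fun p => oo p.1.2) (fun d => !d.1)) with how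
  have hf : ∀ w, (seg w).head? = some (fs w) := by rintro (w | w | w) <;> simp [hseg, hfs]
  have hl : ∀ w, (seg w).getLast? = some (ls w) := by rintro (w | w | w) <;> simp [hseg, hls]
  have hsegJ : ∀ (p : {p // p ∈ J}) v, v ∈ seg (Sum.inr (Sum.inl p)) → v ∈ VJ := by
    intro p v hv
    rw [mVJ]; refine ⟨p.1, p.2, ?_⟩
    simpa [hseg] using hv
  have hsegD : ∀ (d : {d // d ∈ D}) v, v ∈ seg (Sum.inr (Sum.inr d)) → v ∈ tri (a d) (c d) (b d) := by
    intro d v hv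
    rw [mem_tri]
    simpa [hseg] using hv
  have hsegS : ∀ (w : {v // v ∈ S}) v, v ∈ seg (Sum.inl w) → v ∈ S ∧ v = w := by
    intro w v hv
    have : v = w := by simpa [hseg] using hv
    exact ⟨this ▸ w.2, this⟩
  have hSV : ∀ v ∈ S, v ∈ V2 ∧ v ∉ VJ := fun v hv => by simpa [hS] using hv
  have hd : ∀ w w', w ≠ w' → ∀ v ∈ seg w, v ∉ seg w' := by
    rintro (w | w | w) (w' | w' | w') hww v hv hv'
    · exact hww (congrArg Sum.inl (Subtype.ext ((hsegS w v hv).2.symm.trans (hsegS w' v hv').2)))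
    · exact (hSV v (hsegS w v hv).1).2 (hsegJ w' v hv')
    · exact trV w'.1 w'.2 v (hSV v (hsegS w v hv).1).1 (hsegD w' v hv')
    · exact (hSV v (hsegS w' v hv').1).2 (hsegJ w v hv)
    · have hne' : w.1 ≠ w'.1 := fun e => hww (congrArg (Sum.inr ∘ Sum.inl) (Subtype.ext e))
      obtain ⟨q1, q2, q3, q4⟩ := hJ w.1 w.2 w'.1 w'.2 hne'
      have e1 : v = w.1.1 ∨ v = w.1.2 := by simpa [hseg] using hv
      have e2 : v = w'.1.1 ∨ v = w'.1.2 := by simpa [hseg] using hv'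
      rcases e1 with e1 | e1 <;> rcases e2 with e2 | e2
      · exact q1 (e1.symm.trans e2)
      · exact q2 (e1.symm.trans e2)
      · exact q3 (e1.symm.trans e2)
      · exact q4 (e1.symm.trans e2)
    · exact trV w'.1 w'.2 v (hVJ2 (hsegJ w v hv)) (hsegD w' v hv')
    · exact trV w.1 w.2 v (hSV v (hsegS w' v hv').1).1 (hsegD w v hv)
    · exact trV w.1 w.2 v (hVJ2 (hsegJ w' v hv')) (hsegD w v hv)
    · have hne' : w.1 ≠ w'.1 := fun e => hww (congrArg (Sum.inr ∘ Sum.inr) (Subtype.ext e))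
      exact Finset.disjoint_left.1 (trd w.1 w.2 w'.1 w'.2 hne') (hsegD w v hv) (hsegD w' v hv')
  have hfm : ∀ w, fs w ∈ seg w := fun w => List.mem_of_mem_head? (by rw [hf]; rfl)
  have hinj : Function.Injective fs := by
    intro w w' e
    by_contra hww
    exact hd w w' hww (fs w) (hfm w) (e ▸ hfm w')
  have hwiV : ∀ w, wi A o H (iw w) (fs w) := by
    rintro (w | w | w)
    · exact hwi _ (hSV _ w.2).1
    · exact hwi _ (hJA w.1 w.2).2.1
    · have h1 := mem_K.1 (tr w.1 w.2).1
      have := h.good_wi h1.1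
      rw [h1.2.1] at this; exact this
  have hwoV : ∀ w, wo A i H (ow w) (ls w) := by
    rintro (w | w | w)
    · exact hwo _ (hSV _ w.2).1
    · exact hwo _ (hJA w.1 w.2).2.2.1
    · have h1 := mem_K.1 (tr w.1 w.2).2.1
      have := h.good_wo h1.1
      rw [h1.2.2] at this; exact this
  have hDcase : D = Finset.univ ∨ D = ∅ := conn.imp (fun h => h.1) (fun h => h.1)
  have hDsum : ∑ d ∈ D, rho be d (!d) = 0 := by
    rcases hDcase with e | e
    · rw [e]; cases be <;> rfl
    · rw [e]; rfl
  have hbalW : ∑ w, rho be (iw w) (ow w) = 0 := by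
    rw [Fintype.sum_sum_type, Fintype.sum_sum_type]
    simp only [hiw, how, Sum.elim_inl, Sum.elim_inr]
    have e1 : ∑ v : {v // v ∈ S}, rho be (io v.1) (oo v.1) = ∑ v ∈ S, rho be (io v) (oo v) :=
      Finset.sum_coe_sort S (fun v => rho be (io v) (oo v))
    have e2 : ∑ p : {p // p ∈ J}, rho be (io p.1.1) (oo p.1.2) = ∑ p ∈ J, rho be (io p.1) (oo p.2) :=
      Finset.sum_coe_sort J (fun p => rho be (io p.1) (oo p.2))
    have e3 : ∑ d : {d // d ∈ D}, rho be d.1 (!d.1) = ∑ d ∈ D, rho be d (!d) :=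
      Finset.sum_coe_sort D (fun d => rho be d (!d))
    rw [e1, e2, e3, hDsum]
    have e4 := Finset.sum_sdiff hVJ2 (f := fun v => rho be (io v) (oo v))
    have e5 := sum_pairs J hJ hne (fun v => rho be (io v) (oo v))
    have e6 : ∑ p ∈ J, (rho be (io p.1) (oo p.1) + rho be (io p.2) (oo p.2)) = ∑ p ∈ J, (rho be (io p.1) (oo p.2)) + J.card := by
      have e7 : ∑ p ∈ J, (rho be (io p.1) (oo p.2) + 1) = ∑ p ∈ J, (rho be (io p.1) (oo p.2)) + J.card := by
        rw [Finset.sum_add_distrib, Finset.sum_const, nsmul_eq_mul, mul_one]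
      rw [← e7]
      refine Finset.sum_congr rfl fun p hp => ?_
      obtain ⟨_, _, _, q1, q2⟩ := hJA p hp
      rw [q1, q2]; exact rho_contract _ _ _
    simp only [← hVJ] at e5
    simp only [← hS] at e4
    linarith
  set G0 : Finset V := ((G ∩ V2) \ Dv) \ VJ with hG0
  have mG0 : ∀ v, v ∈ G0 ↔ (v ∈ G ∧ v ∈ V2) ∧ v ∉ Dv ∧ v ∉ VJ := by
    intro v; simp only [hG0, Finset.mem_sdiff, Finset.mem_inter]; tauto
  set Gd : Finset ({v // v ∈ S} ⊕ ({p // p ∈ J} ⊕ {d // d ∈ D})) := Finset.univ.filter (fun w => fs w ∈ G0) with hGd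
  have mGd : ∀ w, w ∈ Gd ↔ fs w ∈ G0 := by intro w; simp [hGd]
  have hG0c : G0ᶜ.card ≤ 24 * E := by
    have e : G0ᶜ ⊆ (Gᶜ ∪ V2ᶜ) ∪ (Dv ∪ VJ) := by
      intro v; simp only [Finset.mem_compl, mG0, Finset.mem_union]; tauto
    have h0 := Finset.card_le_card e
    have h1 : ((Gᶜ ∪ V2ᶜ) ∪ (Dv ∪ VJ)).card ≤ (Gᶜ ∪ V2ᶜ).card + (Dv ∪ VJ).card := Finset.card_union_le _ _
    have h2 : (Gᶜ ∪ V2ᶜ).card ≤ Gᶜ.card + V2ᶜ.card := Finset.card_union_le _ _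
    have h3 : (Dv ∪ VJ).card ≤ Dv.card + VJ.card := Finset.card_union_le _ _
    have := h.g1
    omega
  have hGdc : Gdᶜ.card ≤ 24 * E := by
    refine le_trans ?_ hG0c
    rw [← Finset.card_image_of_injective Gdᶜ hinj]
    apply Finset.card_le_card
    intro v hv
    obtain ⟨w, hw, rfl⟩ := Finset.mem_image.1 hv
    rw [Finset.mem_compl, mGd] at hw
    simpa using hw
  have hGdS : ∀ w ∈ Gd, ∃ v, w = Sum.inl v := by
    rintro (w | w | w) hw
    · exact ⟨w, rfl⟩
    · rw [mGd, mG0] at hw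
      exact absurd (hsegJ w _ (hfm _)) hw.2.2
    · rw [mGd, mG0] at hw
      exact absurd (hsegD w _ (hfm _)) (trV w.1 w.2 _ hw.1.2)
  have hham : HamOn (fun w w' => A (ls w) (fs w')) (Finset.univ : Finset ({v // v ∈ S} ⊕ ({p // p ∈ J} ⊕ {d // d ∈ D}))) := by
    refine h.pieces_ham fs ls iw ow Gd G0 (24 * E) hinj ?_ ?_ hG0c (by convert hGdc) ?_ (by omega) hwiV hwoV (rho_true_of be _ _ _ hbalW) ?_
    · intro w hw
      obtain ⟨v, rfl⟩ := hGdS w hw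
      have h1 := (mG0 _).1 ((mGd _).1 hw)
      have h2 := hdev _ h1.1.2 h1.1.1 h1.2.1
      exact ⟨rfl, h1.1.1, h2.1.symm, h2.2.symm⟩
    · intro v hv
      have h1 := (mG0 v).1 hv
      have hvS : v ∈ S := by rw [hS, Finset.mem_sdiff]; exact ⟨h1.1.2, h1.2.2⟩
      exact ⟨Sum.inl ⟨v, hvS⟩, (mGd _).2 hv, rfl⟩
    · have := h.kH; have := h.hk; nlinarith
    · rcases conn with ⟨e, hp⟩ | ⟨e, hp⟩
      · left
        refine ⟨hp, Sum.inr (Sum.inr ⟨true, by simp [e]⟩), ?_, ?_⟩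
        · intro hw; obtain ⟨v, hv⟩ := hGdS _ hw; cases hv
        · simp [hiw, how]
      · right; exact hp
  refine flatten_ham A seg fs ls hf hl ?_ ?_ hd _ ?_ hham
  · rintro (w | w | w)
    · simp [hseg]
    · simpa [hseg] using (hJA w.1 w.2).1
    · have := tr w.1 w.2
      simp [hseg, this.2.2.1, this.2.2.2.1]
  · rintro (w | w | w)
    · simp [hseg]
    · simpa [hseg] using hne w.1 w.2
    · have h1 := tr w.1 w.2
      have h2 : a w.1 ≠ c w.1 := fun e => h.hirr (a w.1) (by have := h1.2.2.1; rwa [← e] at this)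
      have h3 : c w.1 ≠ b w.1 := fun e => h.hirr (c w.1) (by have := h1.2.2.2.1; rwa [← e] at this)
      simp [hseg, h2, h3, h1.2.2.2.2]
  · intro v
    rw [Finset.mem_union, Finset.mem_biUnion]
    constructor
    · rintro (hv | ⟨d, hd, hv⟩)
      · by_cases hvJ : v ∈ VJ
        · obtain ⟨p, hp, e⟩ := (mVJ v).1 hvJ
          exact ⟨Sum.inr (Sum.inl ⟨p, hp⟩), by simpa [hseg] using e⟩
        · exact ⟨Sum.inl ⟨v, by rw [hS, Finset.mem_sdiff]; exact ⟨hv, hvJ⟩⟩, by simp [hseg]⟩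
      · rw [mem_tri] at hv
        exact ⟨Sum.inr (Sum.inr ⟨d, hd⟩), by simpa [hseg] using hv⟩
    · rintro ⟨w | w | w, hw⟩
      · exact Or.inl (hSV v (hsegS w v hw).1).1
      · exact Or.inl (hVJ2 (hsegJ w v hw))
      · exact Or.inr ⟨w.1, w.2, hsegD w v hw⟩
end bigf


section bal
variable {V : Type*} [Fintype V]

lemma int_between {ι : Type*} (S : Finset ι) (g f : ι → ℤ) (hgf : ∀ v ∈ S, g v ≤ f v) :
    ∀ (m : ℕ) (t : ℤ), ∑ v ∈ S, g v ≤ t → ∑ v ∈ S, f v - t = m →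
      ∃ q : ι → ℤ, (∀ v ∈ S, g v ≤ q v ∧ q v ≤ f v) ∧ ∑ v ∈ S, q v = t ∧ (S.filter (fun v => q v ≠ f v)).card ≤ m := by
  intro m
  induction m with
  | zero =>
    intro t h1 h2
    refine ⟨f, fun v hv => ⟨hgf v hv, le_refl _⟩, ?_, ?_⟩
    · push_cast at h2; omega
    · simp
  | succ m ih =>
    intro t h1 h2
    obtain ⟨q, q1, q2, q3⟩ := ih (t + 1) (by omega) (by push_cast at h2; omega)
    have hex : ∃ v ∈ S, g v < q v := by
      by_contra hc
      push Not at hc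
      have := Finset.sum_le_sum hc
      omega
    obtain ⟨u, hu, hgu⟩ := hex
    refine ⟨fun v => if v = u then q v - 1 else q v, ?_, ?_, ?_⟩
    · intro v hv
      have := q1 v hv
      by_cases e : v = u
      · subst e; simp only [if_true]; omega
      · simp only [e, if_false]; exact this
    · have : ∀ v, (if v = u then q v - 1 else q v) = q v - (if v = u then 1 else 0) := by
        intro v; split_ifs <;> simp
      simp only [this]
      rw [Finset.sum_sub_distrib, q2, Finset.sum_ite_eq' S u]
      simp [hu]
    · have : S.filter (fun v => (if v = u then q v - 1 else q v) ≠ f v) ⊆ (S.filter (fun v => q v ≠ f v)) ∪ {u} := by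
        intro v
        simp only [Finset.mem_filter, Finset.mem_union, Finset.mem_singleton]
        rintro ⟨h1, h2⟩
        by_cases e : v = u
        · right; exact e
        · left; simpa [e, h1] using h2
      have h3 := (Finset.card_le_card this).trans (Finset.card_union_le _ _)
      rw [Finset.card_singleton] at h3
      exact h3.trans (by omega)

lemma role_between {A : V → V → Prop} {i o : V → Bool} {H : ℕ} {v : V} {i' o' : Bool}
    (h1 : wi A o H i' v) (h2 : wo A i H o' v) (b : Bool) (t : ℤ) (ht1 : lo A i o H b v ≤ t) (ht2 : t ≤ rho b i' o') :
    ∃ i'' o'', wi A o H i'' v ∧ wo A i H o'' v ∧ rho b i'' o'' = t ∧ (t = rho b i' o' → i'' = i' ∧ o'' = o') := by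
  by_cases e : t = rho b i' o'
  · exact ⟨i', o', h1, h2, e.symm, fun _ => ⟨rfl, rfl⟩⟩
  by_cases p : wo A i H (!b) v <;> by_cases q : wi A o H b v
  · by_cases e0 : t = -1
    · exact ⟨b, !b, q, p, by cases b <;> simp [rho, e0], fun h => absurd h e⟩
    · refine ⟨b, o', q, h2, ?_, fun h => absurd h e⟩
      simp [lo, p, q] at ht1
      have := rho_le b i' o'
      have : o' = b := by
        by_contra hc
        have : rho b i' o' ≤ 0 := by unfold rho; simp [hc]; split_ifs <;> simp
        omega
      subst this
      simp [rho] at *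
      split_ifs at * <;> omega
  all_goals
    have hle := rho_le b i' o'
    simp [lo, p, q] at ht1
  · have hi : i' ≠ b := fun h => q (h ▸ h1)
    refine ⟨i', !b, h1, p, ?_, fun h => absurd h e⟩
    simp [rho, hi] at *
    split_ifs at * <;> omega
  · have hi : o' ≠ !b := fun h => p (h ▸ h2)
    have hi' : o' = b := by cases o' <;> cases b <;> simp_all
    refine ⟨b, o', q, h2, ?_, fun h => absurd h e⟩
    simp [rho, hi'] at *
    split_ifs at * <;> omega
  · omega

lemma pick_arcs (J : Finset (V × V)) (hJ : PDisj J) (Z V2 : Finset V)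
    (hit : ∀ p ∈ J, (p.1 ∉ V2 → p.1 ∈ Z) ∧ (p.2 ∉ V2 → p.2 ∈ Z)) (t : ℕ) (ht : t + Z.card ≤ J.card) :
    ∃ J' ⊆ J, J'.card = t ∧ ∀ p ∈ J', p.1 ∈ V2 ∧ p.2 ∈ V2 := by
  set Jg := J.filter (fun p => p.1 ∈ V2 ∧ p.2 ∈ V2) with hJg
  set Jb := J.filter (fun p => ¬ (p.1 ∈ V2 ∧ p.2 ∈ V2)) with hJb
  have hc : Jg.card + Jb.card = J.card := Finset.card_filter_add_card_filter_not _
  have hb : Jb.card ≤ Z.card := by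
    apply Finset.card_le_card_of_injOn (fun p => if p.1 ∈ V2 then p.2 else p.1)
    · intro p hp
      have hp' := Finset.mem_filter.1 hp
      have := hit p hp'.1
      simp only
      split_ifs with h1
      · apply this.2; intro h2; exact hp'.2 ⟨h1, h2⟩
      · exact this.1 h1
    · intro p hp q hq e
      have hp' := Finset.mem_filter.1 hp
      have hq' := Finset.mem_filter.1 hq
      by_contra hpq
      obtain ⟨q1, q2, q3, q4⟩ := hJ p hp'.1 q hq'.1 hpq
      simp only at e
      split_ifs at e
      · exact q4 e
      · exact q3 e
      · exact q2 e
      · exact q1 e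
  obtain ⟨J', h1, h2⟩ := Finset.exists_subset_card_eq (s := Jg) (n := t) (by omega)
  exact ⟨J', h1.trans (Finset.filter_subset _ _), h2, fun p hp => (Finset.mem_filter.1 (h1 hp)).2⟩
end bal


section caseE
variable {V : Type*} [Fintype V]

lemma Full.arcs {A : V → V → Prop} {i o : V → Bool} {G : Finset V} {E H k Θ : ℕ}
    (h : Full A i o G E H k Θ) (hΘ : 2 * k ≤ Θ) (b : Bool) :
    ∃ J : Finset (V × V), J.card ≤ 50 * (k * E) ∧
      (1 ≤ 2 * k + ∑ v, lo A i o H b v → (J.card : ℤ) = 10 * (k * (2 * k + ∑ v, lo A i o H b v))) ∧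
      (∀ p ∈ J, ¬ wo A i H (!b) p.1 ∧ ¬ wi A o H b p.2 ∧ A p.1 p.2) ∧ PDisj J := by
  by_cases hy : 1 ≤ 2 * k + ∑ v, lo A i o H b v
  · obtain ⟨y, hy'⟩ := Int.eq_ofNat_of_zero_le (a := 2 * k + ∑ v, lo A i o H b v) (by omega)
    obtain ⟨J, j1, j2, j3⟩ := h.J_exists b hΘ y hy'.symm (by omega)
    refine ⟨J, ?_, ?_, j2, j3⟩
    · have h1 := h.lo_univ_le b
      have h2 := h.kE
      have : y ≤ 5 * E := by omega
      rw [j1]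
      have := Nat.mul_le_mul_left k this
      nlinarith
    · intro _; rw [hy', j1]; push_cast; ring
  · exact ⟨∅, by simp, fun h => absurd h hy, by simp, by intro p hp; simp at hp⟩

theorem Full.outcome {k : ℕ} {A : V → V → Prop} {i o : V → Bool} {G : Finset V} {E H Θ : ℕ}
    (h : Full A i o G E H k Θ) (x : Fin k → V) (hx : Function.Injective x) (N : Fin k → ℕ)
    (hN : ∀ j, 4 ≤ N j) (i₀ : Fin k) (s : ℕ) (hs : ∑ j ∈ Finset.univ.erase i₀, N j ≤ s)
    (hΘ : s + 6 + 2 * k ≤ Θ) (hsE : s + 6 ≤ E) : Outcome A x N i₀ := by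
  have hE100 := h.E100
  have hkE := h.kE
  have hk := h.hk
  choose J J1 J2 J3 J4 using fun b => h.arcs (by omega) b
  set FJ : Finset V := (Finset.univ : Finset Bool).biUnion (fun b => (J b).image Prod.fst ∪ (J b).image Prod.snd) with hFJ
  have mFJ : ∀ b, ∀ p ∈ J b, p.1 ∈ FJ ∧ p.2 ∈ FJ := by
    intro b p hp
    constructor
    · exact Finset.mem_biUnion.2 ⟨b, Finset.mem_univ _, Finset.mem_union_left _ (Finset.mem_image_of_mem _ hp)⟩
    · exact Finset.mem_biUnion.2 ⟨b, Finset.mem_univ _, Finset.mem_union_right _ (Finset.mem_image_of_mem _ hp)⟩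
  have hFJc : FJ.card ≤ 200 * (k * E) := by
    have h1 : FJ.card ≤ ∑ b : Bool, ((J b).image Prod.fst ∪ (J b).image Prod.snd).card := Finset.card_biUnion_le
    have h2 : ∀ b, ((J b).image Prod.fst ∪ (J b).image Prod.snd).card ≤ 100 * (k * E) := by
      intro b
      have h1 : ((J b).image Prod.fst ∪ (J b).image Prod.snd).card ≤ ((J b).image Prod.fst).card + ((J b).image Prod.snd).card :=
        Finset.card_union_le _ _
      have h2 : ((J b).image Prod.fst).card ≤ (J b).card := Finset.card_image_le
      have h3 : ((J b).image Prod.snd).card ≤ (J b).card := Finset.card_image_le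
      have := J1 b
      omega
    rw [Fintype.sum_bool] at h1
    have := h2 true; have := h2 false
    omega
  have hkE1 : E ≤ k * E := Nat.le_mul_of_pos_left _ (by omega)
  obtain ⟨l, D, a, c, b, Z, C⟩ := h.conf_exists x hx N hN i₀ (200 * (k * E) + 7 + 4 * k + 2 * s) s hs
    (by have := h.kH; omega) FJ (by omega)
  set Sm : Finset V := (Finset.univ.erase i₀).biUnion (fun j => (l j).toFinset) with hSm
  set T : Finset V := D.biUnion (fun d => tri (a d) (c d) (b d)) with hT
  have mSm : ∀ v, v ∈ Sm ↔ ∃ j, j ≠ i₀ ∧ v ∈ l j := by intro v; simp [hSm]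
  have mT : ∀ v, v ∈ T ↔ ∃ d ∈ D, v ∈ tri (a d) (c d) (b d) := by intro v; simp [hT]
  have hST : Disjoint Sm T := by
    rw [Finset.disjoint_left]
    intro v h1 h2
    obtain ⟨j, hj, hv⟩ := (mSm v).1 h1
    obtain ⟨d, hd, hv'⟩ := (mT v).1 h2
    exact C.trl d hd j hj v hv hv'
  have hSmc : Sm.card ≤ s := by
    refine (Finset.card_biUnion_le).trans (le_trans (Finset.sum_le_sum ?_) hs)
    intro j hj
    rw [← (C.sp j (Finset.ne_of_mem_erase hj)).2.1]
    exact List.toFinset_card_le _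
  have hDc : D.card ≤ 2 := by
    have := Finset.card_le_univ D
    simpa using this
  have hTc : T.card ≤ 6 := by
    have h1 : T.card ≤ ∑ d ∈ D, (tri (a d) (c d) (b d)).card := Finset.card_biUnion_le
    have h2 : ∑ d ∈ D, (tri (a d) (c d) (b d)).card ≤ D.card * 3 := by
      rw [← smul_eq_mul]
      exact Finset.sum_le_card_nsmul _ _ _ (fun d _ => tri_card _ _ _)
    omega
  set V2 : Finset V := (Sm ∪ T)ᶜ with hV2
  have hV2c : V2ᶜ = Sm ∪ T := by rw [hV2, compl_compl]
  have hV2cc : V2ᶜ.card ≤ s + 6 := by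
    rw [hV2c]
    have : (Sm ∪ T).card ≤ Sm.card + T.card := Finset.card_union_le _ _
    omega
  have hrole : ∀ v, ∃ r : Bool × Bool, wi A o H r.1 v ∧ wo A i H r.2 v ∧ (v ∈ G → r.1 = i v ∧ r.2 = o v) := by
    intro v
    by_cases hv : v ∈ G
    · exact ⟨(i v, o v), h.good_wi hv, h.good_wo hv, fun _ => ⟨rfl, rfl⟩⟩
    · obtain ⟨p, hp⟩ : ∃ p, wi A o H p v := (h.wi_or true v).elim (fun h => ⟨_, h⟩) (fun h => ⟨_, h⟩)
      obtain ⟨q, hq⟩ : ∃ p, wo A i H p v := (h.wo_or true v).elim (fun h => ⟨_, h⟩) (fun h => ⟨_, h⟩)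
      exact ⟨(p, q), hp, hq, fun h => absurd h hv⟩
  choose r r1 r2 r3 using hrole
  obtain ⟨be, hbe⟩ : ∃ be, 0 ≤ ∑ v ∈ V2, rho be (r v).1 (r v).2 := by
    by_cases hc : 0 ≤ ∑ v ∈ V2, rho true (r v).1 (r v).2
    · exact ⟨true, hc⟩
    · refine ⟨false, ?_⟩
      have : ∀ v, rho false (r v).1 (r v).2 = - rho true (r v).1 (r v).2 := fun v => rho_not true _ _
      simp only [this, Finset.sum_neg_distrib]
      omega
  have hub : ∑ v ∈ V2, rho be (r v).1 (r v).2 ≤ 5 * E := by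
    have e1 := Finset.sum_add_sum_compl V2 (fun v => rho be (r v).1 (r v).2)
    have e2 : -((s : ℤ) + 6) ≤ ∑ v ∈ V2ᶜ, rho be (r v).1 (r v).2 := by
      have := Finset.card_nsmul_le_sum V2ᶜ (fun v => rho be (r v).1 (r v).2) (-1) (fun v _ => rho_ge _ _ _)
      simp only [nsmul_eq_mul, mul_neg, mul_one] at this
      omega
    have e3 : ∑ v, rho be (r v).1 (r v).2 ≤ ∑ v, (rho be (i v) (o v) + if v ∈ Gᶜ then 2 else 0) := by
      apply Finset.sum_le_sum
      intro v _
      by_cases hv : v ∈ G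
      · rw [(r3 v hv).1, (r3 v hv).2]; simp [hv]
      · have := rho_le be (r v).1 (r v).2
        have := rho_ge be (i v) (o v)
        simp [hv]; omega
    rw [Finset.sum_add_distrib, ← Finset.sum_filter, Finset.sum_const, nsmul_eq_mul] at e3
    have e4 : (Finset.univ.filter (fun v => v ∈ Gᶜ)) = Gᶜ := by ext; simp
    rw [e4] at e3
    have := (h.sum_rho be).1
    have := h.g1
    omega
  have hLr : ∑ v ∈ V2, lo A i o H be v ≤ ∑ v ∈ V2, rho be (r v).1 (r v).2 :=
    Finset.sum_le_sum fun v _ => lo_le_rho (r1 v) (r2 v) be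
  have hVsum := Finset.sum_add_sum_compl V2 (fun v => lo A i o H be v)
  -- arcs
  obtain ⟨t, ht1, ht2, J', hJ'1, hJ'2, hJ'3⟩ : ∃ t : ℕ, ∑ v ∈ V2, lo A i o H be v ≤ t ∧
      (t : ℤ) ≤ ∑ v ∈ V2, rho be (r v).1 (r v).2 ∧
      ∃ J' ⊆ J be, J'.card = t ∧ ∀ p ∈ J', p.1 ∈ V2 ∧ p.2 ∈ V2 := by
    by_cases hL : ∑ v ∈ V2, lo A i o H be v ≤ 0
    · exact ⟨0, by simpa using hL, by simpa using hbe, ∅, by simp, by simp, by simp⟩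
    · obtain ⟨t, ht⟩ := Int.eq_ofNat_of_zero_le (a := ∑ v ∈ V2, lo A i o H be v) (by omega)
      refine ⟨t, le_of_eq ht, by rw [← ht]; exact hLr, ?_⟩
      have hsp : ∀ v ∈ G, lo A i o H be v = rho be (i v) (o v) := by
        rcases h.g5 be with h1 | h1
        · exfalso
          have := Finset.sum_le_card_nsmul V2ᶜ (fun v => lo A i o H be v) 1 (fun v _ => lo_le _)
          have e2 := Finset.card_nsmul_le_sum V2ᶜ (fun v => lo A i o H be v) (-1) (fun v _ => lo_ge _)
          simp only [nsmul_eq_mul, mul_neg, mul_one] at e2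
          omega
        · exact h1
      have sSm : -(2 * ((k : ℤ) - 1)) ≤ ∑ v ∈ Sm, lo A i o H be v := by
        rw [hSm, Finset.sum_biUnion]
        · have e2 := Finset.card_nsmul_le_sum (Finset.univ.erase i₀) (fun j => ∑ v ∈ (l j).toFinset, lo A i o H be v) (-2) (by
            intro j hj
            have h1 := C.sp j (Finset.ne_of_mem_erase hj)
            have h2 := h1.2.2.2 be hsp
            rw [← List.sum_toFinset _ h1.1.2.1] at h2
            exact h2)
          rw [Finset.card_erase_of_mem (Finset.mem_univ _), Finset.card_univ, Fintype.card_fin, nsmul_eq_mul] at e2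
          rw [Nat.cast_sub hk] at e2
          push_cast at e2
          linarith
        · intro j hj j' hj' hjj
          simp only [Function.onFun]
          rw [Finset.disjoint_left]
          intro v hv hv'
          exact C.dis j (Finset.ne_of_mem_erase hj) j' (Finset.ne_of_mem_erase hj') hjj v (by simpa using hv) (by simpa using hv')
      have sT : -2 ≤ ∑ v ∈ T, lo A i o H be v := by
        rw [hT, Finset.sum_biUnion]
        · have e2 := Finset.card_nsmul_le_sum D (fun d => ∑ v ∈ tri (a d) (c d) (b d), lo A i o H be v) (-1) (by
            intro d hd
            obtain ⟨q1, q2, q3, q4, q5⟩ := C.tr d hd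
            have h2 : a d ≠ c d := fun e => h.hirr (a d) (by rwa [← e] at q3)
            have h3 : c d ≠ b d := fun e => h.hirr (c d) (by rwa [← e] at q4)
            rw [mem_K] at q1 q2
            have e : ∑ v ∈ tri (a d) (c d) (b d), lo A i o H be v = lo A i o H be (a d) + (lo A i o H be (c d) + lo A i o H be (b d)) := by
              unfold tri
              rw [Finset.sum_insert, Finset.sum_insert, Finset.sum_singleton]
              · simpa using h3
              · simp [h2, q5]
            show _ ≤ _
            rw [e, hsp _ q1.1, hsp _ q2.1, q1.2.1, q1.2.2, q2.2.1, q2.2.2]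
            have z : ∀ p, rho be p p = 0 := fun p => by unfold rho; simp
            rw [z, z]
            have := lo_ge (A := A) (i := i) (o := o) (H := H) (v := c d) be
            omega)
          simp only [nsmul_eq_mul, mul_neg, mul_one] at e2
          omega
        · intro d hd d' hd' hdd
          exact C.trd d hd d' hd' hdd
      have hsum : ∑ v ∈ V2ᶜ, lo A i o H be v = ∑ v ∈ Sm, lo A i o H be v + ∑ v ∈ T, lo A i o H be v := by
        rw [hV2c, Finset.sum_union hST]
      have hy : (t : ℤ) ≤ 2 * k + ∑ v, lo A i o H be v := by omega
      have hJc := J2 be (by omega)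
      refine pick_arcs (J be) (J4 be) Z V2 ?_ t ?_
      · intro p hp
        have hin : ∀ v ∈ FJ, v ∉ V2 → v ∈ Z := by
          intro v hv hv2
          have : v ∈ Sm ∪ T := by rw [← hV2c]; simpa using hv2
          apply C.hit v hv
          rcases Finset.mem_union.1 this with h1 | h1
          · exact Or.inl ((mSm v).1 h1)
          · exact Or.inr ((mT v).1 h1)
        exact ⟨hin _ (mFJ be p hp).1, hin _ (mFJ be p hp).2⟩
      · have := C.Zc
        set y := 2 * (k : ℤ) + ∑ v, lo A i o H be v with hyy
        have h1 : (1 : ℤ) ≤ y := by omega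
        have h2 : (1 : ℤ) ≤ k := by exact_mod_cast hk
        have h3 : y ≤ k * y := by nlinarith
        have h4 : (k : ℤ) ≤ k * y := by nlinarith
        omega
  obtain ⟨m, hm⟩ := Int.eq_ofNat_of_zero_le (a := ∑ v ∈ V2, rho be (r v).1 (r v).2 - t) (by omega)
  obtain ⟨q, q1, q2, q3⟩ := int_between V2 (fun v => lo A i o H be v) (fun v => rho be (r v).1 (r v).2)
    (fun v _ => lo_le_rho (r1 v) (r2 v) be) m t ht1 hm
  have hnew : ∀ v, ∃ r' : Bool × Bool, v ∈ V2 → (wi A o H r'.1 v ∧ wo A i H r'.2 v ∧ rho be r'.1 r'.2 = q v ∧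
      (q v = rho be (r v).1 (r v).2 → r'.1 = (r v).1 ∧ r'.2 = (r v).2)) := by
    intro v
    by_cases hv : v ∈ V2
    · obtain ⟨a1, a2, h1⟩ := role_between (r1 v) (r2 v) be (q v) (q1 v hv).1 (q1 v hv).2
      exact ⟨(a1, a2), fun _ => h1⟩
    · exact ⟨r v, fun h => absurd h hv⟩
  choose r' hr' using hnew
  have hJm : ∀ p ∈ J', p ∈ J be := fun p hp => hJ'1 hp
  have hfin := h.big_final V2 (V2.filter (fun v => q v ≠ rho be (r v).1 (r v).2)) (fun v => (r' v).1) (fun v => (r' v).2) J' be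
    (fun v hv => (hr' v hv).1) (fun v hv => (hr' v hv).2.1)
    (fun p hp p' hp' => J4 be p (hJm p hp) p' (hJm p' hp'))
    (by
      intro p hp
      obtain ⟨j1, j2, j3⟩ := J3 be p (hJm p hp)
      obtain ⟨u1, u2⟩ := hJ'3 p hp
      refine ⟨j3, u1, u2, ?_, ?_⟩
      · have := (hr' _ u1).2.1
        show (r' p.1).2 = be
        by_contra hc
        have e : (r' p.1).2 = !be := by revert hc; cases (r' p.1).2 <;> cases be <;> simp
        rw [e] at this; exact j1 this
      · have := (hr' _ u2).1
        show (r' p.2).1 = !be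
        by_contra hc
        have e : (r' p.2).1 = be := by revert hc; cases (r' p.2).1 <;> cases be <;> simp
        rw [e] at this; exact j2 this)
    (by omega) (by omega) (by omega)
    (by
      intro v hv hvG hvD
      have h1 : q v = rho be (r v).1 (r v).2 := by
        by_contra hc; exact hvD (Finset.mem_filter.2 ⟨hv, hc⟩)
      have h2 := (hr' v hv).2.2.2 h1
      have h3 := r3 v hvG
      exact ⟨h2.1.trans h3.1, h2.2.trans h3.2⟩)
    (by
      rw [hJ'2, ← q2]
      exact Finset.sum_congr rfl fun v hv => (hr' v hv).2.2.1)
    D a c b C.tr C.trd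
    (by
      intro d hd v hv hvt
      rw [hV2, Finset.mem_compl, Finset.mem_union, not_or] at hv
      exact hv.2 ((mT v).2 ⟨d, hd, hvt⟩))
    C.conn
  refine ⟨l, ?_, ?_, ?_⟩
  · intro j hj
    have h1 := C.sp j hj
    refine ⟨h1.1, h1.2.1, h1.2.2.1 _ (by simp), ?_⟩
    intro j' hj'
    by_cases e : j' = i₀
    · rw [e]; exact C.x0 j hj
    · exact C.dis j' e j hj hj' _ ((C.sp j' e).2.2.1 _ (by simp))
  · intro j j' hj hj' hjj
    exact C.dis j hj j' hj' hjj
  · convert hfin using 1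
    rw [← hT]
    ext v
    have : v ∈ T → v ∉ Sm := fun h1 h2 => Finset.disjoint_left.1 hST h2 h1
    simp only [Finset.mem_sdiff, Finset.mem_univ, true_and, Finset.mem_union, hV2, Finset.mem_compl]
    constructor
    · intro hv
      by_cases hvT : v ∈ T
      · exact Or.inr hvT
      · left; rintro (h1 | h1)
        · exact hv (by convert h1)
        · exact hvT h1
    · rintro (hv | hv) h1
      · exact hv (Or.inl (by convert h1))
      · exact this hv (by convert h1)
end caseE


section final
variable {V : Type*} [Fintype V]

lemma outcome_final {k : ℕ} {A : V → V → Prop} {x : Fin k → V} {N : Fin k → ℕ} {i₀ : Fin k}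
    (hx : Function.Injective x) (hsum : ∑ i, N i = Fintype.card V) (h : Outcome A x N i₀) :
    ∃ c : Fin k → List V,
      (∀ i, IsDicycleList A (c i)) ∧
      (∀ i, (c i).length = N i) ∧
      (∀ i j, i ≠ j → ∀ v ∈ c i, v ∉ c j) ∧
      (∀ i j, x j ∈ c i ↔ j = i) := by
  obtain ⟨c, h1, h2, d, hd, hdU⟩ := h
  have md : ∀ v, v ∈ d ↔ ∀ j, j ≠ i₀ → v ∉ c j := by
    intro v
    rw [← List.mem_toFinset, hdU]
    simp
  have hlen : d.length = N i₀ := by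
    rw [← List.toFinset_card_of_nodup hd.2.1, hdU, ← Finset.compl_eq_univ_sdiff, Finset.card_compl, Finset.card_biUnion]
    · have e : ∑ j ∈ Finset.univ.erase i₀, (c j).toFinset.card = ∑ j ∈ Finset.univ.erase i₀, N j := by
        refine Finset.sum_congr rfl fun j hj => ?_
        have := h1 j (Finset.ne_of_mem_erase hj)
        rw [List.toFinset_card_of_nodup this.1.2.1, this.2.1]
      have e2 := Finset.add_sum_erase Finset.univ N (Finset.mem_univ i₀)
      have e3 : ∑ j ∈ Finset.univ.erase i₀, (c j).toFinset.card = ∑ j ∈ Finset.univ.erase i₀, N j := by convert e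
      omega
    · intro j hj j' hj' hjj
      simp only [Function.onFun]
      rw [Finset.disjoint_left]
      intro v hv hv'
      exact h2 j j' (Finset.ne_of_mem_erase hj) (Finset.ne_of_mem_erase hj') hjj v (by simpa using hv) (by simpa using hv')
  refine ⟨fun j => if j = i₀ then d else c j, ?_, ?_, ?_, ?_⟩
  · intro j
    by_cases e : j = i₀
    · simpa [e] using hd
    · simpa [e] using (h1 j e).1
  · intro j
    by_cases e : j = i₀
    · simpa [e] using hlen
    · simpa [e] using (h1 j e).2.1
  · intro j j' hjj v hv hv'
    by_cases e : j = i₀ <;> by_cases e' : j' = i₀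
    · exact hjj (e.trans e'.symm)
    · simp only [e, e', if_true, if_false] at hv hv'
      exact (md v).1 hv j' e' hv'
    · simp only [e, e', if_true, if_false] at hv hv'
      exact (md v).1 hv' j e hv
    · simp only [e, e', if_false] at hv hv'
      exact h2 j j' e e' hjj v hv hv'
  · intro j j'
    by_cases e : j = i₀
    · simp only [e, if_true, md]
      constructor
      · intro h; by_contra hc
        exact h j' hc (h1 j' hc).2.2.1
      · rintro rfl j hj
        exact (h1 j hj).2.2.2 _ (Ne.symm hj)
    · simp only [e, if_false]
      constructor
      · intro h; by_contra hc
        exact (h1 j e).2.2.2 j' hc h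
      · rintro rfl; exact (h1 _ e).2.2.1

lemma exists_t0 (Q : ℕ) (hQ : 1 ≤ Q) : ∃ t0 : ℕ, ∀ t, t0 ≤ t →
    (1 - 1 / (4 * (Q : ℝ))) ^ t * (4 * Q ^ 2 * (400 * t) ^ 2) ≤ (1 / 2) ^ (1000 * Q + 1) := by
  have hQ' : (1 : ℝ) ≤ Q := by exact_mod_cast hQ
  set c : ℝ := 1 - 1 / (4 * (Q : ℝ)) with hc
  have hpos : 0 < 1 / (4 * (Q : ℝ)) := by positivity
  have hle : 1 / (4 * (Q : ℝ)) ≤ 1 := by rw [div_le_one (by positivity)]; linarith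
  have habs : |c| < 1 := by rw [abs_lt]; constructor <;> linarith
  have ht := (tendsto_pow_const_mul_const_pow_of_abs_lt_one 2 habs).const_mul (4 * (Q : ℝ) ^ 2 * 400 ^ 2)
  rw [mul_zero] at ht
  have := ht.eventually_le_const (u := (1 / 2 : ℝ) ^ (1000 * Q + 1)) (by positivity)
  obtain ⟨t0, h0⟩ := Filter.eventually_atTop.1 this
  refine ⟨t0, fun t htt => le_trans (le_of_eq ?_) (h0 t htt)⟩
  ring

lemma caseE_outcome {k p m n : ℕ} {A : V → V → Prop} (hk : 1 ≤ k) (hp : p = 10 ^ 9 * k ^ 2) (hirr : ∀ v, ¬ A v v)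
    (hn : n = Fintype.card V)
    (hs : ∀ v, n + 2 * k ≤ 2 * (inN A v).card) (he : ∀ v, n + 2 * k ≤ 2 * (outN A v).card)
    (hm1 : 2 * p ^ 4 * m ≤ n) (hm2 : n ≤ 4 * p ^ 4 * m) (hmk : 100 * k + 100 ≤ m) (hN : ¬ NProp A m)
    (x : Fin k → V) (hx : Function.Injective x) (N : Fin k → ℕ) (i₀ : Fin k)
    (hN4 : ∀ i, 4 ≤ N i) (s : ℕ) (hsum : ∑ i ∈ Finset.univ.erase i₀, N i ≤ s) (hsm : 200 * s ≤ m) : Outcome A x N i₀ := by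
  have hp9 : 1000000000 ≤ p := by rw [hp]; nlinarith
  unfold NProp at hN
  push Not at hN
  obtain ⟨S, T, h1, h2, h3⟩ := hN
  have p2 : p ≤ p ^ 2 := by nlinarith
  have p3 : 1000000000 * p ^ 2 ≤ p ^ 3 := by
    calc 1000000000 * p ^ 2 ≤ p * p ^ 2 := Nat.mul_le_mul_right _ hp9
      _ = p ^ 3 := by ring
  have p4 : 1000000000 * p ^ 3 ≤ p ^ 4 := by
    calc 1000000000 * p ^ 3 ≤ p * p ^ 3 := Nat.mul_le_mul_right _ hp9
      _ = p ^ 4 := by ring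
  have mp3 : m ≤ p ^ 3 * m := Nat.le_mul_of_pos_left _ (by omega)
  obtain ⟨i, o, G, hstr⟩ := struct_E0 A S T m (2 * p ^ 2 * m) (10 * p ^ 3 * m)
    (fun v => by have := hs v; omega) (fun v => by have := he v; omega) h3 h1 h2
    (Nat.le_mul_of_pos_left _ (by omega))
    (by
      rw [← hn]
      calc m * n ≤ m * (4 * p ^ 4 * m) := Nat.mul_le_mul_left _ hm2
        _ = _ := by ring)
    (by
      rw [← hn]
      calc 12 * (2 * p ^ 2 * m * n) ≤ 12 * (2 * p ^ 2 * m * (4 * p ^ 4 * m)) := by gcongr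
        _ = 96 * (p ^ 6 * m ^ 2) := by ring
        _ ≤ 100 * (p ^ 6 * m ^ 2) := by omega
        _ = _ := by ring)
    (by
      calc 8 * (2 * p ^ 2 * m) = (16 * p ^ 2) * m := by ring
        _ ≤ (10 * p ^ 3) * m := Nat.mul_le_mul_right _ (by omega))
    (by
      rw [← hn]
      calc 2 * m + 2 * (2 * p ^ 2 * m) + 2 ≤ (4 + 4 * p ^ 2) * m := by nlinarith
        _ ≤ (2 * p ^ 4) * m := Nat.mul_le_mul_right _ (by omega)
        _ ≤ n := hm1)
  have hb : Base A i o G (10 * p ^ 3 * m) (10000 * (k * (11 * (10 * p ^ 3 * m)))) k := by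
    refine ⟨hstr, hirr, fun v => ?_, fun v => ?_, hk, ?_, ?_, ?_⟩
    · rw [← hn]; exact he v
    · rw [← hn]; exact hs v
    · rw [mul_assoc]; omega
    · exact Nat.mul_le_mul_left _ (Nat.mul_le_mul_left _ (Nat.le_mul_of_pos_left _ (by norm_num)))
    · rw [← hn]
      refine le_trans ?_ hm1
      calc 1000 * (k * (10000 * (k * (11 * (10 * p ^ 3 * m))))) = 1100000000 * (k ^ 2 * (p ^ 3 * m)) := by ring
        _ ≤ 2000000000 * (k ^ 2 * (p ^ 3 * m)) := by omega
        _ = 2 * (10 ^ 9 * k ^ 2) * (p ^ 3 * m) := by ring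
        _ = 2 * p * (p ^ 3 * m) := by rw [← hp]
        _ = 2 * p ^ 4 * m := by ring
  obtain ⟨G', hF⟩ := hb.shrink rfl le_rfl
  refine hF.outcome x hx N hN4 i₀ s hsum ?_ ?_ <;> rw [mul_assoc] <;> omega

lemma caseN_outcome {k Q m n : ℕ} {A : V → V → Prop} (hQ : 1 ≤ Q) (hirr : ∀ v, ¬ A v v)
    (hn : n = Fintype.card V)
    (hs : ∀ v, n + 2 * k ≤ 2 * (inN A v).card) (he : ∀ v, n + 2 * k ≤ 2 * (outN A v).card)
    (hm1 : Q * m ≤ n) (hQ3 : 3 ≤ Q) (hm2 : n ≤ 2 * Q * m) (hmk : 100 * k + 10000 ≤ m) (hN : NProp A m)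
    (t0 : ℕ) (ht0 : ∀ t, t0 ≤ t →
      (1 - 1 / (4 * (Q : ℝ))) ^ t * (4 * Q ^ 2 * (400 * t) ^ 2) ≤ (1 / 2) ^ (1000 * Q + 1)) (hmt : 200 * t0 ≤ m)
    (x : Fin k → V) (hx : Function.Injective x) (N : Fin k → ℕ) (i₀ : Fin k)
    (hN4 : ∀ i, 4 ≤ N i) (s : ℕ) (hsum : ∑ i ∈ Finset.univ.erase i₀, N i ≤ s) (hsm : 200 * s ≤ m) : Outcome A x N i₀ := by
  have h3m : 3 * m ≤ n := (Nat.mul_le_mul_right m hQ3).trans hm1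
  refine outcome_N (g := m) (t := m / 200) (R := 1000 * Q) (δ := m / 8) (ℓ := m / 100) (s := s) hirr hN
    (fun v => by have := hs v; omega) (fun v => by have := he v; omega) (by omega) x hx N i₀ hN4 hsum
    (by omega) (by omega) (by omega) ?_ ?_
  · rw [← hn]
    have h1 : m ≤ 200 * (m / 100) := by omega
    calc n ≤ 2 * Q * m := hm2
      _ ≤ 2 * Q * (200 * (m / 100)) := Nat.mul_le_mul_left _ h1
      _ = 400 * (Q * (m / 100)) := by ring
      _ < 1000 * (Q * (m / 100)) := by
        have : 0 < Q * (m / 100) := Nat.mul_pos (by omega) (by omega)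
        omega
      _ = _ := by ring
  · rw [← hn]
    set t := m / 200 with ht
    refine le_trans ?_ (ht0 t (by omega))
    have hnpos : (0 : ℝ) < n := by
      have : 0 < n := by omega
      exact_mod_cast this
    have hQpos : (0 : ℝ) < Q := by exact_mod_cast hQ
    have hm2' : (n : ℝ) ≤ 2 * Q * m := by exact_mod_cast hm2
    have hmt' : (m : ℝ) ≤ 400 * t := by
      have : m ≤ 400 * t := by omega
      exact_mod_cast this
    have h3m' : 3 * (m : ℝ) ≤ n := by exact_mod_cast h3m
    have a1 : 1 / (4 * (Q : ℝ)) ≤ (m : ℝ) / (2 * n) := by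
      rw [div_le_div_iff₀ (by positivity) (by positivity)]
      linarith
    have a2 : (m : ℝ) / (2 * n) ≤ 1 := by
      rw [div_le_one (by positivity)]
      have : (0 : ℝ) ≤ m := Nat.cast_nonneg _
      linarith
    have hn2 : (n : ℝ) ^ 2 ≤ 4 * Q ^ 2 * (400 * t) ^ 2 := by
      calc (n : ℝ) ^ 2 ≤ (2 * Q * (400 * t)) ^ 2 := by
            apply pow_le_pow_left₀ hnpos.le
            refine hm2'.trans ?_
            gcongr
        _ = _ := by ring
    have a3 : (1 - (m : ℝ) / (2 * n)) ^ t ≤ (1 - 1 / (4 * (Q : ℝ))) ^ t := by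
      apply pow_le_pow_left₀ <;> linarith
    have a4 : 0 ≤ (1 - (m : ℝ) / (2 * n)) ^ t := by apply pow_nonneg; linarith
    exact mul_le_mul a3 hn2 (by positivity) (a4.trans a3)
end final


/-- **Corollary (directed El-Zahar with prescribed vertices).** For every positive `k`
there are an integer `C₀` and constants `α, β ∈ (0,1)` such that the following holds.
Let `D` be a digraph on `n ≥ C₀ k` vertices with `δ⁰(D) ≥ n/2 + k` and let
`S = {x 0, …, x (k-1)}` be any `k` vertices of `D`.  Then for any integer partition
`n = n₁ + ⋯ + n_k` with each `nᵢ ≥ 4` and with the sum of those `nᵢ` smaller than `β n`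
at most `α n`, `D` contains `k` vertex-disjoint directed cycles `C₁, …, C_k` of lengths
`n₁, …, n_k` such that `V(Cᵢ) ∩ S = {x i}` for every `i`. -/
theorem disjoint_cycles_through_prescribed_vertices (k : ℕ) (hk : 1 ≤ k) :
    ∃ (C₀ : ℕ) (α β : ℝ), 0 < α ∧ α < 1 ∧ 0 < β ∧ β < 1 ∧
      ∀ (V : Type) [Fintype V] (A : V → V → Prop),
        (∀ v, ¬ A v v) →
        C₀ * k ≤ Fintype.card V →
        (∀ v : V, (Fintype.card V : ℝ) / 2 + k ≤ (outDeg A v : ℝ) ∧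
                  (Fintype.card V : ℝ) / 2 + k ≤ (inDeg A v : ℝ)) →
        ∀ x : Fin k → V, Function.Injective x →
          ∀ N : Fin k → ℕ,
            (∀ i, 4 ≤ N i) →
            (∑ i, N i) = Fintype.card V →
            (∑ i, if (N i : ℝ) < β * Fintype.card V then (N i : ℝ) else 0) ≤
              α * Fintype.card V →
            ∃ c : Fin k → List V,
              (∀ i, IsDicycleList A (c i)) ∧
              (∀ i, (c i).length = N i) ∧
              (∀ i j, i ≠ j → ∀ v ∈ c i, v ∉ c j) ∧
              (∀ i j, x j ∈ c i ↔ j = i) := by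
  set p : ℕ := 10 ^ 9 * k ^ 2 with hp
  set Q : ℕ := 2 * p ^ 4 with hQd
  have hp1 : 1 ≤ p := by rw [hp]; nlinarith
  have hp4 : 1 ≤ p ^ 4 := Nat.one_le_pow _ _ hp1
  have hp9 : 2 ≤ p ^ 4 := by
    have : 2 ≤ p := by rw [hp]; nlinarith
    calc 2 ≤ p := this
      _ ≤ p ^ 4 := Nat.le_self_pow (by norm_num) p
  have hQ3 : 3 ≤ Q := by omega
  obtain ⟨t0, ht0⟩ := exists_t0 Q (by omega)
  have hQR : (3 : ℝ) ≤ Q := by exact_mod_cast hQ3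
  refine ⟨Q * (200 * t0 + 100 * k + 10000), 1 / (400 * Q), 3 / 4, by positivity, ?_, by norm_num, by norm_num, ?_⟩
  · rw [div_lt_one (by positivity)]; linarith
  intro V _ A hirr hC hdeg x hx N hN4 hNsum hNα
  set n := Fintype.card V with hn
  have hC' : Q * (200 * t0 + 100 * k + 10000) ≤ n := (Nat.le_mul_of_pos_right _ (by omega)).trans hC
  set m := n / Q with hm
  have hmge : 200 * t0 + 100 * k + 10000 ≤ m := (Nat.le_div_iff_mul_le (by omega)).2 (by rw [mul_comm]; exact hC')
  have hm1 : Q * m ≤ n := Nat.mul_div_le n Q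
  have hm2 : n ≤ 2 * Q * m := by
    have h1 : n < Q * (m + 1) := Nat.lt_mul_div_succ n (by omega)
    have h2 : Q ≤ Q * m := Nat.le_mul_of_pos_right _ (by omega)
    have h3 : Q * (m + 1) = Q * m + Q := by ring
    have h4 : 2 * Q * m = 2 * (Q * m) := by ring
    omega
  have hnpos : 0 < n := by
    have : 3 * m ≤ Q * m := Nat.mul_le_mul_right _ hQ3
    omega
  have hnR : (0 : ℝ) < n := by exact_mod_cast hnpos
  have he : ∀ v, n + 2 * k ≤ 2 * (outN A v).card := by
    intro v
    have h1 := (hdeg v).1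
    have e : outDeg A v = (outN A v).card := by
      unfold outDeg
      rw [← Set.ncard_coe_finset]; congr 1; ext u; simp
    rw [e] at h1
    have : ((n + 2 * k : ℕ) : ℝ) ≤ ((2 * (outN A v).card : ℕ) : ℝ) := by push_cast; linarith
    exact_mod_cast this
  have hs : ∀ v, n + 2 * k ≤ 2 * (inN A v).card := by
    intro v
    have h1 := (hdeg v).2
    have e : inDeg A v = (inN A v).card := by
      unfold inDeg
      rw [← Set.ncard_coe_finset]; congr 1; ext u; simp
    rw [e] at h1
    have : ((n + 2 * k : ℕ) : ℝ) ≤ ((2 * (inN A v).card : ℕ) : ℝ) := by push_cast; linarith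
    exact_mod_cast this
  have hNR : ∑ j, (N j : ℝ) = n := by exact_mod_cast hNsum
  have hα1 : 1 / (400 * (Q : ℝ)) * n < n := by
    have : 1 / (400 * (Q : ℝ)) < 1 := by rw [div_lt_one (by positivity)]; linarith
    nlinarith
  obtain ⟨i₀, hi₀⟩ : ∃ i₀, (3 / 4 : ℝ) * n ≤ N i₀ := by
    by_contra hc
    push Not at hc
    simp only [hc, if_true] at hNα
    linarith
  have hsmall : ∑ j ∈ Finset.univ.erase i₀, (N j : ℝ) ≤ 1 / (400 * Q) * n := by
    refine le_trans ?_ hNα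
    rw [← Finset.add_sum_erase Finset.univ (fun i => if (N i : ℝ) < 3 / 4 * n then (N i : ℝ) else 0) (Finset.mem_univ i₀)]
    have e2 := Finset.add_sum_erase Finset.univ (fun j => (N j : ℝ)) (Finset.mem_univ i₀)
    simp only [hNR] at e2
    have h0 : (0 : ℝ) ≤ if (N i₀ : ℝ) < 3 / 4 * n then (N i₀ : ℝ) else 0 := by split_ifs <;> simp
    have e3 : ∑ j ∈ Finset.univ.erase i₀, (N j : ℝ) = ∑ j ∈ Finset.univ.erase i₀, (if (N j : ℝ) < 3 / 4 * n then (N j : ℝ) else 0) := by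
      refine Finset.sum_congr rfl fun j hj => ?_
      have := Finset.single_le_sum (f := fun j => (N j : ℝ)) (fun _ _ => Nat.cast_nonneg _) hj
      rw [if_pos]
      linarith
    rw [e3]
    simpa using h0
  have hsm : 200 * ∑ j ∈ Finset.univ.erase i₀, N j ≤ m := by
    have h1 : ((200 * ∑ j ∈ Finset.univ.erase i₀, N j : ℕ) : ℝ) ≤ m := by
      push_cast
      have h2 : (n : ℝ) ≤ 2 * Q * m := by exact_mod_cast hm2
      have h3 : 1 / (400 * (Q : ℝ)) * n ≤ 1 / (400 * (Q : ℝ)) * (2 * Q * m) := by gcongr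
      have h4 : 1 / (400 * (Q : ℝ)) * (2 * Q * m) = m / 200 := by field_simp; ring
      linarith
    exact_mod_cast h1
  apply outcome_final (i₀ := i₀) hx hNsum
  by_cases hNP : NProp A m
  · exact caseN_outcome (by omega) hirr hn hs he hm1 hQ3 hm2 (by omega) hNP t0 ht0 (by omega) x hx N i₀ hN4 _ le_rfl hsm
  · exact caseE_outcome hk hp hirr hn hs he hm1 (by rw [hQd] at hm2; linarith) (by omega) hNP x hx N i₀ hN4 _ le_rfl hsm
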